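/- arXiv:2511.09365 — 2 statements merged into one kernel-verified Lean document; each statement's English description precedes it below -/
import Mathlib

section
/- For every constant c ∈ (0,1) there exist constants c₁ > 0, C ≥ 1, C_c ≥ 1 and X₀ such that for every X ≥ X₀ the following holds. There is a function Λ̃ : [X, 2X) → ℝ_{≥0} with Λ̃(p) ≥ c₁·log X for all primes p ∈ [X, 2X) and 𝔼_{x∈[X,2X)} Λ̃(x) ≤ C, such that for any Q ∈ ℕ with Q ≤ log X there exist: a function Λ_per : ℤ → ℝ which is periodic with period Q! and satisfies 𝔼_{x∈[X,2X)} |Λ_per(x)| ≤ C·(log Q)^C and sup_x |Λ_per(x)| ≤ C·Q², together with finitely many functions g₁,…,g_m : [X,2X) → ℝ and a function h : [X,2X) → ℝ with Λ̃ − Λ_per = Σᵢ gᵢ + h on [X,2X), satisfying: (1) 𝔼_{x∈[X,2X)} |h(x)| ≤ C·Q^{−1}; (2) Σᵢ ‖gᵢ‖_∞ ≤ C_c·(log X)^{C_c}; (3) Σᵢ ‖ĝᵢ‖_∞^c · ‖gᵢ‖_∞^{1−c} ≤ C_c·X^c·Q^{−c/4}, where ‖f̂‖_∞ := sup_{θ∈ℝ/ℤ}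 |Σ_{x∈[X,2X)} f(x)·e(θx)|. -/
noncomputable section

open Finset

/-- `e(x) = exp(2πix)`. -/
def eC (x : ℝ) : ℂ := Complex.exp (2 * Real.pi * Complex.I * x)

/-- Uniform average of a real-valued function over a finite set. -/
def avgR {α : Type*} (s : Finset α) (f : α → ℝ) : ℝ := (∑ x ∈ s, f x) / s.card

/-- Sup norm of `f` on the finite set `s`. -/
def supOn (s : Finset ℕ) (f : ℕ → ℝ) : ℝ := ⨆ x ∈ s, |f x|

/-- `‖f̂‖_∞ = sup_θ |∑_{x ∈ s} f(x) e(θx)|`. -/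
def fourierSup (s : Finset ℕ) (f : ℕ → ℝ) : ℝ :=
  ⨆ θ : ℝ, ‖∑ x ∈ s, (f x : ℂ) * eC (θ * (x : ℝ))‖

lemma eC_add (x y : ℝ) : eC (x + y) = eC x * eC y := by
  rw [eC, eC, eC, ← Complex.exp_add]; congr 1; push_cast; ring

lemma eC_eq (x : ℝ) : eC x = Complex.exp (Complex.I * ((2 * Real.pi * x : ℝ) : ℂ)) := by
  rw [eC]; congr 1; push_cast; ring

lemma norm_eC (x : ℝ) : ‖eC x‖ = 1 := by
  rw [eC_eq, mul_comm, Complex.norm_exp_ofReal_mul_I]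

lemma eC_intCast (n : ℤ) : eC (n : ℝ) = 1 := by
  rw [eC, Complex.exp_eq_one_iff]; exact ⟨n, by push_cast; ring⟩

lemma eC_natCast (n : ℕ) : eC (n : ℝ) = 1 := by simpa using eC_intCast n

lemma eC_mul_natCast (x : ℝ) (n : ℕ) : eC (x * n) = eC x ^ n := by
  rw [eC, eC, ← Complex.exp_nat_mul]; congr 1; push_cast; ring

lemma eC_eq_one_iff (x : ℝ) : eC x = 1 ↔ ∃ n : ℤ, x = n := by
  rw [eC, Complex.exp_eq_one_iff]
  constructor
  · rintro ⟨n, hn⟩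
    refine ⟨n, ?_⟩
    have h2 : (2 * Real.pi * Complex.I : ℂ) ≠ 0 := Complex.two_pi_I_ne_zero
    have : (x : ℂ) = n := by
      apply mul_left_cancel₀ h2
      rw [hn]; ring
    exact_mod_cast this
  · rintro ⟨n, rfl⟩; exact ⟨n, by push_cast; ring⟩

lemma four_mul_le_norm_eC_sub_one {x δ : ℝ} (h : ∀ z : ℤ, δ ≤ |x - z|) :
    4 * δ ≤ ‖eC x - 1‖ := by
  set y : ℝ := x - round x with hy
  have hxy : eC x = eC y := by
    have : x = y + (round x : ℤ) := by rw [hy]; ring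
    conv_lhs => rw [this, eC_add, eC_intCast, mul_one]
  have hy2 : |y| ≤ 1 / 2 := abs_sub_round x
  rw [hxy, eC_eq, Complex.norm_exp_I_mul_ofReal_sub_one, Real.norm_eq_abs, abs_mul, abs_two]
  have hπ := Real.pi_pos
  have h3 : 2 * Real.pi * y / 2 = Real.pi * y := by ring
  have := Real.mul_abs_le_abs_sin (x := 2 * Real.pi * y / 2) (by
    rw [h3, abs_mul, abs_of_pos hπ]; nlinarith)
  rw [h3, abs_mul, abs_of_pos hπ] at this
  rw [h3]
  have h4 : 2 / Real.pi * (Real.pi * |y|) = 2 * |y| := by field_simp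
  have h5 := h (round x)
  rw [h4] at this
  linarith

lemma norm_sum_Ico_eC_le {α δ : ℝ} (hδ : 0 < δ) (h : ∀ z : ℤ, δ ≤ |α - z|) (a b : ℕ) :
    ‖∑ k ∈ Ico a b, eC (α * k)‖ ≤ 1 / (2 * δ) := by
  have h4 := four_mul_le_norm_eC_sub_one h
  have hpos : 0 < ‖eC α - 1‖ := by linarith
  have hne : eC α ≠ 1 := fun h0 => by simp [h0] at hpos
  rcases le_or_gt a b with hab | hab
  · simp only [eC_mul_natCast]
    rw [geom_sum_Ico hne hab, norm_div, div_le_div_iff₀ hpos (by positivity)]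
    have : ‖eC α ^ b - eC α ^ a‖ ≤ 2 := by
      refine (norm_sub_le _ _).trans ?_
      simp only [norm_pow, norm_eC, one_pow]; norm_num
    nlinarith [norm_nonneg (eC α ^ b - eC α ^ a)]
  · rw [Ico_eq_empty (by omega)]; simp; positivity

/-- The multiples of `m` in `[X, 2 * X)`. -/
lemma sum_Ico_dvd {M : Type*} [AddCommMonoid M] (X : ℕ) {m : ℕ} (hm : 0 < m) (F : ℕ → M) :
    ∑ n ∈ Ico X (2 * X), (if m ∣ n then F n else 0) =
      ∑ k ∈ Ico (X ⌈/⌉ m) ((2 * X) ⌈/⌉ m), F (m * k) := by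
  rw [← sum_filter]
  symm
  refine sum_bij (fun k _ => m * k) ?_ ?_ ?_ ?_
  · intro k hk
    rw [mem_Ico] at hk
    rw [mem_filter, mem_Ico]
    refine ⟨⟨?_, ?_⟩, dvd_mul_right _ _⟩
    · exact (ceilDiv_le_iff_le_mul hm).1 hk.1
    · by_contra hcon
      push Not at hcon
      have := (ceilDiv_le_iff_le_mul (b := 2 * X) (c := k) hm).2 hcon
      omega
  · intro a _ b _ hab
    exact Nat.eq_of_mul_eq_mul_left hm hab
  · intro n hn
    rw [mem_filter, mem_Ico] at hn
    obtain ⟨⟨h1, h2⟩, k, rfl⟩ := hn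
    refine ⟨k, ?_, rfl⟩
    rw [mem_Ico]
    refine ⟨(ceilDiv_le_iff_le_mul hm).2 h1, ?_⟩
    by_contra hcon
    push Not at hcon
    have := (ceilDiv_le_iff_le_mul (b := 2 * X) (c := k) hm).1 hcon
    omega
  · intros; rfl

/-- The number of multiples of `m` in `[X, 2 * X)`. -/
def countDvd (X m : ℕ) : ℝ := ∑ n ∈ Ico X (2 * X), if m ∣ n then (1 : ℝ) else 0

lemma abs_ceilDiv_sub_lt (X : ℕ) {m : ℕ} (hm : 0 < m) :
    (X : ℝ) / m ≤ ((X ⌈/⌉ m : ℕ) : ℝ) ∧ ((X ⌈/⌉ m : ℕ) : ℝ) < (X : ℝ) / m + 1 := by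
  have hm' : (0 : ℝ) < m := by exact_mod_cast hm
  constructor
  · rw [div_le_iff₀ hm']
    have := (ceilDiv_le_iff_le_mul (b := X) (c := X ⌈/⌉ m) hm).1 le_rfl
    rw [mul_comm]
    exact_mod_cast this
  · have h1 : m * (X ⌈/⌉ m) < X + m := by
      rw [Nat.ceilDiv_eq_add_pred_div]
      have := Nat.mul_div_le (X + m - 1) m
      omega
    have h2 : (m : ℝ) * ((X ⌈/⌉ m : ℕ) : ℝ) < X + m := by exact_mod_cast h1
    have h3 : (X : ℝ) / m + 1 = (X + m) / m := by field_simp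
    rw [h3, lt_div_iff₀ hm']; linarith

lemma countDvd_eq (X : ℕ) {m : ℕ} (hm : 0 < m) :
    countDvd X m = (((2 * X) ⌈/⌉ m : ℕ) : ℝ) - ((X ⌈/⌉ m : ℕ) : ℝ) := by
  rw [countDvd, sum_Ico_dvd X hm]
  have : X ⌈/⌉ m ≤ (2 * X) ⌈/⌉ m := by
    rw [ceilDiv_le_iff_le_mul hm]
    have := (ceilDiv_le_iff_le_mul (b := 2 * X) (c := (2 * X) ⌈/⌉ m) hm).1 le_rfl
    omega
  simp [Nat.cast_sub this]

lemma abs_countDvd_sub_le (X : ℕ) {m : ℕ} (hm : 0 < m) :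
    |countDvd X m - X / m| ≤ 1 := by
  rw [countDvd_eq X hm, abs_le]
  have h1 := abs_ceilDiv_sub_lt X hm
  have h2 := abs_ceilDiv_sub_lt (2 * X) hm
  have h3 : ((2 * X : ℕ) : ℝ) / m = 2 * ((X : ℝ) / m) := by push_cast; ring
  rw [h3] at h2
  constructor <;> linarith

lemma countDvd_le (X : ℕ) {m : ℕ} (hm : 0 < m) : countDvd X m ≤ 2 * X / m := by
  have hm' : (0 : ℝ) < m := by exact_mod_cast hm
  rcases le_or_gt m X with h | h
  · have h1 := (abs_le.1 (abs_countDvd_sub_le X hm)).2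
    have : (1 : ℝ) ≤ X / m := by
      rw [le_div_iff₀ hm', one_mul]; exact_mod_cast h
    have : (2 * X / m : ℝ) = X / m + X / m := by ring
    linarith
  · rcases Nat.eq_zero_or_pos X with rfl | hX
    · simp [countDvd]
    rw [countDvd_eq X hm]
    have ha : 1 ≤ X ⌈/⌉ m := by
      by_contra hcon
      have : X ⌈/⌉ m ≤ 0 := by omega
      rw [ceilDiv_le_iff_le_mul hm] at this
      omega
    have ha' : (1 : ℝ) ≤ ((X ⌈/⌉ m : ℕ) : ℝ) := by exact_mod_cast ha
    rcases le_or_gt (2 * X) m with h2 | h2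
    · have : (2 * X) ⌈/⌉ m ≤ 1 := by rw [ceilDiv_le_iff_le_mul hm]; omega
      have : (((2 * X) ⌈/⌉ m : ℕ) : ℝ) ≤ 1 := by exact_mod_cast this
      have : (0 : ℝ) ≤ 2 * X / m := by positivity
      linarith
    · have : (2 * X) ⌈/⌉ m ≤ 2 := by rw [ceilDiv_le_iff_le_mul hm]; omega
      have : (((2 * X) ⌈/⌉ m : ℕ) : ℝ) ≤ 2 := by exact_mod_cast this
      have : (1 : ℝ) ≤ 2 * X / m := by
        rw [le_div_iff₀ hm', one_mul]; exact_mod_cast h2.le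
      linarith

/-- The exponential sum over multiples of `m` in `[X, 2 * X)`. -/
def expSumDvd (X m : ℕ) (θ : ℝ) : ℂ :=
  ∑ n ∈ Ico X (2 * X), if m ∣ n then eC (θ * n) else 0

lemma norm_expSumDvd_le_count (X m : ℕ) (θ : ℝ) : ‖expSumDvd X m θ‖ ≤ countDvd X m := by
  refine (norm_sum_le _ _).trans (sum_le_sum fun n _ => ?_)
  split_ifs <;> simp [norm_eC]

lemma norm_expSumDvd_le (X : ℕ) {m : ℕ} (hm : 0 < m) {θ δ : ℝ} (hδ : 0 < δ)
    (h : ∀ z : ℤ, δ ≤ |m * θ - z|) : ‖expSumDvd X m θ‖ ≤ 1 / (2 * δ) := by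
  rw [expSumDvd, sum_Ico_dvd X hm]
  have := norm_sum_Ico_eC_le hδ h (X ⌈/⌉ m) ((2 * X) ⌈/⌉ m)
  convert this using 4
  push_cast; ring

lemma sum_eC_div {d : ℕ} (hd : 0 < d) (k : ℕ) :
    ∑ b ∈ range d, eC ((b : ℝ) / d * k) = if d ∣ k then (d : ℂ) else 0 := by
  have hd' : (d : ℝ) ≠ 0 := by exact_mod_cast hd.ne'
  have h1 : ∀ b : ℕ, eC ((b : ℝ) / d * k) = eC ((k : ℝ) / d) ^ b := by
    intro b; rw [← eC_mul_natCast]; congr 1; ring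
  simp only [h1]
  split_ifs with h
  · obtain ⟨c, rfl⟩ := h
    have : ((d * c : ℕ) : ℝ) / d = (c : ℕ) := by push_cast; field_simp
    rw [this, eC_natCast]; simp
  · have hne : eC ((k : ℝ) / d) ≠ 1 := by
      rw [Ne, eC_eq_one_iff]
      rintro ⟨n, hn⟩
      rw [div_eq_iff hd'] at hn
      have : (k : ℤ) = n * d := by exact_mod_cast hn
      exact h (by exact_mod_cast (Dvd.intro_left n this.symm))
    rw [geom_sum_eq hne, ← eC_mul_natCast, div_mul_cancel₀ _ hd', eC_natCast]
    simp

lemma expSumDvd_mul (X : ℕ) {e d : ℕ} (he : 0 < e) (hd : 0 < d) (θ : ℝ) :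
    (d : ℂ) * expSumDvd X (e * d) θ = ∑ b ∈ range d, expSumDvd X e (θ + b / (e * d)) := by
  have he' : (e : ℝ) ≠ 0 := by exact_mod_cast he.ne'
  have hd' : (d : ℝ) ≠ 0 := by exact_mod_cast hd.ne'
  simp only [expSumDvd]
  rw [sum_comm, mul_sum]
  refine sum_congr rfl fun n _ => ?_
  by_cases hen : e ∣ n
  · obtain ⟨k, rfl⟩ := hen
    simp only [dvd_mul_right, if_true]
    have : ∀ b : ℕ, eC ((θ + b / (e * d)) * ((e * k : ℕ) : ℝ)) =
        eC (θ * ((e * k : ℕ) : ℝ)) * eC ((b : ℝ) / d * k) := by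
      intro b; rw [← eC_add]; congr 1; push_cast; field_simp
    simp only [this]
    rw [← mul_sum, sum_eC_div hd]
    by_cases hdk : d ∣ k
    · rw [if_pos hdk, if_pos (Nat.mul_dvd_mul_left e hdk)]; ring
    · rw [if_neg hdk, if_neg (fun h => hdk (Nat.dvd_of_mul_dvd_mul_left he h))]; simp
  · have : ¬ e * d ∣ n := fun h => hen (dvd_of_mul_right_dvd h)
    simp [hen, this]

lemma inv_den_le_abs_sub {q : ℚ} {m : ℕ} (h : ¬ q.den ∣ m) (z : ℤ) :
    1 / (q.den : ℝ) ≤ |m * (q : ℝ) - z| := by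
  have hd : (0 : ℝ) < q.den := by exact_mod_cast q.den_pos
  have hq : (q : ℝ) = q.num / q.den := by exact_mod_cast (Rat.num_div_den q).symm
  have hne : (m : ℤ) * q.num - z * q.den ≠ 0 := by
    intro h0
    have h1 : (q.den : ℤ) ∣ m * q.num := ⟨z, by linarith⟩
    have h2 : IsCoprime (q.den : ℤ) q.num := by
      rw [Int.isCoprime_iff_gcd_eq_one]
      have := q.reduced
      rw [Nat.Coprime, Nat.gcd_comm] at this
      simpa [Int.gcd] using this
    exact h (by exact_mod_cast h2.dvd_of_dvd_mul_right h1)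
  have h1 : (1 : ℝ) ≤ |(((m : ℤ) * q.num - z * q.den : ℤ) : ℝ)| := by
    rw [← Int.cast_abs]; exact_mod_cast Int.one_le_abs hne
  have h2 : (m : ℝ) * q - z = (((m : ℤ) * q.num - z * q.den : ℤ) : ℝ) / q.den := by
    rw [hq]; push_cast; field_simp
  rw [h2, abs_div, abs_of_pos hd]
  gcongr

lemma norm_expSumDvd_le_of_not_dvd (X : ℕ) {N T m : ℕ} (hm : 0 < m) (hmT : m ≤ T)
    (hTN : 2 * T ≤ N) {θ : ℝ} {q : ℚ} (hq : |θ - q| ≤ 1 / ((N + 1) * q.den))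
    (hqN : q.den ≤ N) (h : ¬ q.den ∣ m) : ‖expSumDvd X m θ‖ ≤ N := by
  have hd : (0 : ℝ) < q.den := by exact_mod_cast q.den_pos
  have hN : (0 : ℝ) < N := by
    have : 0 < N := lt_of_lt_of_le q.den_pos hqN
    exact_mod_cast this
  have key : ∀ z : ℤ, 1 / (2 * (N : ℝ)) ≤ |m * θ - z| := by
    intro z
    have h1 := inv_den_le_abs_sub h z
    have h2 : |m * (q : ℝ) - z| ≤ |m * θ - z| + m * |θ - q| := by
      have : (m : ℝ) * q - z = (m * θ - z) - m * (θ - q) := by ring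
      rw [this]
      refine (abs_sub _ _).trans ?_
      rw [abs_mul, Nat.abs_cast]
    have h3 : m * |θ - q| ≤ 1 / 2 * (1 / (q.den : ℝ)) := by
      have hmN : (m : ℝ) ≤ 1 / 2 * (N + 1) := by
        have : 2 * m ≤ N + 1 := by omega
        have : (2 * m : ℝ) ≤ N + 1 := by exact_mod_cast this
        linarith
      calc m * |θ - q| ≤ (1 / 2 * (N + 1)) * (1 / ((N + 1) * q.den)) := by gcongr
        _ = _ := by field_simp
    have h4 : 1 / (N : ℝ) ≤ 1 / q.den := by
      apply one_div_le_one_div_of_le hd; exact_mod_cast hqN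
    have h5 : 1 / (2 * (N : ℝ)) = 1 / 2 * (1 / N) := by field_simp
    linarith
  refine (norm_expSumDvd_le X hm (by positivity) key).trans (le_of_eq ?_)
  field_simp

lemma norm_expSumDvd_sub_le_of_dvd (X : ℕ) {N T e d : ℕ} (he : 0 < e) (hd : 0 < d)
    (hT : e * d ≤ T) (hTN : 2 * T ^ 2 ≤ N) {θ : ℝ} {q : ℚ}
    (hq : |θ - q| ≤ 1 / ((N + 1) * q.den)) (h : q.den ∣ e) :
    ‖expSumDvd X (e * d) θ - expSumDvd X e θ / d‖ ≤ N := by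
  have hd' : (0 : ℝ) < d := by exact_mod_cast hd
  have he' : (0 : ℝ) < e := by exact_mod_cast he
  have hT0 : 0 < T := lt_of_lt_of_le (Nat.mul_pos he hd) hT
  have hT' : (0 : ℝ) < T := by exact_mod_cast hT0
  have hqd : (1 : ℝ) ≤ q.den := by exact_mod_cast q.den_pos
  have hTN' : (2 * T ^ 2 : ℝ) ≤ N := by exact_mod_cast hTN
  have hN : (0 : ℝ) < N := lt_of_lt_of_le (by positivity) hTN'
  have hdC : (d : ℂ) ≠ 0 := by exact_mod_cast hd.ne'
  have heT : (e : ℝ) ≤ T := by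
    have : e ≤ T := le_trans (Nat.le_mul_of_pos_right e hd) hT
    exact_mod_cast this
  have hdT : (d : ℝ) ≤ T := by
    have : d ≤ T := le_trans (Nat.le_mul_of_pos_left d he) hT
    exact_mod_cast this
  have h1 : (d : ℂ) * (expSumDvd X (e * d) θ - expSumDvd X e θ / d) =
      ∑ b ∈ Ico 1 d, expSumDvd X e (θ + b / (e * d)) := by
    rw [mul_sub, expSumDvd_mul X he hd, mul_div_cancel₀ _ hdC, range_eq_Ico,
      sum_eq_sum_Ico_succ_bot hd]
    simp
  have h2 : ∀ b ∈ Ico 1 d, ‖expSumDvd X e (θ + b / (e * d))‖ ≤ N := by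
    intro b hb
    rw [mem_Ico] at hb
    have key : ∀ z : ℤ, 1 / (2 * (N : ℝ)) ≤ |e * (θ + b / (e * d)) - z| := by
      intro z
      obtain ⟨f, hf⟩ := h
      have hqf : (e : ℝ) * q = (f * q.num : ℤ) := by
        have hqq : (q : ℝ) = q.num / q.den := by exact_mod_cast (Rat.num_div_den q).symm
        rw [hf, hqq]; push_cast; field_simp
      set z' : ℤ := z - f * q.num with hz'
      have h3 : (e : ℝ) * (θ + b / (e * d)) - z = ((b : ℝ) / d - z') + e * (θ - q) := by
        have : (z' : ℝ) = z - e * q := by rw [hqf, hz']; push_cast; ring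
        rw [this]; field_simp; ring
      have h4 : 1 / (d : ℝ) ≤ |(b : ℝ) / d - z'| := by
        have hne : (b : ℤ) - z' * d ≠ 0 := by
          intro h0
          have h5 : (d : ℤ) ∣ b := ⟨z', by linarith⟩
          have h6 : d ∣ b := by exact_mod_cast h5
          have := Nat.le_of_dvd (by omega) h6
          omega
        have h1 : (1 : ℝ) ≤ |(((b : ℤ) - z' * d : ℤ) : ℝ)| := by
          rw [← Int.cast_abs]; exact_mod_cast Int.one_le_abs hne
        have h2 : (b : ℝ) / d - z' = (((b : ℤ) - z' * d : ℤ) : ℝ) / d := by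
          push_cast; field_simp
        rw [h2, abs_div, abs_of_pos hd']
        gcongr
      have h5 : |(e : ℝ) * (θ - q)| ≤ T / N := by
        rw [abs_mul, Nat.abs_cast]
        calc (e : ℝ) * |θ - q| ≤ T * (1 / ((N + 1) * q.den)) := by gcongr
          _ ≤ T * (1 / N) := by
            gcongr
            nlinarith
          _ = _ := by ring
      have h6 : 1 / (T : ℝ) ≤ 1 / d := one_div_le_one_div_of_le hd' hdT
      have h7 : (T : ℝ) / N ≤ 1 / 2 * (1 / T) := by
        rw [div_le_iff₀ hN]
        have : 1 / 2 * (1 / (T : ℝ)) * N ≥ 1 / 2 * (1 / (T : ℝ)) * (2 * T ^ 2) := by gcongr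
        have h8 : 1 / 2 * (1 / (T : ℝ)) * (2 * T ^ 2) = T := by field_simp
        linarith
      have h9 : 1 / (2 * (N : ℝ)) ≤ 1 / 2 * (1 / T) := by
        have : 1 / 2 * (1 / (T : ℝ)) = 1 / (2 * T) := by field_simp
        rw [this]
        apply one_div_le_one_div_of_le (by positivity)
        have : (1 : ℝ) ≤ T := by exact_mod_cast hT0
        nlinarith
      rw [h3]
      have h10 := abs_sub_abs_le_abs_sub ((b : ℝ) / d - z') (-(e * (θ - q)))
      rw [sub_neg_eq_add, abs_neg] at h10
      linarith
    refine (norm_expSumDvd_le X he (by positivity) key).trans (le_of_eq ?_)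
    field_simp
  have h3 : (d : ℝ) * ‖expSumDvd X (e * d) θ - expSumDvd X e θ / d‖ ≤ d * N := by
    have : (d : ℝ) * ‖expSumDvd X (e * d) θ - expSumDvd X e θ / d‖ =
        ‖(d : ℂ) * (expSumDvd X (e * d) θ - expSumDvd X e θ / d)‖ := by simp
    rw [this, h1]
    refine (norm_sum_le _ _).trans ((sum_le_card_nsmul _ _ _ h2).trans ?_)
    rw [nsmul_eq_mul, Nat.card_Ico]
    gcongr
    omega
  exact le_of_mul_le_mul_left h3 hd'

lemma norm_expSumDvd_sub_le (X : ℕ) {N T e d : ℕ} (he : 0 < e) (hd : 0 < d)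
    (hT : e * d ≤ T) (hTN : 2 * T ^ 2 ≤ N) {θ : ℝ} {q : ℚ}
    (hq : |θ - q| ≤ 1 / ((N + 1) * q.den)) (hqN : q.den ≤ N) :
    ‖expSumDvd X (e * d) θ - expSumDvd X e θ / d‖ ≤
      2 * N + if ¬ q.den ∣ e ∧ q.den ∣ e * d then 2 * X / ((e : ℝ) * d) else 0 := by
  have hN0 : (0 : ℝ) ≤ N := Nat.cast_nonneg N
  have hed : 0 < e * d := Nat.mul_pos he hd
  have heT : e ≤ T := le_trans (Nat.le_mul_of_pos_right e hd) hT
  have hTN2 : 2 * T ≤ N := le_trans (by nlinarith) hTN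
  by_cases h1 : q.den ∣ e
  · rw [if_neg (by tauto)]
    have := norm_expSumDvd_sub_le_of_dvd X he hd hT hTN hq h1
    linarith
  · have h2 : ‖expSumDvd X e θ / d‖ ≤ N := by
      rw [norm_div, Complex.norm_natCast]
      have h3 := norm_expSumDvd_le_of_not_dvd X he heT hTN2 hq hqN h1
      refine (div_le_self (norm_nonneg _) ?_).trans h3
      exact_mod_cast hd
    refine (norm_sub_le _ _).trans ?_
    by_cases h3 : q.den ∣ e * d
    · rw [if_pos ⟨h1, h3⟩]
      have h4 := (norm_expSumDvd_le_count X (e * d) θ).trans (countDvd_le X hed)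
      push_cast at h4
      linarith
    · rw [if_neg (by tauto)]
      have h4 := norm_expSumDvd_le_of_not_dvd X hed hT hTN2 hq hqN h3
      linarith

lemma norm_expSumDvd_sub_le_trivial (X : ℕ) {e d : ℕ} (he : 0 < e) (hd : 0 < d) (θ : ℝ) :
    ‖expSumDvd X (e * d) θ - expSumDvd X e θ / d‖ ≤ 4 * X / ((e : ℝ) * d) := by
  have h1 := (norm_expSumDvd_le_count X (e * d) θ).trans (countDvd_le X (Nat.mul_pos he hd))
  have h2 := (norm_expSumDvd_le_count X e θ).trans (countDvd_le X he)
  have hd' : (0 : ℝ) < d := by exact_mod_cast hd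
  have h3 : ‖expSumDvd X e θ / d‖ ≤ 2 * X / ((e : ℝ) * d) := by
    rw [norm_div, Complex.norm_natCast, div_le_iff₀ hd']
    refine h2.trans (le_of_eq ?_)
    field_simp
  push_cast at h1
  refine (norm_sub_le _ _).trans ?_
  have : 4 * X / ((e : ℝ) * d) = 2 * X / ((e : ℝ) * d) + 2 * X / ((e : ℝ) * d) := by ring
  linarith

lemma sum_divisors_moebius (n : ℕ) :
    ∑ e ∈ n.divisors, ArithmeticFunction.moebius e = if n = 1 then 1 else 0 := by
  rw [← ArithmeticFunction.coe_zeta_mul_apply, ArithmeticFunction.coe_zeta_mul_moebius,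
    ArithmeticFunction.one_apply]

/-- `1` if `n` is coprime to `P` and `0` otherwise. -/
def coprimeInd (P n : ℕ) : ℝ := if n.Coprime P then 1 else 0

lemma sum_moebius_dvd {P : ℕ} (hP : P ≠ 0) (n : ℕ) :
    ∑ e ∈ P.divisors, (if e ∣ n then (ArithmeticFunction.moebius e : ℝ) else 0) =
      coprimeInd P n := by
  rw [← sum_filter]
  have h1 : P.divisors.filter (· ∣ n) = (n.gcd P).divisors := by
    ext e
    simp only [mem_filter, Nat.mem_divisors, Nat.dvd_gcd_iff]
    have : n.gcd P ≠ 0 := Nat.gcd_ne_zero_right hP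
    tauto
  rw [h1]
  rw [← Int.cast_sum, sum_divisors_moebius, coprimeInd]
  simp [Nat.Coprime]

/-- The main bound for the exponential sum of a sifted combination of `1_{d ∣ n} - 1 / d`. -/
lemma norm_expSum_sifted_le {ι : Type*} {X N T w P : ℕ} (hP0 : P ≠ 0)
    (hP : ∀ p, p.Prime → p ∣ P → p < w) (hTN : 2 * T ^ 2 ≤ N) (hN : 0 < N) (D : Finset ι) (d : ι → ℕ)
    (ρ : ι → ℝ) (hd0 : ∀ i ∈ D, 0 < d i)
    (hd : ∀ i ∈ D, ∀ p, p.Prime → p ∣ d i → w ≤ p) {M : ℝ}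
    (hM0 : 0 ≤ M)
    (hM : ∀ p, p.Prime → w ≤ p → ∑ i ∈ D with p ∣ d i, |ρ i| / d i ≤ M) (θ : ℝ) :
    ‖∑ n ∈ Ico X (2 * X), ((coprimeInd P n *
        ∑ i ∈ D, ρ i * ((if d i ∣ n then 1 else 0) - 1 / (d i : ℝ)) : ℝ) : ℂ) * eC (θ * n)‖ ≤
      (∑ e ∈ P.divisors, 1 / (e : ℝ)) * (2 * N * T * ∑ i ∈ D, |ρ i| / d i + 2 * X * M) +
        4 * X * ∑ e ∈ P.divisors, ∑ i ∈ D with T < e * d i, |ρ i| / ((e : ℝ) * d i) := by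
  have hcop : ∀ e ∈ P.divisors, ∀ i ∈ D, e.Coprime (d i) := by
    intro e he i hi
    refine Nat.Coprime.symm (Nat.Coprime.coprime_dvd_right (Nat.dvd_of_mem_divisors he) ?_)
    refine Nat.coprime_of_dvd fun p hp h1 h2 => ?_
    have := hP p hp h2
    have := hd i hi p hp h1
    omega
  have hmain : ∑ n ∈ Ico X (2 * X), ((coprimeInd P n *
        ∑ i ∈ D, ρ i * ((if d i ∣ n then 1 else 0) - 1 / (d i : ℝ)) : ℝ) : ℂ) * eC (θ * n) =
      ∑ e ∈ P.divisors, ∑ i ∈ D, ((ArithmeticFunction.moebius e : ℝ) * ρ i : ℂ) *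
        (expSumDvd X (e * d i) θ - expSumDvd X e θ / d i) := by
    have : ∀ n ∈ Ico X (2 * X), ((coprimeInd P n *
        ∑ i ∈ D, ρ i * ((if d i ∣ n then 1 else 0) - 1 / (d i : ℝ)) : ℝ) : ℂ) * eC (θ * n) =
        ∑ e ∈ P.divisors, ∑ i ∈ D, ((ArithmeticFunction.moebius e : ℝ) * ρ i : ℂ) *
        ((if e * d i ∣ n then eC (θ * n) else 0) -
          (if e ∣ n then eC (θ * n) else 0) / d i) := by
      intro n _
      rw [← sum_moebius_dvd hP0, sum_mul_sum]
      push_cast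
      rw [sum_mul]
      refine sum_congr rfl fun e he => ?_
      rw [sum_mul]
      refine sum_congr rfl fun i hi => ?_
      have h1 : (e * d i ∣ n) ↔ (e ∣ n ∧ d i ∣ n) :=
        ⟨fun h => ⟨dvd_of_mul_right_dvd h, dvd_of_mul_left_dvd h⟩,
          fun h => (hcop e he i hi).mul_dvd_of_dvd_of_dvd h.1 h.2⟩
      by_cases h2 : e ∣ n <;> by_cases h3 : d i ∣ n <;> simp [h1, h2, h3] <;> ring
    rw [sum_congr rfl this, sum_comm]
    refine sum_congr rfl fun e _ => ?_
    rw [sum_comm]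
    refine sum_congr rfl fun i _ => ?_
    rw [← mul_sum, sum_sub_distrib, ← sum_div, expSumDvd, expSumDvd]
  rw [hmain]
  obtain ⟨q, hq, hqN⟩ := Real.exists_rat_abs_sub_le_and_den_le θ hN
  have hterm : ∀ e ∈ P.divisors, ∀ i ∈ D,
      ‖((ArithmeticFunction.moebius e : ℝ) * ρ i : ℂ) *
        (expSumDvd X (e * d i) θ - expSumDvd X e θ / d i)‖ ≤
      2 * N * T * (1 / (e : ℝ) * (|ρ i| / d i)) +
      (2 * X * (1 / (e : ℝ))) *
        (if ¬ q.den ∣ e ∧ q.den ∣ e * d i then |ρ i| / d i else 0) +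
      4 * X * (if T < e * d i then |ρ i| / ((e : ℝ) * d i) else 0) := by
    intro e he i hi
    have he0 : 0 < e := Nat.pos_of_mem_divisors he
    have hi0 := hd0 i hi
    have he' : (0 : ℝ) < e := by exact_mod_cast he0
    have hi' : (0 : ℝ) < d i := by exact_mod_cast hi0
    have hμ : |(ArithmeticFunction.moebius e : ℝ)| ≤ 1 := by
      exact_mod_cast ArithmeticFunction.abs_moebius_le_one (n := e)
    rw [norm_mul, norm_mul, Complex.norm_real, Complex.norm_real, Real.norm_eq_abs,
      Real.norm_eq_abs]
    refine (mul_le_mul_of_nonneg_right (mul_le_of_le_one_left (abs_nonneg _) hμ)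
      (norm_nonneg _)).trans ?_
    have hρ := abs_nonneg (ρ i)
    by_cases hT : T < e * d i
    · rw [if_pos hT]
      have h1 := norm_expSumDvd_sub_le_trivial X he0 hi0 θ
      have h2 : |ρ i| * ‖expSumDvd X (e * d i) θ - expSumDvd X e θ / d i‖ ≤
          |ρ i| * (4 * X / ((e : ℝ) * d i)) := by gcongr
      have h3 : |ρ i| * (4 * X / ((e : ℝ) * d i)) = 4 * X * (|ρ i| / ((e : ℝ) * d i)) := by ring
      have h4 : 0 ≤ 2 * N * T * (1 / (e : ℝ) * (|ρ i| / d i)) := by positivity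
      have h5 : 0 ≤ (2 * X * (1 / (e : ℝ))) *
          (if ¬ q.den ∣ e ∧ q.den ∣ e * d i then |ρ i| / d i else 0) := by
        split_ifs <;> positivity
      linarith
    · rw [if_neg hT, mul_zero, add_zero]
      push Not at hT
      have h1 := norm_expSumDvd_sub_le X he0 hi0 hT hTN hq hqN
      have h2 : |ρ i| * ‖expSumDvd X (e * d i) θ - expSumDvd X e θ / d i‖ ≤
          |ρ i| * (2 * N + if ¬ q.den ∣ e ∧ q.den ∣ e * d i then 2 * X / ((e : ℝ) * d i) else 0) := by
        gcongr
      refine h2.trans ?_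
      rw [mul_add]
      refine add_le_add ?_ (le_of_eq ?_)
      · have h3 : (1 : ℝ) ≤ T * (1 / (e : ℝ) * (1 / d i)) := by
          have : (e * d i : ℝ) ≤ T := by exact_mod_cast hT
          have h4 : (T : ℝ) * (1 / (e : ℝ) * (1 / d i)) = T / (e * d i) := by field_simp
          rwa [h4, le_div_iff₀ (by positivity), one_mul]
        calc |ρ i| * (2 * N) = |ρ i| * (2 * N) * 1 := by ring
          _ ≤ |ρ i| * (2 * N) * (T * (1 / (e : ℝ) * (1 / d i))) := by gcongr
          _ = _ := by ring
      · split_ifs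
        · field_simp
        · simp
  have hbad : ∀ e ∈ P.divisors,
      ∑ i ∈ D, (if ¬ q.den ∣ e ∧ q.den ∣ e * d i then |ρ i| / d i else 0) ≤ M := by
    intro e he
    by_cases hp : ∃ p, p.Prime ∧ p ∣ q.den ∧ w ≤ p
    · obtain ⟨p, hp, hpq, hwp⟩ := hp
      refine le_trans ?_ (hM p hp hwp)
      rw [sum_filter]
      refine sum_le_sum fun i _ => ?_
      have h0 : 0 ≤ |ρ i| / d i := by positivity
      by_cases hb : ¬ q.den ∣ e ∧ q.den ∣ e * d i
      · have h1 : p ∣ e * d i := hpq.trans hb.2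
        have h2 : ¬ p ∣ e := fun h => by
          have := hP p hp (h.trans (Nat.dvd_of_mem_divisors he))
          omega
        rw [if_pos hb, if_pos ((hp.dvd_mul.1 h1).resolve_left h2)]
      · rw [if_neg hb]; split_ifs <;> simp [h0]
    · refine le_trans (le_of_eq (sum_eq_zero fun i hi => ?_)) hM0
      rw [if_neg]
      rintro ⟨h1, h2⟩
      refine h1 (Nat.Coprime.dvd_of_dvd_mul_right (Nat.coprime_of_dvd fun p hp' h3 h4 => ?_) h2)
      exact hp ⟨p, hp', h3, hd i hi p hp' h4⟩
  refine (norm_sum_le _ _).trans ?_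
  have h1 : ∀ e ∈ P.divisors, ‖∑ i ∈ D, ((ArithmeticFunction.moebius e : ℝ) * ρ i : ℂ) *
        (expSumDvd X (e * d i) θ - expSumDvd X e θ / d i)‖ ≤
      1 / (e : ℝ) * (2 * N * T * ∑ i ∈ D, |ρ i| / d i + 2 * X * M) +
        4 * X * ∑ i ∈ D with T < e * d i, |ρ i| / ((e : ℝ) * d i) := by
    intro e he
    refine (norm_sum_le _ _).trans ((sum_le_sum (hterm e he)).trans ?_)
    rw [sum_add_distrib, sum_add_distrib, ← mul_sum, ← mul_sum, ← mul_sum, ← mul_sum, sum_filter,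
      mul_add]
    have := mul_le_mul_of_nonneg_left (hbad e he) (show 0 ≤ 2 * X * (1 / (e : ℝ)) by positivity)
    refine add_le_add (add_le_add (le_of_eq (by ring)) (this.trans (le_of_eq (by ring)))) le_rfl
  refine (sum_le_sum h1).trans (le_of_eq ?_)
  rw [sum_add_distrib, ← sum_mul, ← mul_sum]

open ArithmeticFunction in
lemma sum_divisors_pow_card_div {P : ℕ} (hP : Squarefree P) (K : ℝ) :
    ∑ d ∈ P.divisors, K ^ #d.primeFactors / d = ∏ p ∈ P.primeFactors, (1 + K / p) := by
  have h := (IsMultiplicative.prodPrimeFactors (R := ℝ) (fun p => K / p)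
    ).prodPrimeFactors_one_add_of_squarefree hP
  have h1 : ∀ p ∈ P.primeFactors, 1 + K / (p : ℝ) =
      1 + ArithmeticFunction.prodPrimeFactors (fun p : ℕ => K / (p : ℝ)) p := by
    intro p hp
    have hp' := Nat.prime_of_mem_primeFactors hp
    rw [prodPrimeFactors_apply hp'.ne_zero, hp'.primeFactors, prod_singleton]
  rw [prod_congr rfl h1, h]
  refine sum_congr rfl fun d hd => ?_
  have hd0 : d ≠ 0 := (Nat.pos_of_mem_divisors hd).ne'
  rw [prodPrimeFactors_apply hd0, prod_div_distrib, prod_const]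
  congr 1
  have := Nat.prod_primeFactors_of_squarefree (hP.squarefree_of_dvd (Nat.dvd_of_mem_divisors hd))
  rw [← Nat.cast_prod, this]

lemma sum_divisors_dvd_pow_card_div_le {P p : ℕ} (hP : Squarefree P) (hp : p.Prime) {K : ℝ}
    (hK : 0 ≤ K) :
    ∑ d ∈ P.divisors with p ∣ d, K ^ #d.primeFactors / d ≤
      K / p * ∏ q ∈ P.primeFactors, (1 + K / q) := by
  rw [← sum_divisors_pow_card_div hP, mul_sum]
  have hp0 : (0 : ℝ) < p := by exact_mod_cast hp.pos
  have h1 : ∀ d ∈ P.divisors.filter (p ∣ ·), K ^ #d.primeFactors / (d : ℝ) =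
      K / p * (K ^ #(d / p).primeFactors / ((d / p : ℕ) : ℝ)) := by
    intro d hd
    rw [mem_filter, Nat.mem_divisors] at hd
    obtain ⟨⟨hdP, -⟩, d', rfl⟩ := hd
    have hcop : p.Coprime d' := by
      have := (hP.squarefree_of_dvd hdP)
      exact (Nat.squarefree_mul_iff.1 this).1
    rw [Nat.mul_div_cancel_left _ hp.pos, hcop.primeFactors_mul,
      card_union_of_disjoint hcop.disjoint_primeFactors, hp.primeFactors, card_singleton]
    push_cast
    rw [pow_add, pow_one, mul_div_mul_comm]
  have hinj : Set.InjOn (fun d => d / p) (P.divisors.filter (p ∣ ·) : Finset ℕ) := by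
    intro a ha b hb hab
    simp only [coe_filter, Set.mem_ofPred_eq] at ha hb
    rw [← Nat.mul_div_cancel' ha.2, ← Nat.mul_div_cancel' hb.2, show a / p = b / p from hab]
  rw [sum_congr rfl h1, ← sum_image (f := fun d : ℕ => K / p * (K ^ #d.primeFactors / (d : ℝ))) hinj]
  refine sum_le_sum_of_subset_of_nonneg ?_ fun _ _ _ => by positivity
  intro e he
  rw [mem_image] at he
  obtain ⟨d, hd, rfl⟩ := he
  rw [mem_filter, Nat.mem_divisors] at hd
  rw [Nat.mem_divisors]
  exact ⟨(Nat.div_dvd_of_dvd hd.2).trans hd.1.1, hd.1.2⟩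

lemma squarefree_prod_primes {s : Finset ℕ} (hs : ∀ p ∈ s, p.Prime) : Squarefree (∏ p ∈ s, p) := by
  refine Finset.squarefree_prod_of_pairwise_isCoprime ?_ fun p hp => (hs p hp).squarefree
  intro p hp q hq hpq
  exact Nat.coprime_iff_isRelPrime.1 ((Nat.coprime_primes (hs p hp) (hs q hq)).2 hpq)

/-- `∏_{p < n} (1 + K / p)`. -/
def eulerProd (K : ℝ) (n : ℕ) : ℝ := ∏ p ∈ n.primesBelow, (1 + K / p)

lemma sum_divisors_sqfree_pow (n : ℕ) (K : ℝ) :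
    ∑ d ∈ (∏ p ∈ n.primeFactors, p).divisors, K ^ #d.primeFactors = (1 + K) ^ #n.primeFactors := by
  have hs : ∀ p ∈ n.primeFactors, p.Prime := fun p hp => Nat.prime_of_mem_primeFactors hp
  have h := (ArithmeticFunction.IsMultiplicative.prodPrimeFactors (R := ℝ) (fun _ => K)
    ).prodPrimeFactors_one_add_of_squarefree (squarefree_prod_primes hs)
  rw [Nat.primeFactors_prod hs] at h
  have h1 : ∀ p ∈ n.primeFactors,
      1 + ArithmeticFunction.prodPrimeFactors (fun _ : ℕ => K) p = 1 + K := by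
    intro p hp
    have hp' := hs p hp
    rw [ArithmeticFunction.prodPrimeFactors_apply hp'.ne_zero, hp'.primeFactors, prod_singleton]
  rw [prod_congr rfl h1, prod_const] at h
  rw [h]
  refine sum_congr rfl fun d hd => ?_
  rw [ArithmeticFunction.prodPrimeFactors_apply (Nat.pos_of_mem_divisors hd).ne', prod_const]

/-- The product of the primes below `n`. -/
def primeProd (n : ℕ) : ℕ := ∏ p ∈ n.primesBelow, p

lemma primeFactors_primeProd (n : ℕ) : (primeProd n).primeFactors = n.primesBelow :=
  Nat.primeFactors_prod fun _ hp => Nat.prime_of_mem_primesBelow hp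

lemma squarefree_primeProd (n : ℕ) : Squarefree (primeProd n) :=
  squarefree_prod_primes fun _ hp => Nat.prime_of_mem_primesBelow hp

lemma primeProd_ne_zero (n : ℕ) : primeProd n ≠ 0 := (squarefree_primeProd n).ne_zero

lemma dvd_primeProd_of_squarefree {d n : ℕ} (hd : Squarefree d) (h : ∀ p, p.Prime → p ∣ d → p < n) :
    d ∣ primeProd n := by
  rw [← Nat.prod_primeFactors_of_squarefree hd]
  refine prod_dvd_prod_of_subset _ _ _ fun p hp => ?_
  rw [Nat.mem_primesBelow]
  have hp' := Nat.prime_of_mem_primeFactors hp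
  exact ⟨h p hp' (Nat.dvd_of_mem_primeFactors hp), hp'⟩

lemma sum_Ico_pow_card_primeFactors_le (X : ℕ) {K : ℝ} (hK : 0 ≤ K) :
    ∑ n ∈ Ico X (2 * X), (1 + K) ^ #n.primeFactors ≤ 2 * X * eulerProd K (2 * X) := by
  have h1 : ∀ n ∈ Ico X (2 * X), (1 + K) ^ #n.primeFactors ≤
      ∑ d ∈ (primeProd (2 * X)).divisors, K ^ #d.primeFactors * (if d ∣ n then 1 else 0) := by
    intro n hn
    rw [mem_Ico] at hn
    rw [← sum_divisors_sqfree_pow]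
    simp only [mul_ite, mul_one, mul_zero]
    rw [← sum_filter]
    refine sum_le_sum_of_subset_of_nonneg ?_ fun _ _ _ => by positivity
    intro d hd
    rw [Nat.mem_divisors] at hd
    rw [mem_filter, Nat.mem_divisors]
    refine ⟨⟨hd.1.trans (prod_dvd_prod_of_subset _ _ _ fun p hp => ?_), primeProd_ne_zero _⟩,
      hd.1.trans (Nat.prod_primeFactors_dvd n)⟩
    rw [Nat.mem_primesBelow]
    have := Nat.le_of_mem_primeFactors hp
    exact ⟨by omega, Nat.prime_of_mem_primeFactors hp⟩
  refine (sum_le_sum h1).trans ?_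
  rw [sum_comm, eulerProd, ← primeFactors_primeProd, ← sum_divisors_pow_card_div
    (squarefree_primeProd _), mul_sum]
  refine sum_le_sum fun d hd => ?_
  rw [← mul_sum]
  have := countDvd_le X (Nat.pos_of_mem_divisors hd)
  rw [countDvd] at this
  calc _ ≤ K ^ #d.primeFactors * (2 * X / d) := by gcongr
    _ = _ := by ring

lemma eulerProd_nonneg {K : ℝ} (hK : 0 ≤ K) (n : ℕ) : 0 ≤ eulerProd K n :=
  prod_nonneg fun _ _ => by positivity

lemma one_le_eulerProd {K : ℝ} (hK : 0 ≤ K) (n : ℕ) : 1 ≤ eulerProd K n :=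
  Finset.one_le_prod fun _ _ => le_add_of_nonneg_right (by positivity)

lemma eulerProd_mono {K : ℝ} (hK : 0 ≤ K) {m n : ℕ} (h : m ≤ n) :
    eulerProd K m ≤ eulerProd K n := by
  refine prod_le_prod_of_subset_of_one_le (fun p hp => ?_) (fun _ _ => by positivity)
    fun _ _ _ => le_add_of_nonneg_right (by positivity)
  rw [Nat.mem_primesBelow] at hp ⊢
  exact ⟨hp.1.trans_le h, hp.2⟩

lemma eulerProd_natCast_le (K n : ℕ) : eulerProd K n ≤ eulerProd 1 n ^ K := by
  rw [eulerProd, eulerProd, ← prod_pow]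
  refine prod_le_prod (fun _ _ => by positivity) fun p _ => ?_
  have h0 : (0 : ℝ) ≤ 1 / p := by positivity
  have := one_add_mul_le_pow (a := 1 / (p : ℝ)) (by linarith) K
  calc 1 + (K : ℝ) / p = 1 + K * (1 / p) := by ring
    _ ≤ _ := this

lemma eulerProd_one_succ_le {i : ℕ} (hi : 1 ≤ i) :
    eulerProd 1 (2 ^ (i + 1)) ≤ eulerProd 1 (2 ^ i) * Real.exp (4 / i) := by
  set s := (2 ^ (i + 1)).primesBelow \ (2 ^ i).primesBelow with hs
  have hsub : (2 ^ i).primesBelow ⊆ (2 ^ (i + 1)).primesBelow := by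
    intro p hp
    rw [Nat.mem_primesBelow] at hp ⊢
    exact ⟨hp.1.trans_le (Nat.pow_le_pow_right (by norm_num) (by omega)), hp.2⟩
  have hs1 : ∀ p ∈ s, 2 ^ i ≤ p ∧ p < 2 ^ (i + 1) ∧ p.Prime := by
    intro p hp
    rw [hs, mem_sdiff, Nat.mem_primesBelow, Nat.mem_primesBelow] at hp
    exact ⟨by by_contra h; exact hp.2 ⟨by omega, hp.1.2⟩, hp.1⟩
  have hcard : i * #s ≤ 4 * 2 ^ i := by
    have h1 : (2 ^ i) ^ #s ≤ ∏ p ∈ s, p := by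
      rw [← prod_const]
      exact prod_le_prod' fun p hp => (hs1 p hp).1
    have h2 : ∏ p ∈ s, p ≤ primorial (2 ^ (i + 1)) := by
      rw [primorial]
      refine prod_le_prod_of_subset_of_one_le' ?_ ?_
      · intro p hp
        have := hs1 p hp
        rw [mem_filter, mem_range]
        exact ⟨by omega, this.2.2⟩
      · intro p hp _
        exact (mem_filter.1 hp).2.one_le
    have h3 := (h1.trans h2).trans (primorial_le_four_pow _)
    have h4 : (4 : ℕ) ^ 2 ^ (i + 1) = 2 ^ (4 * 2 ^ i) := by
      rw [show (4 : ℕ) = 2 ^ 2 by norm_num, ← pow_mul]; congr 1; ring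
    rw [h4, ← pow_mul] at h3
    exact (Nat.pow_le_pow_iff_right (by norm_num)).1 h3
  rw [eulerProd, ← prod_sdiff hsub, mul_comm]
  refine mul_le_mul_of_nonneg_left ?_ (eulerProd_nonneg zero_le_one _)
  have hi' : (0 : ℝ) < i := by exact_mod_cast hi
  calc ∏ p ∈ s, (1 + 1 / (p : ℝ)) ≤ ∏ p ∈ s, Real.exp (1 / 2 ^ i) := by
        refine prod_le_prod (fun _ _ => by positivity) fun p hp => ?_
        have h1 : (2 ^ i : ℝ) ≤ p := by exact_mod_cast (hs1 p hp).1
        have h2 : 1 / (p : ℝ) ≤ 1 / 2 ^ i := one_div_le_one_div_of_le (by positivity) h1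
        have := Real.add_one_le_exp (1 / (2 : ℝ) ^ i)
        linarith
    _ = Real.exp (#s * (1 / 2 ^ i)) := by rw [prod_const, ← Real.exp_nat_mul]
    _ ≤ Real.exp (4 / i) := by
        gcongr
        rw [mul_one_div, div_le_div_iff₀ (by positivity) hi']
        have : (i * #s : ℝ) ≤ 4 * 2 ^ i := by exact_mod_cast hcard
        linarith

/-- A weak form of the theorem of Mertens. -/
lemma eulerProd_one_le {j : ℕ} (hj : 1 ≤ j) : eulerProd 1 (2 ^ j) ≤ 81 * (j : ℝ) ^ 4 := by
  have h1 : ∀ i : ℕ, eulerProd 1 (2 ^ (i + 1)) ≤ Real.exp (4 * (harmonic i : ℝ)) := by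
    intro i
    induction i with
    | zero =>
      have : (2 ^ (0 + 1)).primesBelow = ∅ := by decide
      rw [eulerProd, this]; simp
    | succ i ih =>
      refine (eulerProd_one_succ_le (by omega)).trans ?_
      rw [harmonic_succ]
      push_cast
      rw [mul_add, Real.exp_add]
      refine mul_le_mul ih (le_of_eq ?_) (Real.exp_nonneg _) (Real.exp_nonneg _)
      congr 1
  obtain ⟨i, rfl⟩ : ∃ i, j = i + 1 := ⟨j - 1, by omega⟩
  refine (h1 i).trans ?_
  have h2 : (harmonic i : ℝ) ≤ 1 + Real.log ((i + 1 : ℕ) : ℝ) := by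
    have h3 := harmonic_le_one_add_log (i + 1)
    rw [harmonic_succ] at h3
    push_cast at h3 ⊢
    have : (0 : ℝ) ≤ ((i : ℝ) + 1)⁻¹ := by positivity
    linarith
  have h3 : Real.exp 1 ≤ 3 := by linarith [Real.exp_one_lt_d9]
  calc Real.exp (4 * (harmonic i : ℝ)) ≤ Real.exp (4 * (1 + Real.log ((i + 1 : ℕ) : ℝ))) := by gcongr
    _ = Real.exp 1 ^ 4 * ((i + 1 : ℕ) : ℝ) ^ 4 := by
      have h4 : ∀ x : ℝ, Real.exp (4 * x) = Real.exp x ^ 4 := fun x => by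
        rw [← Real.exp_nat_mul]; norm_num
      rw [h4, Real.exp_add, Real.exp_log (by positivity), mul_pow]
    _ ≤ 3 ^ 4 * ((i + 1 : ℕ) : ℝ) ^ 4 := by gcongr
    _ = _ := by norm_num

lemma sum_lcm_le {P : ℕ} (hP : P ≠ 0) {D : Finset ℕ} (hD : D ⊆ P.divisors) {u F : ℕ → ℝ}
    (hu : ∀ a, 0 ≤ u a) (hF : ∀ a, 0 ≤ F a) :
    ∑ x ∈ D ×ˢ D, u x.1 * u x.2 * F (x.1.lcm x.2) ≤
      ∑ d ∈ P.divisors, F d * (∑ a ∈ d.divisors, u a) ^ 2 := by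
  have h1 : ∀ d ∈ P.divisors, F d * (∑ a ∈ d.divisors, u a) ^ 2 =
      ∑ x ∈ P.divisors ×ˢ P.divisors,
        if x.1 ∣ d ∧ x.2 ∣ d then u x.1 * u x.2 * F d else 0 := by
    intro d hd
    have hd' := Nat.dvd_of_mem_divisors hd
    have h2 : d.divisors = P.divisors.filter (· ∣ d) := by
      ext a
      simp only [Nat.mem_divisors, mem_filter]
      exact ⟨fun h => ⟨⟨h.1.trans hd', hP⟩, h.1⟩, fun h => ⟨h.2, (Nat.pos_of_mem_divisors hd).ne'⟩⟩
    rw [h2, sum_filter, sq, sum_mul_sum, ← sum_product', mul_sum]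
    refine sum_congr rfl fun x _ => ?_
    by_cases ha : x.1 ∣ d <;> by_cases hb : x.2 ∣ d <;> simp [ha, hb]; ring
  rw [sum_congr rfl h1, sum_comm]
  have h3 : D ×ˢ D ⊆ P.divisors ×ˢ P.divisors := product_subset_product hD hD
  refine (sum_le_sum_of_subset_of_nonneg h3 fun x _ _ =>
    mul_nonneg (mul_nonneg (hu _) (hu _)) (hF _)).trans (sum_le_sum fun x hx => ?_)
  rw [mem_product, Nat.mem_divisors, Nat.mem_divisors] at hx
  have hmem : x.1.lcm x.2 ∈ P.divisors := by
    rw [Nat.mem_divisors]; exact ⟨Nat.lcm_dvd hx.1.1 hx.2.1, hP⟩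
  refine le_trans (le_of_eq ?_) (single_le_sum (fun d _ => ?_) hmem)
  · rw [if_pos ⟨Nat.dvd_lcm_left _ _, Nat.dvd_lcm_right _ _⟩]
  · split_ifs
    · exact mul_nonneg (mul_nonneg (hu _) (hu _)) (hF _)
    · exact le_rfl

lemma two_pow_le_of_lt {j t e : ℕ} (he : Squarefree e) (h : ∀ p, p.Prime → p ∣ e → p < 2 ^ j)
    (hte : 2 ^ t < e) : (2 : ℝ) ^ (t / j) ≤ 2 ^ #e.primeFactors := by
  have h1 : e ≤ (2 ^ j) ^ #e.primeFactors := by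
    conv_lhs => rw [← Nat.prod_primeFactors_of_squarefree he]
    rw [← prod_const]
    exact prod_le_prod' fun p hp => (h p (Nat.prime_of_mem_primeFactors hp)
      (Nat.dvd_of_mem_primeFactors hp)).le
  rw [← pow_mul] at h1
  have h2 : t < j * #e.primeFactors := (Nat.pow_lt_pow_iff_right (by norm_num)).1 (hte.trans_le h1)
  refine pow_le_pow_right₀ (by norm_num) ?_
  exact (Nat.div_lt_of_lt_mul h2).le

/-- `∏_{p < n} (1 - 1 / p)`. -/
def primeDensity (n : ℕ) : ℝ := ∏ p ∈ n.primesBelow, (1 - 1 / (p : ℝ))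

lemma one_div_prime_le_half {p : ℕ} (hp : p.Prime) : 1 / (p : ℝ) ≤ 1 / 2 :=
  one_div_le_one_div_of_le (by norm_num) (by exact_mod_cast hp.two_le)

lemma primeDensity_pos (n : ℕ) : 0 < primeDensity n := by
  refine prod_pos fun p hp => ?_
  have := one_div_prime_le_half (Nat.prime_of_mem_primesBelow hp)
  linarith

lemma inv_primeDensity_le_eulerProd (n : ℕ) : (primeDensity n)⁻¹ ≤ eulerProd 1 n ^ 2 := by
  rw [inv_le_iff_one_le_mul₀ (primeDensity_pos n), eulerProd, primeDensity, ← prod_pow,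
    ← prod_mul_distrib]
  refine one_le_prod fun p hp => ?_
  have h1 := one_div_prime_le_half (Nat.prime_of_mem_primesBelow hp)
  have h0 : (0 : ℝ) ≤ 1 / p := by positivity
  set x := 1 / (p : ℝ)
  nlinarith [mul_nonneg h0 (sub_nonneg.2 h1), mul_nonneg (mul_nonneg h0 (sub_nonneg.2 h1)) h0]

lemma one_le_mul_primeDensity {n : ℕ} (hn : 2 ≤ n) : 1 ≤ ((n : ℝ) - 1) * primeDensity n := by
  induction n, hn using Nat.le_induction with
  | base =>
    have : (2).primesBelow = ∅ := by decide
    rw [primeDensity, this]; norm_num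
  | succ n hn ih =>
    have hn' : (2 : ℝ) ≤ n := by exact_mod_cast hn
    have hV := primeDensity_pos n
    have h : (primeDensity (n + 1)) ≥ (1 - 1 / (n : ℝ)) * primeDensity n := by
      rw [primeDensity, Nat.primesBelow_succ]
      split_ifs with h
      · rw [prod_insert (by simp [Nat.mem_primesBelow]), primeDensity]
      · have : (0 : ℝ) ≤ 1 / n := by positivity
        rw [← primeDensity]
        nlinarith
    push_cast
    calc (1 : ℝ) ≤ (n - 1) * primeDensity n := ih
      _ = n * ((1 - 1 / (n : ℝ)) * primeDensity n) := by field_simp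
      _ ≤ n * primeDensity (n + 1) := by gcongr
      _ = _ := by ring

lemma inv_primeDensity_le {n : ℕ} (hn : 1 ≤ n) : (primeDensity n)⁻¹ ≤ n := by
  obtain rfl | hn := hn.eq_or_lt
  · have : (1).primesBelow = ∅ := by decide
    rw [primeDensity, this]; norm_num
  · rw [inv_le_iff_one_le_mul₀ (primeDensity_pos n)]
    have := one_le_mul_primeDensity hn
    have := primeDensity_pos n
    linarith

lemma coprimeInd_nonneg (P n : ℕ) : 0 ≤ coprimeInd P n := by
  rw [coprimeInd]; split_ifs <;> norm_num

lemma coprimeInd_le_one (P n : ℕ) : coprimeInd P n ≤ 1 := by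
  rw [coprimeInd]; split_ifs <;> norm_num

lemma coprimeInd_mul (P P' n : ℕ) :
    coprimeInd (P * P') n = coprimeInd P n * coprimeInd P' n := by
  simp only [coprimeInd, Nat.coprime_mul_iff_right]
  split_ifs <;> simp_all

/-- The model for the von Mangoldt function obtained by sieving out the primes below `w`. -/
def sieveModel (w n : ℕ) : ℝ := (primeDensity w)⁻¹ * coprimeInd (primeProd w) n

lemma sieveModel_nonneg (w n : ℕ) : 0 ≤ sieveModel w n :=
  mul_nonneg (inv_nonneg.2 (primeDensity_pos w).le) (coprimeInd_nonneg _ _)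

lemma sieveModel_le (w n : ℕ) : sieveModel w n ≤ (primeDensity w)⁻¹ :=
  mul_le_of_le_one_right (inv_nonneg.2 (primeDensity_pos w).le) (coprimeInd_le_one _ _)

/-- The product of the primes in `[m, n)`. -/
def primeProdIco (m n : ℕ) : ℕ := ∏ p ∈ n.primesBelow \ m.primesBelow, p

lemma prime_of_mem_sdiff {m n p : ℕ} (hp : p ∈ n.primesBelow \ m.primesBelow) : p.Prime :=
  Nat.prime_of_mem_primesBelow (mem_sdiff.1 hp).1

lemma primeFactors_primeProdIco (m n : ℕ) :
    (primeProdIco m n).primeFactors = n.primesBelow \ m.primesBelow :=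
  Nat.primeFactors_prod fun _ hp => prime_of_mem_sdiff hp

lemma squarefree_primeProdIco (m n : ℕ) : Squarefree (primeProdIco m n) :=
  squarefree_prod_primes fun _ hp => prime_of_mem_sdiff hp

lemma primesBelow_mono {m n : ℕ} (h : m ≤ n) : m.primesBelow ⊆ n.primesBelow := by
  intro p hp
  rw [Nat.mem_primesBelow] at hp ⊢
  exact ⟨hp.1.trans_le h, hp.2⟩

lemma primeProd_mul_primeProdIco {m n : ℕ} (h : m ≤ n) :
    primeProd m * primeProdIco m n = primeProd n := by
  rw [primeProd, primeProdIco, primeProd, mul_comm, prod_sdiff (primesBelow_mono h)]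

lemma le_of_dvd_primeProdIco {m n p : ℕ} (hp : p.Prime) (h : p ∣ primeProdIco m n) : m ≤ p := by
  have := Nat.mem_primeFactors.2 ⟨hp, h, (squarefree_primeProdIco m n).ne_zero⟩
  rw [primeFactors_primeProdIco, mem_sdiff, Nat.mem_primesBelow, Nat.mem_primesBelow] at this
  by_contra h'
  exact this.2 ⟨by omega, hp⟩

lemma lt_of_dvd_primeProd {n p : ℕ} (hp : p.Prime) (h : p ∣ primeProd n) : p < n := by
  have := Nat.mem_primeFactors.2 ⟨hp, h, primeProd_ne_zero n⟩
  rw [primeFactors_primeProd, Nat.mem_primesBelow] at this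
  exact this.1

lemma sum_moebius_div_primeProdIco {m n : ℕ} (h : m ≤ n) :
    ∑ d ∈ (primeProdIco m n).divisors, (ArithmeticFunction.moebius d : ℝ) / d =
      (primeDensity m)⁻¹ * primeDensity n := by
  have h1 : ∀ d ∈ (primeProdIco m n).divisors, (ArithmeticFunction.moebius d : ℝ) / d =
      (-1) ^ #d.primeFactors / d := by
    intro d hd
    have hd' := (squarefree_primeProdIco m n).squarefree_of_dvd (Nat.dvd_of_mem_divisors hd)
    rw [ArithmeticFunction.moebius_apply_of_squarefree hd',
      ← (ArithmeticFunction.cardDistinctFactors_eq_cardFactors_iff_squarefree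
        hd'.ne_zero).2 hd', ArithmeticFunction.cardDistinctFactors_apply]
    push_cast
    rfl
  rw [sum_congr rfl h1, sum_divisors_pow_card_div (squarefree_primeProdIco m n),
    primeFactors_primeProdIco, primeDensity, primeDensity, ← prod_sdiff (primesBelow_mono h),
    mul_comm, mul_inv_cancel_right₀ (show ∏ p ∈ m.primesBelow, (1 - 1 / (p : ℝ)) ≠ 0 from
      (primeDensity_pos m).ne')]
  exact prod_congr rfl fun p _ => by ring

lemma sieveModel_sub {m n : ℕ} (h : m ≤ n) (x : ℕ) :
    sieveModel n x - sieveModel m x = (primeDensity n)⁻¹ * (coprimeInd (primeProd m) x *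
      ∑ d ∈ (primeProdIco m n).divisors, (ArithmeticFunction.moebius d : ℝ) *
        ((if d ∣ x then 1 else 0) - 1 / (d : ℝ))) := by
  have h1 := sum_moebius_dvd (squarefree_primeProdIco m n).ne_zero x
  have h2 := sum_moebius_div_primeProdIco h
  have h3 : ∑ d ∈ (primeProdIco m n).divisors, (ArithmeticFunction.moebius d : ℝ) *
      ((if d ∣ x then 1 else 0) - 1 / (d : ℝ)) =
      coprimeInd (primeProdIco m n) x - (primeDensity m)⁻¹ * primeDensity n := by
    rw [← h1, ← h2, ← sum_sub_distrib]
    refine sum_congr rfl fun d _ => ?_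
    split_ifs <;> ring
  have := (primeDensity_pos n).ne'
  rw [h3, sieveModel, sieveModel, ← primeProd_mul_primeProdIco h, coprimeInd_mul]
  field_simp

lemma sum_divisors_primeProdIco_le (m n : ℕ) {K : ℝ} (hK : 0 ≤ K) :
    ∑ d ∈ (primeProdIco m n).divisors, K ^ #d.primeFactors / d ≤ eulerProd K n := by
  rw [sum_divisors_pow_card_div (squarefree_primeProdIco m n), primeFactors_primeProdIco]
  exact prod_le_prod_of_subset_of_one_le sdiff_subset (fun _ _ => by positivity)
    fun _ _ _ => le_add_of_nonneg_right (by positivity)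

lemma sum_divisors_primeProd (n : ℕ) (K : ℝ) :
    ∑ d ∈ (primeProd n).divisors, K ^ #d.primeFactors / d = eulerProd K n := by
  rw [sum_divisors_pow_card_div (squarefree_primeProd n), primeFactors_primeProd, eulerProd]

lemma sum_one_div_divisors_primeProd (n : ℕ) :
    ∑ d ∈ (primeProd n).divisors, 1 / (d : ℝ) = eulerProd 1 n := by
  simpa using sum_divisors_primeProd n 1

lemma sum_dvd_divisors_primeProdIco_le (m n : ℕ) {p : ℕ} (hp : p.Prime) {K : ℝ} (hK : 0 ≤ K) :
    ∑ d ∈ (primeProdIco m n).divisors with p ∣ d, K ^ #d.primeFactors / d ≤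
      K / p * eulerProd K n := by
  refine (sum_divisors_dvd_pow_card_div_le (squarefree_primeProdIco m n) hp hK).trans ?_
  rw [← sum_divisors_pow_card_div (squarefree_primeProdIco m n)]
  gcongr
  exact sum_divisors_primeProdIco_le m n hK

lemma abs_moebius_le_one (d : ℕ) : |(ArithmeticFunction.moebius d : ℝ)| ≤ 1 := by
  exact_mod_cast ArithmeticFunction.abs_moebius_le_one

lemma norm_expSum_sieveModel_sub_le {X r j : ℕ} (hX : 2 ^ (32 * r) ≤ X) (hr : 1 ≤ r)
    (hj : (j + 1) ^ 2 ≤ r) (θ : ℝ) :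
    ‖∑ n ∈ Ico X (2 * X), ((sieveModel (2 ^ (j + 1)) n - sieveModel (2 ^ j) n : ℝ) : ℂ) *
      eC (θ * n)‖ ≤ 7 * 81 ^ 6 * X * (j + 1 : ℝ) ^ 24 / 2 ^ j := by
  have hle : 2 ^ j ≤ 2 ^ (j + 1) := Nat.pow_le_pow_right (by norm_num) (by omega)
  set E := eulerProd 1 (2 ^ (j + 1)) with hE
  have hE1 : 1 ≤ E := one_le_eulerProd zero_le_one _
  have hE0 : 0 ≤ E := by linarith
  have hEj : eulerProd 1 (2 ^ j) ≤ E := eulerProd_mono zero_le_one hle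
  have hE2 : eulerProd 2 (2 ^ (j + 1)) ≤ E ^ 2 := by
    exact_mod_cast eulerProd_natCast_le 2 (2 ^ (j + 1))
  set D := (primeProdIco (2 ^ j) (2 ^ (j + 1))).divisors with hD
  have hD1 : ∑ d ∈ D, |(ArithmeticFunction.moebius d : ℝ)| / d ≤ E := by
    refine le_trans (sum_le_sum fun d _ => ?_) (sum_divisors_primeProdIco_le _ _ zero_le_one)
    rw [one_pow]
    gcongr
    exact abs_moebius_le_one d
  have hM : ∀ p : ℕ, p.Prime → 2 ^ j ≤ p →
      ∑ d ∈ D with p ∣ d, |(ArithmeticFunction.moebius d : ℝ)| / d ≤ E / 2 ^ j := by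
    intro p hp hjp
    refine le_trans (sum_le_sum fun d _ => ?_)
      ((sum_dvd_divisors_primeProdIco_le _ _ hp zero_le_one).trans ?_)
    · rw [one_pow]
      gcongr
      exact abs_moebius_le_one d
    · have : (2 : ℝ) ^ j ≤ p := by exact_mod_cast hjp
      calc 1 / (p : ℝ) * E ≤ 1 / 2 ^ j * E := by gcongr
        _ = _ := by ring
  have htail : ∑ e ∈ (primeProd (2 ^ j)).divisors, ∑ d ∈ D with 2 ^ (4 * r) < e * d,
      |(ArithmeticFunction.moebius d : ℝ)| / ((e : ℝ) * d) ≤ E ^ 4 / 2 ^ j := by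
    have h1 : ∀ e ∈ (primeProd (2 ^ j)).divisors, ∀ d ∈ D, 2 ^ (4 * r) < e * d →
        |(ArithmeticFunction.moebius d : ℝ)| / ((e : ℝ) * d) ≤
        (2 ^ #e.primeFactors / e) * (2 ^ #d.primeFactors / d) / 2 ^ j := by
      intro e he d hd hed
      have hdvd : e * d ∣ primeProd (2 ^ (j + 1)) := by
        rw [← primeProd_mul_primeProdIco hle]
        exact mul_dvd_mul (Nat.dvd_of_mem_divisors he) (Nat.dvd_of_mem_divisors hd)
      have h2 := two_pow_le_of_lt ((squarefree_primeProd _).squarefree_of_dvd hdvd)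
        (fun p hp hpd => lt_of_dvd_primeProd hp (hpd.trans hdvd)) hed
      have h3 : j ≤ 4 * r / (j + 1) := by
        rw [Nat.le_div_iff_mul_le (by omega)]
        nlinarith
      have h4 : (2 : ℝ) ^ j ≤ 2 ^ #(e * d).primeFactors :=
        (pow_le_pow_right₀ (by norm_num) h3).trans h2
      have h5 : (2 : ℝ) ^ #(e * d).primeFactors ≤ 2 ^ #e.primeFactors * 2 ^ #d.primeFactors := by
        rw [← pow_add]
        refine pow_le_pow_right₀ (by norm_num) ?_
        rw [Nat.primeFactors_mul (Nat.pos_of_mem_divisors he).ne' (Nat.pos_of_mem_divisors hd).ne']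
        exact card_union_le _ _
      rw [div_mul_div_comm, le_div_iff₀ (by positivity), div_mul_eq_mul_div]
      refine div_le_div_of_nonneg_right ?_ (by positivity)
      calc _ ≤ 1 * (2 : ℝ) ^ j := by gcongr; exact abs_moebius_le_one d
        _ ≤ _ := by rw [one_mul]; exact h4.trans h5
    calc _ ≤ ∑ e ∈ (primeProd (2 ^ j)).divisors, ∑ d ∈ D,
          (2 ^ #e.primeFactors / (e : ℝ)) * (2 ^ #d.primeFactors / d) / 2 ^ j := by
          refine sum_le_sum fun e he => ?_
          rw [sum_filter]
          refine sum_le_sum fun d hd => ?_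
          split_ifs with h
          · exact h1 e he d hd h
          · positivity
      _ = (∑ e ∈ (primeProd (2 ^ j)).divisors, 2 ^ #e.primeFactors / (e : ℝ)) *
          (∑ d ∈ D, 2 ^ #d.primeFactors / (d : ℝ)) / 2 ^ j := by
          simp_rw [sum_mul_sum, sum_div]
      _ ≤ E ^ 2 * E ^ 2 / 2 ^ j := by
          gcongr
          · rw [sum_divisors_primeProd]
            exact (eulerProd_mono zero_le_two hle).trans hE2
          · exact (sum_divisors_primeProdIco_le _ _ zero_le_two).trans hE2
      _ = _ := by ring
  have hcore := norm_expSum_sifted_le (X := X) (N := 2 ^ (16 * r)) (T := 2 ^ (4 * r))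
    (w := 2 ^ j) (primeProd_ne_zero (2 ^ j)) (fun p hp h => lt_of_dvd_primeProd hp h)
    (by rw [← pow_mul, ← pow_succ']; exact Nat.pow_le_pow_right (by norm_num) (by omega))
    (by positivity) D (fun d => d) (fun d => (ArithmeticFunction.moebius d : ℝ))
    (fun d hd => Nat.pos_of_mem_divisors hd)
    (fun d hd p hp hpd => le_of_dvd_primeProdIco hp (hpd.trans (Nat.dvd_of_mem_divisors hd)))
    (M := E / 2 ^ j) (by positivity) hM θ
  have hrw : ∑ n ∈ Ico X (2 * X), ((sieveModel (2 ^ (j + 1)) n - sieveModel (2 ^ j) n : ℝ) : ℂ) *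
      eC (θ * n) = ((primeDensity (2 ^ (j + 1)))⁻¹ : ℝ) * ∑ n ∈ Ico X (2 * X),
        ((coprimeInd (primeProd (2 ^ j)) n * ∑ d ∈ D, (ArithmeticFunction.moebius d : ℝ) *
        ((if d ∣ n then 1 else 0) - 1 / (d : ℝ)) : ℝ) : ℂ) * eC (θ * n) := by
    rw [mul_sum]
    refine sum_congr rfl fun n _ => ?_
    rw [sieveModel_sub hle, Complex.ofReal_mul, mul_assoc]
  rw [hrw, norm_mul, Complex.norm_real, Real.norm_of_nonneg (inv_nonneg.2 (primeDensity_pos _).le)]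
  rw [sum_one_div_divisors_primeProd] at hcore
  have hXr : (2 : ℝ) * (2 ^ (16 * r) : ℕ) * (2 ^ (4 * r) : ℕ) ≤ X / 2 ^ j := by
    rw [le_div_iff₀ (by positivity)]
    have hjr : j + 1 ≤ r := by nlinarith
    have : 2 * 2 ^ (16 * r) * 2 ^ (4 * r) * 2 ^ j ≤ X := by
      refine le_trans ?_ hX
      rw [← pow_succ', ← pow_add, ← pow_add]
      exact Nat.pow_le_pow_right (by norm_num) (by omega)
    exact_mod_cast this
  have hEle : E ≤ 81 * (j + 1 : ℝ) ^ 4 := by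
    have := eulerProd_one_le (j := j + 1) (by omega)
    push_cast at this
    exact this
  calc _ ≤ E ^ 2 * (E * (X / 2 ^ j * E + 2 * X * (E / 2 ^ j)) + 4 * X * (E ^ 4 / 2 ^ j)) := by
        refine mul_le_mul (inv_primeDensity_le_eulerProd _) (hcore.trans ?_) (norm_nonneg _)
          (by positivity)
        gcongr
    _ = X / 2 ^ j * (3 * E ^ 4 * 1 + 4 * E ^ 6) := by ring
    _ ≤ X / 2 ^ j * (3 * E ^ 4 * E ^ 2 + 4 * E ^ 6) := by gcongr; exact one_le_pow₀ hE1
    _ = 7 * X / 2 ^ j * E ^ 6 := by ring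
    _ ≤ 7 * X / 2 ^ j * (81 * (j + 1 : ℝ) ^ 4) ^ 6 := by gcongr
    _ = _ := by ring

/-- The squarefree positive integers up to `R`. -/
def sqfreeUpTo (R : ℕ) : Finset ℕ := (Icc 1 R).filter Squarefree

lemma mem_sqfreeUpTo {R d : ℕ} : d ∈ sqfreeUpTo R ↔ (1 ≤ d ∧ d ≤ R) ∧ Squarefree d := by
  rw [sqfreeUpTo, mem_filter, mem_Icc]

lemma pos_of_mem_sqfreeUpTo {R d : ℕ} (h : d ∈ sqfreeUpTo R) : 0 < d :=
  (mem_sqfreeUpTo.1 h).1.1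

lemma mem_sqfreeUpTo_of_dvd {R d e : ℕ} (h : d ∈ sqfreeUpTo R) (he : e ∣ d) :
    e ∈ sqfreeUpTo R := by
  have h' := mem_sqfreeUpTo.1 h
  exact mem_sqfreeUpTo.2 ⟨⟨Nat.pos_of_dvd_of_pos he h'.1.1,
    (Nat.le_of_dvd h'.1.1 he).trans h'.1.2⟩, h'.2.squarefree_of_dvd he⟩

/-- The normalising factor `∑ 1 / φ(l)` of the Selberg sieve. -/
def selbergNorm (R : ℕ) : ℝ := ∑ l ∈ sqfreeUpTo R, 1 / (l.totient : ℝ)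

/-- The Selberg sieve weights of level `R`. -/
def selbergWeight (R d : ℕ) : ℝ := (ArithmeticFunction.moebius d : ℝ) * (d / selbergNorm R) *
  ∑ l ∈ sqfreeUpTo R with d ∣ l, 1 / (l.totient : ℝ)

lemma log_le_two_mul_selbergNorm (R : ℕ) : Real.log (R + 1) ≤ 2 * selbergNorm R := by
  have h1 : ∀ n ∈ Icc 1 R, ∃ x ∈ sqfreeUpTo R ×ˢ Ioo 0 (R + 1), x.2 ^ 2 * x.1 = n := by
    intro n hn
    rw [mem_Icc] at hn
    obtain ⟨a, b, hab, ha⟩ := Nat.sq_mul_squarefree n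
    have hn0 : 0 < n := hn.1
    have hb : 0 < b := by
      rcases Nat.eq_zero_or_pos b with rfl | h
      · simp at hab; omega
      · exact h
    have ha0 : 0 < a := ha.ne_zero.bot_lt
    have haR : a ≤ n := by rw [← hab]; exact Nat.le_mul_of_pos_left _ (by positivity)
    have hbR : b ≤ n := by rw [← hab]; nlinarith
    refine ⟨(a, b), ?_, hab⟩
    rw [mem_product, mem_sqfreeUpTo, mem_Ioo]
    exact ⟨⟨⟨ha0, haR.trans hn.2⟩, ha⟩, hb, by simp only; omega⟩
  have h2 : (harmonic R : ℝ) ≤ ∑ x ∈ sqfreeUpTo R ×ˢ Ioo 0 (R + 1),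
      ((x.2 : ℝ) ^ 2)⁻¹ * (1 / (x.1 : ℝ)) := by
    rw [harmonic_eq_sum_Icc]
    push_cast
    calc ∑ n ∈ Icc 1 R, (n : ℝ)⁻¹ ≤ ∑ n ∈ Icc 1 R, ∑ x ∈ sqfreeUpTo R ×ˢ Ioo 0 (R + 1),
          if x.2 ^ 2 * x.1 = n then ((x.2 : ℝ) ^ 2)⁻¹ * (1 / (x.1 : ℝ)) else 0 := by
          refine sum_le_sum fun n hn => ?_
          obtain ⟨x, hx, hxn⟩ := h1 n hn
          refine le_trans (le_of_eq ?_) (single_le_sum (fun y _ => ?_) hx)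
          · rw [if_pos hxn, ← hxn]; push_cast; rw [mul_inv, one_div]
          · split_ifs <;> positivity
      _ ≤ _ := by
          rw [sum_comm]
          refine sum_le_sum fun x _ => ?_
          rw [sum_ite_eq]
          split_ifs
          · exact le_rfl
          · positivity
  have h3 : ∑ l ∈ sqfreeUpTo R, 1 / (l : ℝ) ≤ selbergNorm R := by
    refine sum_le_sum fun l hl => ?_
    have := Nat.totient_pos.2 (pos_of_mem_sqfreeUpTo hl)
    refine one_div_le_one_div_of_le (by exact_mod_cast this) ?_
    exact_mod_cast Nat.totient_le l
  have h4 := log_add_one_le_harmonic R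
  push_cast at h4
  refine h4.trans (h2.trans ?_)
  rw [sum_product_right]
  simp only [← mul_sum]
  rw [← sum_mul]
  have h5 := sum_Ioo_inv_sq_le (α := ℝ) 0 (R + 1)
  norm_num at h5
  exact mul_le_mul h5 h3 (sum_nonneg fun _ _ => by positivity) zero_le_two

lemma selbergNorm_pos {R : ℕ} (hR : 1 ≤ R) : 0 < selbergNorm R := by
  refine sum_pos (fun l hl => ?_) ⟨1, mem_sqfreeUpTo.2 ⟨⟨le_rfl, hR⟩, squarefree_one⟩⟩
  have := Nat.totient_pos.2 (pos_of_mem_sqfreeUpTo hl)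
  positivity

lemma selbergWeight_one {R : ℕ} (hR : 1 ≤ R) : selbergWeight R 1 = 1 := by
  simp only [selbergWeight, ArithmeticFunction.moebius_apply_one, one_dvd, filter_true]
  rw [← selbergNorm]
  have := (selbergNorm_pos hR).ne'
  push_cast
  field_simp

lemma le_two_pow_mul_totient {d : ℕ} (hd : Squarefree d) :
    d ≤ 2 ^ #d.primeFactors * d.totient := by
  have h1 := Nat.totient_mul_prod_primeFactors d
  rw [Nat.prod_primeFactors_of_squarefree hd, mul_comm] at h1
  rw [Nat.eq_of_mul_eq_mul_left hd.ne_zero.bot_lt h1, ← prod_const, ← prod_mul_distrib]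
  conv_lhs => rw [← Nat.prod_primeFactors_of_squarefree hd]
  refine prod_le_prod' fun p hp => ?_
  have := (Nat.prime_of_mem_primeFactors hp).two_le
  omega

lemma abs_selbergWeight_le {R d : ℕ} (hd : d ∈ sqfreeUpTo R) :
    |selbergWeight R d| ≤ 2 ^ #d.primeFactors := by
  have hd' := mem_sqfreeUpTo.1 hd
  have hG := selbergNorm_pos (hd'.1.1.trans hd'.1.2)
  have hd0 : 0 < d := hd'.1.1
  have hφ := Nat.totient_pos.2 hd0
  have hsum : ∑ l ∈ sqfreeUpTo R with d ∣ l, 1 / (l.totient : ℝ) ≤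
      1 / (d.totient : ℝ) * selbergNorm R := by
    have h1 : ∀ l ∈ (sqfreeUpTo R).filter (d ∣ ·), 1 / (l.totient : ℝ) =
        1 / (d.totient : ℝ) * (1 / ((l / d).totient : ℝ)) := by
      intro l hl
      rw [mem_filter, mem_sqfreeUpTo] at hl
      obtain ⟨⟨-, hl⟩, k, rfl⟩ := hl
      rw [Nat.mul_div_cancel_left _ hd0, Nat.totient_mul (Nat.squarefree_mul_iff.1 hl).1]
      push_cast
      rw [one_div_mul_one_div]
    have hinj : Set.InjOn (fun l => l / d) ((sqfreeUpTo R).filter (d ∣ ·) : Finset ℕ) := by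
      intro a ha b hb hab
      simp only [coe_filter, Set.mem_ofPred_eq] at ha hb
      rw [← Nat.mul_div_cancel' ha.2, ← Nat.mul_div_cancel' hb.2, show a / d = b / d from hab]
    rw [sum_congr rfl h1,
      ← sum_image (f := fun l : ℕ => 1 / (d.totient : ℝ) * (1 / (l.totient : ℝ))) hinj,
      selbergNorm, mul_sum]
    refine sum_le_sum_of_subset_of_nonneg ?_ fun _ _ _ => by positivity
    intro e he
    rw [mem_image] at he
    obtain ⟨l, hl, rfl⟩ := he
    rw [mem_filter] at hl
    exact mem_sqfreeUpTo_of_dvd hl.1 (Nat.div_dvd_of_dvd hl.2)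
  have hsum0 : 0 ≤ ∑ l ∈ sqfreeUpTo R with d ∣ l, 1 / (l.totient : ℝ) :=
    sum_nonneg fun _ _ => by positivity
  rw [selbergWeight, abs_mul, abs_mul, abs_of_nonneg hsum0,
    abs_of_nonneg (show 0 ≤ d / selbergNorm R by positivity)]
  have h2 : (d : ℝ) ≤ 2 ^ #d.primeFactors * d.totient := by
    exact_mod_cast le_two_pow_mul_totient hd'.2
  calc _ ≤ 1 * (d / selbergNorm R) * (1 / (d.totient : ℝ) * selbergNorm R) := by
        gcongr; exact abs_moebius_le_one d
    _ = d / d.totient := by field_simp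
    _ ≤ _ := by rw [div_le_iff₀ (by positivity)]; exact h2

lemma sum_moebius_between {l m : ℕ} (hm : Squarefree m) :
    ∑ d ∈ m.divisors with l ∣ d, (ArithmeticFunction.moebius d : ℝ) =
      if l = m then (ArithmeticFunction.moebius l : ℝ) else 0 := by
  by_cases hlm : l ∣ m
  · obtain ⟨k, rfl⟩ := hlm
    have hl0 : 0 < l := Nat.pos_of_ne_zero (left_ne_zero_of_mul hm.ne_zero)
    have hk0 : k ≠ 0 := right_ne_zero_of_mul hm.ne_zero
    have himg : (l * k).divisors.filter (l ∣ ·) = k.divisors.image (l * ·) := by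
      ext d
      simp only [mem_filter, Nat.mem_divisors, mem_image]
      constructor
      · rintro ⟨⟨hd, -⟩, e, rfl⟩
        exact ⟨e, ⟨Nat.dvd_of_mul_dvd_mul_left hl0 hd, hk0⟩, rfl⟩
      · rintro ⟨e, ⟨he, -⟩, rfl⟩
        exact ⟨⟨Nat.mul_dvd_mul_left _ he, hm.ne_zero⟩, dvd_mul_right _ _⟩
    rw [himg, sum_image fun a _ b _ h => Nat.eq_of_mul_eq_mul_left hl0 h]
    have h1 : ∀ e ∈ k.divisors, (ArithmeticFunction.moebius (l * e) : ℝ) =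
        (ArithmeticFunction.moebius l : ℝ) * ArithmeticFunction.moebius e := by
      intro e he
      have hcop : l.Coprime e := (Nat.squarefree_mul_iff.1 hm).1.coprime_dvd_right
        (Nat.dvd_of_mem_divisors he)
      rw [ArithmeticFunction.isMultiplicative_moebius.map_mul_of_coprime hcop]
      push_cast
      rfl
    have h2 := sum_divisors_moebius k
    rw [sum_congr rfl h1, ← mul_sum, ← Int.cast_sum, h2]
    have h3 : l = l * k ↔ k = 1 := by
      constructor
      · intro h
        exact Nat.eq_of_mul_eq_mul_left hl0 (by omega)
      · rintro rfl; simp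
    by_cases hk : k = 1 <;> simp [h3, hk]
  · rw [if_neg (by rintro rfl; exact hlm dvd_rfl), sum_eq_zero]
    intro d hd
    rw [mem_filter] at hd
    exact absurd (hd.2.trans (Nat.dvd_of_mem_divisors hd.1)) hlm

lemma sum_selbergWeight_div {R l : ℕ} (hl : l ∈ sqfreeUpTo R) :
    ∑ d ∈ sqfreeUpTo R with l ∣ d, selbergWeight R d / d =
      (ArithmeticFunction.moebius l : ℝ) / (l.totient * selbergNorm R) := by
  calc _ = ∑ d ∈ sqfreeUpTo R, ∑ m ∈ sqfreeUpTo R,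
        if d ∣ m then (if l ∣ d then (ArithmeticFunction.moebius d : ℝ) else 0) *
          (1 / (m.totient * selbergNorm R)) else 0 := by
        rw [sum_filter]
        refine sum_congr rfl fun d hd => ?_
        have hd0 : (d : ℝ) ≠ 0 := by exact_mod_cast (pos_of_mem_sqfreeUpTo hd).ne'
        rw [← sum_filter, ← mul_sum]
        split_ifs
        · simp_rw [← div_div]
          rw [selbergWeight, ← sum_div]
          field_simp
        · simp
    _ = ∑ m ∈ sqfreeUpTo R, (∑ d ∈ m.divisors with l ∣ d, (ArithmeticFunction.moebius d : ℝ)) *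
          (1 / (m.totient * selbergNorm R)) := by
        rw [sum_comm]
        refine sum_congr rfl fun m hm => ?_
        rw [← sum_filter, sum_filter (fun d => l ∣ d), sum_mul]
        refine sum_congr ?_ fun _ _ => rfl
        ext d
        rw [mem_filter, Nat.mem_divisors]
        exact ⟨fun h => ⟨h.2, (pos_of_mem_sqfreeUpTo hm).ne'⟩,
          fun h => ⟨mem_sqfreeUpTo_of_dvd hm h.1, h.1⟩⟩
    _ = ∑ m ∈ sqfreeUpTo R, if l = m then (ArithmeticFunction.moebius l : ℝ) *
          (1 / (m.totient * selbergNorm R)) else 0 := by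
        refine sum_congr rfl fun m hm => ?_
        rw [sum_moebius_between (mem_sqfreeUpTo.1 hm).2, ite_mul, zero_mul]
    _ = _ := by rw [sum_ite_eq, if_pos hl]; ring

lemma sum_selbergWeight_lcm {R : ℕ} (hR : 1 ≤ R) :
    ∑ x ∈ sqfreeUpTo R ×ˢ sqfreeUpTo R,
      selbergWeight R x.1 * selbergWeight R x.2 / (x.1.lcm x.2 : ℕ) = 1 / selbergNorm R := by
  have h1 : ∀ x ∈ sqfreeUpTo R ×ˢ sqfreeUpTo R,
      selbergWeight R x.1 * selbergWeight R x.2 / ((x.1.lcm x.2 : ℕ) : ℝ) =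
      ∑ l ∈ sqfreeUpTo R, (l.totient : ℝ) * ((if l ∣ x.1 then selbergWeight R x.1 / x.1 else 0) *
        (if l ∣ x.2 then selbergWeight R x.2 / x.2 else 0)) := by
    intro x hx
    rw [mem_product] at hx
    have ha := pos_of_mem_sqfreeUpTo hx.1
    have hb := pos_of_mem_sqfreeUpTo hx.2
    have h2 : ((x.1.gcd x.2 : ℕ) : ℝ) =
        ∑ l ∈ sqfreeUpTo R, if l ∣ x.1 ∧ l ∣ x.2 then (l.totient : ℝ) else 0 := by
      conv_lhs => rw [← Nat.sum_totient (x.1.gcd x.2)]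
      rw [Nat.cast_sum, ← sum_filter]
      refine sum_congr ?_ fun _ _ => rfl
      ext l
      rw [mem_filter, Nat.mem_divisors, Nat.dvd_gcd_iff]
      exact ⟨fun h => ⟨mem_sqfreeUpTo_of_dvd hx.1 h.1.1, h.1⟩,
        fun h => ⟨h.2, (Nat.gcd_pos_of_pos_left _ ha).ne'⟩⟩
    have h3 : (x.1.gcd x.2 : ℝ) * (x.1.lcm x.2 : ℕ) = x.1 * x.2 := by
      exact_mod_cast Nat.gcd_mul_lcm x.1 x.2
    have ha' : (x.1 : ℝ) ≠ 0 := by exact_mod_cast ha.ne'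
    have hb' : (x.2 : ℝ) ≠ 0 := by exact_mod_cast hb.ne'
    have hl' : ((x.1.lcm x.2 : ℕ) : ℝ) ≠ 0 := by exact_mod_cast (Nat.lcm_pos ha hb).ne'
    have h4 : 1 / ((x.1.lcm x.2 : ℕ) : ℝ) = (x.1.gcd x.2 : ℕ) / (x.1 * x.2) := by
      rw [div_eq_div_iff hl' (mul_ne_zero ha' hb'), one_mul, h3]
    calc _ = selbergWeight R x.1 * selbergWeight R x.2 * (1 / ((x.1.lcm x.2 : ℕ) : ℝ)) := by ring
      _ = _ := by
        rw [h4, h2, sum_div, mul_sum]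
        refine sum_congr rfl fun l _ => ?_
        by_cases h5 : l ∣ x.1 <;> by_cases h6 : l ∣ x.2 <;> simp [h5, h6]
        field_simp
  rw [sum_congr rfl h1, sum_comm]
  have hG := (selbergNorm_pos hR).ne'
  calc _ = ∑ l ∈ sqfreeUpTo R, 1 / (l.totient : ℝ) * (1 / selbergNorm R ^ 2) := by
        refine sum_congr rfl fun l hl => ?_
        rw [← mul_sum, sum_product]
        simp only
        rw [← sum_mul_sum, ← sum_filter, sum_selbergWeight_div hl]
        have hφ : (l.totient : ℝ) ≠ 0 := by
          exact_mod_cast (Nat.totient_pos.2 (pos_of_mem_sqfreeUpTo hl)).ne'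
        have hμ : (ArithmeticFunction.moebius l : ℝ) * ArithmeticFunction.moebius l = 1 := by
          have := ArithmeticFunction.moebius_sq_eq_one_of_squarefree (mem_sqfreeUpTo.1 hl).2
          rw [sq] at this
          exact_mod_cast this
        rw [div_mul_div_comm, hμ]
        field_simp
    _ = _ := by
        rw [← sum_mul, ← selbergNorm]
        field_simp

/-- The Selberg upper bound sieve of level `R` for the indicator of primes. -/
def selbergSieve (R n : ℕ) : ℝ := (∑ d ∈ sqfreeUpTo R with d ∣ n, selbergWeight R d) ^ 2

lemma selbergSieve_nonneg (R n : ℕ) : 0 ≤ selbergSieve R n := sq_nonneg _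

lemma selbergSieve_prime {R p : ℕ} (hR : 1 ≤ R) (hp : p.Prime) (hRp : R < p) :
    selbergSieve R p = 1 := by
  have : (sqfreeUpTo R).filter (· ∣ p) = {1} := by
    ext d
    rw [mem_filter, mem_sqfreeUpTo, mem_singleton, Nat.dvd_prime hp]
    constructor
    · rintro ⟨h, h' | h'⟩
      · exact h'
      · omega
    · rintro rfl
      exact ⟨⟨⟨le_rfl, hR⟩, squarefree_one⟩, Or.inl rfl⟩
  rw [selbergSieve, this, sum_singleton, selbergWeight_one hR, one_pow]

lemma selbergSieve_le {R n : ℕ} (hn : n ≠ 0) : selbergSieve R n ≤ 9 ^ #n.primeFactors := by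
  have h1 : |∑ d ∈ sqfreeUpTo R with d ∣ n, selbergWeight R d| ≤ 3 ^ #n.primeFactors := by
    refine (abs_sum_le_sum_abs _ _).trans ?_
    have h2 := sum_divisors_sqfree_pow n 2
    rw [show (1 + 2 : ℝ) = 3 by norm_num] at h2
    rw [← h2]
    refine (sum_le_sum fun d hd => abs_selbergWeight_le (mem_filter.1 hd).1).trans ?_
    refine sum_le_sum_of_subset_of_nonneg ?_ fun _ _ _ => by positivity
    intro d hd
    rw [mem_filter, mem_sqfreeUpTo] at hd
    rw [Nat.mem_divisors]
    refine ⟨?_, (squarefree_prod_primes fun p hp => Nat.prime_of_mem_primeFactors hp).ne_zero⟩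
    conv_lhs => rw [← Nat.prod_primeFactors_of_squarefree hd.1.2]
    exact prod_dvd_prod_of_subset _ _ _ (Nat.primeFactors_mono hd.2 hn)
  rw [selbergSieve, ← sq_abs]
  calc _ ≤ ((3 : ℝ) ^ #n.primeFactors) ^ 2 := by gcongr
    _ = _ := by rw [← pow_mul, mul_comm, pow_mul]; norm_num

lemma sq_sum_dvd (D : Finset ℕ) (u : ℕ → ℝ) (n : ℕ) :
    (∑ d ∈ D with d ∣ n, u d) ^ 2 =
      ∑ x ∈ D ×ˢ D, u x.1 * u x.2 * (if x.1.lcm x.2 ∣ n then 1 else 0) := by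
  rw [sq, sum_filter, sum_mul_sum, ← sum_product']
  refine sum_congr rfl fun x _ => ?_
  simp only [Nat.lcm_dvd_iff]
  by_cases ha : x.1 ∣ n <;> by_cases hb : x.2 ∣ n <;> simp [ha, hb]

lemma abs_selbergWeight_le_natCast {R d : ℕ} (hd : d ∈ sqfreeUpTo R) :
    |selbergWeight R d| ≤ R := by
  have hd' := mem_sqfreeUpTo.1 hd
  refine (abs_selbergWeight_le hd).trans ?_
  have h1 : 2 ^ #d.primeFactors ≤ d := by
    conv_rhs => rw [← Nat.prod_primeFactors_of_squarefree hd'.2]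
    rw [← prod_const]
    exact prod_le_prod' fun p hp => (Nat.prime_of_mem_primeFactors hp).two_le
  exact_mod_cast h1.trans hd'.1.2

lemma sum_selbergSieve_le (X : ℕ) {R : ℕ} (hR : 1 ≤ R) :
    ∑ n ∈ Ico X (2 * X), selbergSieve R n ≤ X / selbergNorm R + R ^ 4 := by
  have h1 : ∑ n ∈ Ico X (2 * X), selbergSieve R n = ∑ x ∈ sqfreeUpTo R ×ˢ sqfreeUpTo R,
      selbergWeight R x.1 * selbergWeight R x.2 * countDvd X (x.1.lcm x.2) := by
    simp_rw [selbergSieve, sq_sum_dvd]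
    rw [sum_comm]
    simp_rw [countDvd, mul_sum]
  have h2 : ∀ x ∈ sqfreeUpTo R ×ˢ sqfreeUpTo R,
      selbergWeight R x.1 * selbergWeight R x.2 * countDvd X (x.1.lcm x.2) ≤
      X * (selbergWeight R x.1 * selbergWeight R x.2 / (x.1.lcm x.2 : ℕ)) + R ^ 2 := by
    intro x hx
    rw [mem_product] at hx
    have hl := Nat.lcm_pos (pos_of_mem_sqfreeUpTo hx.1) (pos_of_mem_sqfreeUpTo hx.2)
    have h3 := abs_countDvd_sub_le X hl
    have h4 : selbergWeight R x.1 * selbergWeight R x.2 *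
        (countDvd X (x.1.lcm x.2) - X / (x.1.lcm x.2 : ℕ)) ≤ R * R * 1 := by
      refine (le_abs_self _).trans ?_
      rw [abs_mul, abs_mul]
      gcongr
      · exact abs_selbergWeight_le_natCast hx.1
      · exact abs_selbergWeight_le_natCast hx.2
    calc _ = X * (selbergWeight R x.1 * selbergWeight R x.2 / (x.1.lcm x.2 : ℕ)) +
          selbergWeight R x.1 * selbergWeight R x.2 *
          (countDvd X (x.1.lcm x.2) - X / (x.1.lcm x.2 : ℕ)) := by ring
      _ ≤ _ := by linarith
  rw [h1]
  refine (sum_le_sum h2).trans ?_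
  rw [sum_add_distrib, ← mul_sum, sum_selbergWeight_lcm hR, sum_const, card_product, nsmul_eq_mul]
  have h5 : #(sqfreeUpTo R) ≤ R := (card_filter_le _ _).trans (by simp)
  have h6 : (#(sqfreeUpTo R) : ℝ) ≤ R := by exact_mod_cast h5
  push_cast
  calc _ ≤ X * (1 / selbergNorm R) + R * R * (R : ℝ) ^ 2 := by gcongr
    _ = _ := by ring

/-- The squarefree integers up to `R` without prime factors below `w`. -/
def roughUpTo (R w : ℕ) : Finset ℕ := (sqfreeUpTo R).filter fun d => d.Coprime (primeProd w)

/-- The mean value of the Selberg sieve on integers without prime factors below `w`. -/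
def roughMean (R w : ℕ) : ℝ := primeDensity w * ∑ x ∈ roughUpTo R w ×ˢ roughUpTo R w,
  selbergWeight R x.1 * selbergWeight R x.2 / (x.1.lcm x.2 : ℕ)

lemma coprimeInd_mul_selbergSieve (R w n : ℕ) :
    coprimeInd (primeProd w) n * selbergSieve R n = coprimeInd (primeProd w) n *
      ∑ x ∈ roughUpTo R w ×ˢ roughUpTo R w, selbergWeight R x.1 * selbergWeight R x.2 *
        (if x.1.lcm x.2 ∣ n then 1 else 0) := by
  rw [← sq_sum_dvd, selbergSieve]
  by_cases h : n.Coprime (primeProd w)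
  · congr 3
    ext d
    rw [roughUpTo, mem_filter, mem_filter, mem_filter]
    exact ⟨fun h' => ⟨⟨h'.1, h.coprime_dvd_left h'.2⟩, h'.2⟩, fun h' => ⟨h'.1.1, h'.2⟩⟩
  · rw [coprimeInd, if_neg h, zero_mul, zero_mul]

lemma sum_Ioc_dvd {M m : ℕ} (h : m ∣ M) :
    ∑ n ∈ Ioc 0 M, (if m ∣ n then (1 : ℝ) else 0) = M / m := by
  rw [← sum_filter, sum_const, nsmul_eq_mul, mul_one, Nat.Ioc_filter_dvd_card_eq_div,
    Nat.cast_div_charZero h]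

lemma sum_moebius_div_primeProd (n : ℕ) :
    ∑ d ∈ (primeProd n).divisors, (ArithmeticFunction.moebius d : ℝ) / d = primeDensity n := by
  have h1 : (0).primesBelow = ∅ := by decide
  have h2 := sum_moebius_div_primeProdIco (Nat.zero_le n)
  simpa [primeProdIco, primeDensity, primeProd, h1] using h2

lemma primeProd_dvd_primeProd {m n : ℕ} (h : m ≤ n) : primeProd m ∣ primeProd n :=
  prod_dvd_prod_of_subset _ _ _ (primesBelow_mono h)

lemma dvd_primeProd_of_mem {R d n : ℕ} (hd : d ∈ sqfreeUpTo R) (hn : R < n) : d ∣ primeProd n := by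
  have hd' := mem_sqfreeUpTo.1 hd
  refine dvd_primeProd_of_squarefree hd'.2 fun p _ hpd => ?_
  have := Nat.le_of_dvd hd'.1.1 hpd
  omega

lemma sum_coprimeInd_mul_selbergSieve (R w : ℕ) {M : ℕ} (hw : primeProd w ∣ M)
    (hR : ∀ d ∈ sqfreeUpTo R, d ∣ M) :
    ∑ n ∈ Ioc 0 M, coprimeInd (primeProd w) n * selbergSieve R n = M * roughMean R w := by
  have h1 : ∀ e ∈ (primeProd w).divisors, ∀ x ∈ roughUpTo R w ×ˢ roughUpTo R w,
      ∑ n ∈ Ioc 0 M, (if e ∣ n then (ArithmeticFunction.moebius e : ℝ) else 0) *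
        (selbergWeight R x.1 * selbergWeight R x.2 * (if x.1.lcm x.2 ∣ n then 1 else 0)) =
      M * ((ArithmeticFunction.moebius e : ℝ) / e *
        (selbergWeight R x.1 * selbergWeight R x.2 / (x.1.lcm x.2 : ℕ))) := by
    intro e he x hx
    rw [mem_product, roughUpTo, mem_filter, mem_filter] at hx
    have he' := Nat.dvd_of_mem_divisors he
    have hcop : e.Coprime (x.1.lcm x.2) :=
      (((hx.1.2.mul_left hx.2.2).symm.coprime_dvd_left he').coprime_dvd_right
        (Nat.lcm_dvd_mul _ _))
    have hdvd : e * x.1.lcm x.2 ∣ M := hcop.mul_dvd_of_dvd_of_dvd (he'.trans hw)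
      (Nat.lcm_dvd (hR _ hx.1.1) (hR _ hx.2.1))
    have h2 := sum_Ioc_dvd hdvd
    calc _ = (ArithmeticFunction.moebius e : ℝ) * (selbergWeight R x.1 * selbergWeight R x.2) *
          ∑ n ∈ Ioc 0 M, (if e * x.1.lcm x.2 ∣ n then (1 : ℝ) else 0) := by
          rw [mul_sum]
          refine sum_congr rfl fun n _ => ?_
          have h3 : e * x.1.lcm x.2 ∣ n ↔ e ∣ n ∧ x.1.lcm x.2 ∣ n :=
            ⟨fun h => ⟨(dvd_mul_right _ _).trans h, (dvd_mul_left _ _).trans h⟩,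
              fun h => hcop.mul_dvd_of_dvd_of_dvd h.1 h.2⟩
          simp only [h3]
          by_cases ha : e ∣ n <;> by_cases hb : x.1.lcm x.2 ∣ n <;> simp [ha, hb]
      _ = _ := by rw [h2]; push_cast; ring
  calc _ = ∑ n ∈ Ioc 0 M, ∑ e ∈ (primeProd w).divisors, ∑ x ∈ roughUpTo R w ×ˢ roughUpTo R w,
        (if e ∣ n then (ArithmeticFunction.moebius e : ℝ) else 0) *
        (selbergWeight R x.1 * selbergWeight R x.2 * (if x.1.lcm x.2 ∣ n then 1 else 0)) := by
        refine sum_congr rfl fun n _ => ?_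
        rw [coprimeInd_mul_selbergSieve, ← sum_moebius_dvd (primeProd_ne_zero w), sum_mul_sum]
    _ = ∑ e ∈ (primeProd w).divisors, ∑ x ∈ roughUpTo R w ×ˢ roughUpTo R w,
        M * ((ArithmeticFunction.moebius e : ℝ) / e *
        (selbergWeight R x.1 * selbergWeight R x.2 / (x.1.lcm x.2 : ℕ))) := by
        rw [sum_comm]
        refine sum_congr rfl fun e he => ?_
        rw [sum_comm]
        exact sum_congr rfl fun x hx => h1 e he x hx
    _ = _ := by
        simp_rw [← mul_sum]
        rw [← sum_mul, sum_moebius_div_primeProd, roughMean]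

lemma sum_selbergSieve_period {R M : ℕ} (hR1 : 1 ≤ R) (hR : ∀ d ∈ sqfreeUpTo R, d ∣ M) :
    ∑ n ∈ Ioc 0 M, selbergSieve R n = M * (1 / selbergNorm R) := by
  rw [← sum_selbergWeight_lcm hR1, mul_sum]
  simp_rw [selbergSieve, sq_sum_dvd]
  rw [sum_comm]
  refine sum_congr rfl fun x hx => ?_
  rw [mem_product] at hx
  rw [← mul_sum, sum_Ioc_dvd (Nat.lcm_dvd (hR _ hx.1) (hR _ hx.2))]
  ring

lemma roughMean_nonneg_and_le {R : ℕ} (hR : 1 ≤ R) (w : ℕ) :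
    0 ≤ roughMean R w ∧ roughMean R w ≤ 1 / selbergNorm R := by
  set M := primeProd (max w (R + 1)) with hM
  have hM0 : (0 : ℝ) < M := by exact_mod_cast (primeProd_ne_zero (max w (R + 1))).bot_lt
  have hw : primeProd w ∣ M := primeProd_dvd_primeProd (le_max_left _ _)
  have hd : ∀ d ∈ sqfreeUpTo R, d ∣ M := fun d hd =>
    dvd_primeProd_of_mem hd (lt_max_of_lt_right (by omega))
  have h1 := sum_coprimeInd_mul_selbergSieve R w hw hd
  have h2 := sum_selbergSieve_period hR hd
  constructor
  · refine nonneg_of_mul_nonneg_right ?_ hM0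
    rw [← h1]
    exact sum_nonneg fun n _ => mul_nonneg (coprimeInd_nonneg _ _) (selbergSieve_nonneg _ _)
  · refine le_of_mul_le_mul_left ?_ hM0
    rw [← h1, ← h2]
    exact sum_le_sum fun n _ => mul_le_of_le_one_left (selbergSieve_nonneg _ _)
      (coprimeInd_le_one _ _)

lemma coprimeInd_mul_selbergSieve_sub (R w n : ℕ) :
    coprimeInd (primeProd w) n * selbergSieve R n - roughMean R w * sieveModel w n =
      coprimeInd (primeProd w) n * ∑ x ∈ roughUpTo R w ×ˢ roughUpTo R w,
        selbergWeight R x.1 * selbergWeight R x.2 *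
        ((if x.1.lcm x.2 ∣ n then 1 else 0) - 1 / ((x.1.lcm x.2 : ℕ) : ℝ)) := by
  rw [coprimeInd_mul_selbergSieve, roughMean, sieveModel]
  simp_rw [mul_sub, sum_sub_distrib, mul_one_div]
  have := (primeDensity_pos w).ne'
  field_simp

lemma sum_divisors_two_pow_sq {d : ℕ} (hd : Squarefree d) :
    (∑ a ∈ d.divisors, (2 : ℝ) ^ #a.primeFactors) ^ 2 = 9 ^ #d.primeFactors := by
  have h := sum_divisors_sqfree_pow d 2
  rw [Nat.prod_primeFactors_of_squarefree hd] at h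
  rw [h, ← pow_mul, mul_comm, pow_mul]
  norm_num

lemma sum_abs_selbergWeight_lcm_le {R n w : ℕ} (hn : R < n) {F : ℕ → ℝ} (hF : ∀ d, 0 ≤ F d) :
    ∑ x ∈ roughUpTo R w ×ˢ roughUpTo R w,
      |selbergWeight R x.1 * selbergWeight R x.2| * F (x.1.lcm x.2) ≤
      ∑ d ∈ (primeProd n).divisors, F d * 9 ^ #d.primeFactors := by
  have hsub : roughUpTo R w ⊆ (primeProd n).divisors := by
    intro d hd
    rw [Nat.mem_divisors]
    exact ⟨dvd_primeProd_of_mem (mem_filter.1 hd).1 hn, primeProd_ne_zero n⟩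
  have h1 := sum_lcm_le (primeProd_ne_zero n) hsub (u := fun a => 2 ^ #a.primeFactors)
    (fun a => by positivity) hF
  refine le_trans (sum_le_sum fun x hx => ?_) (h1.trans (le_of_eq (sum_congr rfl fun d hd => ?_)))
  · rw [mem_product] at hx
    rw [abs_mul]
    refine mul_le_mul_of_nonneg_right ?_ (hF _)
    exact mul_le_mul (abs_selbergWeight_le (mem_filter.1 hx.1).1)
      (abs_selbergWeight_le (mem_filter.1 hx.2).1) (abs_nonneg _) (by positivity)
  · rw [sum_divisors_two_pow_sq
      ((squarefree_primeProd n).squarefree_of_dvd (Nat.dvd_of_mem_divisors hd))]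

lemma norm_expSum_selbergSieve_sub_le {X r J : ℕ} (hX : 2 ^ (32 * r) ≤ X) (hJ1 : 1 ≤ J)
    (hJ : (J + 1) ^ 2 ≤ r) (θ : ℝ) :
    ‖∑ n ∈ Ico X (2 * X), ((coprimeInd (primeProd (2 ^ J)) n * selbergSieve (2 ^ r) n -
      roughMean (2 ^ r) (2 ^ J) * sieveModel (2 ^ J) n : ℝ) : ℂ) * eC (θ * n)‖ ≤
      23 * 1296 ^ 11 * X * (r : ℝ) ^ 44 / 2 ^ J := by
  have hJr : J + 1 ≤ r := by nlinarith
  set E := eulerProd 1 (2 ^ (r + 1)) with hE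
  have hE1 : 1 ≤ E := one_le_eulerProd zero_le_one _
  have hE0 : 0 ≤ E := by linarith
  have hpow : 2 ^ J ≤ 2 ^ (r + 1) := Nat.pow_le_pow_right (by norm_num) (by omega)
  have hRlt : 2 ^ r < 2 ^ (r + 1) := Nat.pow_lt_pow_right (by norm_num) (by omega)
  have hEJ : eulerProd 1 (2 ^ J) ≤ E := eulerProd_mono zero_le_one hpow
  have hE2 : eulerProd 2 (2 ^ J) ≤ E ^ 2 :=
    (eulerProd_mono zero_le_two hpow).trans (by exact_mod_cast eulerProd_natCast_le 2 (2 ^ (r + 1)))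
  have hE9 : eulerProd 9 (2 ^ (r + 1)) ≤ E ^ 9 := by
    exact_mod_cast eulerProd_natCast_le 9 (2 ^ (r + 1))
  set D := roughUpTo (2 ^ r) (2 ^ J) ×ˢ roughUpTo (2 ^ r) (2 ^ J) with hD
  have hDmem : ∀ x ∈ D, (x.1 ∈ sqfreeUpTo (2 ^ r) ∧ x.1.Coprime (primeProd (2 ^ J))) ∧
      (x.2 ∈ sqfreeUpTo (2 ^ r) ∧ x.2.Coprime (primeProd (2 ^ J))) := by
    intro x hx
    rwa [hD, mem_product, roughUpTo, mem_filter, mem_filter] at hx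
  have hlpos : ∀ x ∈ D, 0 < x.1.lcm x.2 := fun x hx =>
    Nat.lcm_pos (pos_of_mem_sqfreeUpTo (hDmem x hx).1.1) (pos_of_mem_sqfreeUpTo (hDmem x hx).2.1)
  have hD1 : ∑ x ∈ D, |selbergWeight (2 ^ r) x.1 * selbergWeight (2 ^ r) x.2| /
      (x.1.lcm x.2 : ℕ) ≤ E ^ 9 := by
    have h1 := sum_abs_selbergWeight_lcm_le (w := 2 ^ J) hRlt (F := fun d => 1 / (d : ℝ))
      (fun d => by positivity)
    simp only [mul_one_div, one_div_mul_eq_div] at h1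
    rw [sum_divisors_primeProd] at h1
    exact h1.trans hE9
  have hM : ∀ p : ℕ, p.Prime → 2 ^ J ≤ p → ∑ x ∈ D with p ∣ x.1.lcm x.2,
      |selbergWeight (2 ^ r) x.1 * selbergWeight (2 ^ r) x.2| / (x.1.lcm x.2 : ℕ) ≤
      9 * E ^ 9 / 2 ^ J := by
    intro p hp hJp
    have h1 := sum_abs_selbergWeight_lcm_le (w := 2 ^ J) hRlt
      (F := fun d => if p ∣ d then 1 / (d : ℝ) else 0) (fun d => by split_ifs <;> positivity)
    simp only [mul_ite, mul_zero, ite_mul, zero_mul, mul_one_div, one_div_mul_eq_div] at h1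
    rw [← sum_filter, ← sum_filter] at h1
    refine h1.trans ((sum_divisors_dvd_pow_card_div_le (squarefree_primeProd _) hp
      (by norm_num : (0 : ℝ) ≤ 9)).trans ?_)
    rw [primeFactors_primeProd, ← eulerProd, mul_div_right_comm]
    have h2 : (2 : ℝ) ^ J ≤ p := by exact_mod_cast hJp
    have h3 := eulerProd_nonneg (by norm_num : (0 : ℝ) ≤ 9) (2 ^ (r + 1))
    gcongr
  have htail : ∑ e ∈ (primeProd (2 ^ J)).divisors, ∑ x ∈ D with 2 ^ (4 * r) < e * x.1.lcm x.2,
      |selbergWeight (2 ^ r) x.1 * selbergWeight (2 ^ r) x.2| / ((e : ℝ) * (x.1.lcm x.2 : ℕ)) ≤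
      E ^ 11 / 2 ^ J := by
    have h1 : ∀ e ∈ (primeProd (2 ^ J)).divisors, ∀ x ∈ D, 2 ^ (4 * r) < e * x.1.lcm x.2 →
        |selbergWeight (2 ^ r) x.1 * selbergWeight (2 ^ r) x.2| / ((e : ℝ) * (x.1.lcm x.2 : ℕ)) ≤
        (2 ^ #e.primeFactors / e) * (|selbergWeight (2 ^ r) x.1 * selbergWeight (2 ^ r) x.2| /
          (x.1.lcm x.2 : ℕ)) / 2 ^ J := by
      intro e he x hx hlt
      have hdvd := Nat.dvd_of_mem_divisors he
      have h2 : x.1.lcm x.2 ≤ 2 ^ (2 * r) := by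
        have h3 := (mem_sqfreeUpTo.1 (hDmem x hx).1.1).1.2
        have h4 := (mem_sqfreeUpTo.1 (hDmem x hx).2.1).1.2
        calc x.1.lcm x.2 ≤ x.1 * x.2 := Nat.le_of_dvd
              (Nat.mul_pos (pos_of_mem_sqfreeUpTo (hDmem x hx).1.1)
                (pos_of_mem_sqfreeUpTo (hDmem x hx).2.1)) (Nat.lcm_dvd_mul _ _)
          _ ≤ 2 ^ r * 2 ^ r := Nat.mul_le_mul h3 h4
          _ = _ := by rw [← pow_add]; congr 1; ring
      have h3 : 2 ^ (2 * r) < e := by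
        by_contra h
        have h4 : e * x.1.lcm x.2 ≤ 2 ^ (2 * r) * 2 ^ (2 * r) :=
          Nat.mul_le_mul (not_lt.1 h) h2
        rw [← pow_add, show 2 * r + 2 * r = 4 * r by ring] at h4
        omega
      have h4 := two_pow_le_of_lt ((squarefree_primeProd _).squarefree_of_dvd hdvd)
        (fun p hp hpd => lt_of_dvd_primeProd hp (hpd.trans hdvd)) h3
      have h5 : J ≤ 2 * r / J := by
        rw [Nat.le_div_iff_mul_le (by omega)]
        nlinarith
      have h6 : (2 : ℝ) ^ J ≤ 2 ^ #e.primeFactors := (pow_le_pow_right₀ one_le_two h5).trans h4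
      rw [div_mul_div_comm, le_div_iff₀ (by positivity), div_mul_eq_mul_div, mul_comm]
      gcongr
    calc _ ≤ ∑ e ∈ (primeProd (2 ^ J)).divisors, ∑ x ∈ D, (2 ^ #e.primeFactors / (e : ℝ)) *
          (|selbergWeight (2 ^ r) x.1 * selbergWeight (2 ^ r) x.2| /
          (x.1.lcm x.2 : ℕ)) / 2 ^ J := by
          refine sum_le_sum fun e he => ?_
          rw [sum_filter]
          refine sum_le_sum fun x hx => ?_
          split_ifs with h
          · exact h1 e he x hx h
          · positivity
      _ = (∑ e ∈ (primeProd (2 ^ J)).divisors, 2 ^ #e.primeFactors / (e : ℝ)) *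
          (∑ x ∈ D, |selbergWeight (2 ^ r) x.1 * selbergWeight (2 ^ r) x.2| /
          (x.1.lcm x.2 : ℕ)) / 2 ^ J := by
          simp_rw [sum_mul_sum, sum_div]
      _ ≤ E ^ 2 * E ^ 9 / 2 ^ J := by
          gcongr
          rw [sum_divisors_primeProd]
          exact hE2
      _ = _ := by ring
  have hcore := norm_expSum_sifted_le (X := X) (N := 2 ^ (16 * r)) (T := 2 ^ (4 * r))
    (w := 2 ^ J) (primeProd_ne_zero (2 ^ J)) (fun p hp h => lt_of_dvd_primeProd hp h)
    (by rw [← pow_mul, ← pow_succ']; exact Nat.pow_le_pow_right (by norm_num) (by omega))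
    (by positivity) D (fun x => x.1.lcm x.2)
    (fun x => selbergWeight (2 ^ r) x.1 * selbergWeight (2 ^ r) x.2) hlpos
    (fun x hx p hp hpd => by
      by_contra hlt
      have h1 : p ∣ primeProd (2 ^ J) := dvd_primeProd_of_squarefree hp.prime.squarefree
        fun q hq hqp => by rw [(Nat.prime_dvd_prime_iff_eq hq hp).1 hqp]; omega
      have h2 := ((hDmem x hx).1.2.mul_left (hDmem x hx).2.2)
      exact hp.one_lt.ne' (Nat.eq_one_of_dvd_coprimes h2 (hpd.trans (Nat.lcm_dvd_mul _ _)) h1))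
    (M := 9 * E ^ 9 / 2 ^ J) (by positivity) hM θ
  have hXr : (2 : ℝ) * (2 ^ (16 * r) : ℕ) * (2 ^ (4 * r) : ℕ) ≤ X / 2 ^ J := by
    rw [le_div_iff₀ (by positivity)]
    have : 2 * 2 ^ (16 * r) * 2 ^ (4 * r) * 2 ^ J ≤ X := by
      refine le_trans ?_ hX
      rw [← pow_succ', ← pow_add, ← pow_add]
      exact Nat.pow_le_pow_right (by norm_num) (by omega)
    exact_mod_cast this
  have hEle : E ≤ 1296 * (r : ℝ) ^ 4 := by
    have := eulerProd_one_le (j := r + 1) (by omega)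
    push_cast at this
    have hr1 : (1 : ℝ) ≤ r := by exact_mod_cast (by omega : 1 ≤ r)
    calc E ≤ 81 * ((r : ℝ) + 1) ^ 4 := this
      _ ≤ 81 * ((r : ℝ) + r) ^ 4 := by gcongr
      _ = _ := by ring
  rw [sum_one_div_divisors_primeProd] at hcore
  simp_rw [coprimeInd_mul_selbergSieve_sub]
  refine hcore.trans ?_
  calc _ ≤ E * (X / 2 ^ J * E ^ 9 + 2 * X * (9 * E ^ 9 / 2 ^ J)) + 4 * X * (E ^ 11 / 2 ^ J) := by
        gcongr
    _ = X / 2 ^ J * (19 * E ^ 10 * 1 + 4 * E ^ 11) := by ring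
    _ ≤ X / 2 ^ J * (19 * E ^ 10 * E + 4 * E ^ 11) := by gcongr
    _ = 23 * X / 2 ^ J * E ^ 11 := by ring
    _ ≤ 23 * X / 2 ^ J * (1296 * (r : ℝ) ^ 4) ^ 11 := by gcongr
    _ = _ := by ring

lemma le_log_and_log_le {X r : ℕ} (hr : 1 ≤ r) (hX : 2 ^ (32 * r) ≤ X)
    (hX' : X < 2 ^ (32 * (r + 1))) : (r : ℝ) ≤ Real.log X ∧ Real.log X ≤ 64 * r := by
  have hX0 : 0 < X := lt_of_lt_of_le (by positivity) hX
  have h2 := Real.log_two_gt_d9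
  have h3 := Real.log_two_lt_d9
  have hr' : (1 : ℝ) ≤ r := by exact_mod_cast hr
  constructor
  · have h1 : Real.log ((2 : ℝ) ^ (32 * r)) ≤ Real.log X :=
      Real.log_le_log (by positivity) (by exact_mod_cast hX)
    rw [Real.log_pow] at h1
    push_cast at h1
    clear hX hX'
    nlinarith
  · have h1 : Real.log X ≤ Real.log ((2 : ℝ) ^ (32 * (r + 1))) :=
      Real.log_le_log (by exact_mod_cast hX0) (by exact_mod_cast hX'.le)
    rw [Real.log_pow] at h1
    push_cast at h1
    clear hX hX'
    nlinarith

lemma div_four_le_selbergNorm (r : ℕ) : (r : ℝ) / 4 ≤ selbergNorm (2 ^ r) := by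
  have h1 := log_le_two_mul_selbergNorm (2 ^ r)
  have h2 : Real.log ((2 : ℝ) ^ r) ≤ Real.log (((2 ^ r : ℕ) : ℝ) + 1) :=
    Real.log_le_log (by positivity) (by push_cast; linarith)
  rw [Real.log_pow] at h2
  have h3 := Real.log_two_gt_d9
  have h4 : (0 : ℝ) ≤ r := by positivity
  nlinarith

lemma log_div_selbergNorm_le {X r : ℕ} (hr : 1 ≤ r) (hX : 2 ^ (32 * r) ≤ X)
    (hX' : X < 2 ^ (32 * (r + 1))) : Real.log X / selbergNorm (2 ^ r) ≤ 256 := by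
  rw [div_le_iff₀ (selbergNorm_pos Nat.one_le_two_pow)]
  linarith [(le_log_and_log_le hr hX hX').2, div_four_le_selbergNorm r]

lemma log_mul_sum_selbergSieve_le {X r : ℕ} (hr : 1 ≤ r) (hX : 2 ^ (32 * r) ≤ X)
    (hX' : X < 2 ^ (32 * (r + 1))) :
    Real.log X * ∑ n ∈ Ico X (2 * X), selbergSieve (2 ^ r) n ≤ 320 * X := by
  have hlog := le_log_and_log_le hr hX hX'
  have hlog0 : 0 ≤ Real.log X := (Nat.cast_nonneg r).trans hlog.1
  have h1 := log_div_selbergNorm_le hr hX hX'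
  have h2 : 2 ^ (5 * r) ≤ X := (Nat.pow_le_pow_right (by norm_num) (by omega)).trans hX
  have h3 : Real.log X * ((2 ^ r : ℕ) : ℝ) ^ 4 ≤ 64 * X := by
    clear hX hX'
    have h4 : (r : ℝ) ≤ 2 ^ r := by exact_mod_cast Nat.lt_two_pow_self.le
    have h5 : (2 : ℝ) ^ (5 * r) ≤ X := by exact_mod_cast h2
    push_cast
    calc Real.log X * ((2 : ℝ) ^ r) ^ 4 ≤ (64 * r) * ((2 : ℝ) ^ r) ^ 4 :=
          mul_le_mul_of_nonneg_right hlog.2 (by positivity)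
      _ ≤ (64 * 2 ^ r) * ((2 : ℝ) ^ r) ^ 4 := by gcongr
      _ = 64 * 2 ^ (5 * r) := by ring
      _ ≤ 64 * X := by linarith
  have h6 := mul_le_mul_of_nonneg_left
    (sum_selbergSieve_le X (R := 2 ^ r) Nat.one_le_two_pow) hlog0
  refine h6.trans ?_
  have h7 := mul_le_mul_of_nonneg_right h1 (Nat.cast_nonneg (α := ℝ) X)
  rw [mul_add]
  have h8 : Real.log X * (X / selbergNorm (2 ^ r)) = Real.log X / selbergNorm (2 ^ r) * X := by
    ring
  linarith

lemma sum_selbergSieve_pow_le {X : ℕ} (hX : X ≠ 0) (R m : ℕ) :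
    ∑ n ∈ Ico X (2 * X), selbergSieve R n ^ m ≤ 2 * X * eulerProd 1 (2 * X) ^ 9 ^ m := by
  have h1 := sum_Ico_pow_card_primeFactors_le X (K := ((9 ^ m - 1 : ℕ) : ℝ)) (by positivity)
  have h9 : 1 ≤ 9 ^ m := Nat.one_le_pow _ _ (by norm_num)
  have hK : 1 + ((9 ^ m - 1 : ℕ) : ℝ) = 9 ^ m := by
    rw [Nat.cast_sub h9]; push_cast; ring
  rw [hK] at h1
  calc _ ≤ ∑ n ∈ Ico X (2 * X), ((9 : ℝ) ^ m) ^ #n.primeFactors := by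
        refine sum_le_sum fun n hn => ?_
        rw [← pow_mul, mul_comm m, pow_mul]
        have hn0 : n ≠ 0 := by have := (mem_Ico.1 hn).1; omega
        exact pow_le_pow_left₀ (selbergSieve_nonneg R n) (selbergSieve_le hn0) m
    _ ≤ _ := h1
    _ ≤ 2 * X * eulerProd 1 (2 * X) ^ (9 ^ m - 1) := by
        gcongr
        exact eulerProd_natCast_le _ _
    _ ≤ _ := by
        gcongr
        · exact one_le_eulerProd zero_le_one _
        · omega

lemma eventually_sq_mul_clog_le (A : ℕ) :
    ∃ r₀ : ℕ, ∀ r ≥ r₀, (A * Nat.clog 2 r + 1) ^ 2 ≤ r := by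
  have h1 := tendsto_pow_const_div_const_pow_of_one_lt 2 (one_lt_two : (1 : ℝ) < 2)
  have h2 : ∀ᶠ l : ℕ in Filter.atTop, (l : ℝ) ^ 2 / 2 ^ l < 1 / (2 * (A + 1) ^ 2) :=
    h1.eventually_lt_const (by positivity)
  obtain ⟨l₀, hl₀⟩ := Filter.eventually_atTop.1 h2
  refine ⟨2 ^ (l₀ + 1) + 2, fun r hr => ?_⟩
  set l := Nat.clog 2 r with hl
  have hr2 : 1 < r := (Nat.le_add_left 2 _).trans hr
  have h3 : r ≤ 2 ^ l := Nat.le_pow_clog one_lt_two r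
  have h4 : l₀ + 1 < l := by
    by_contra h
    have : 2 ^ l ≤ 2 ^ (l₀ + 1) := Nat.pow_le_pow_right (by norm_num) (by omega)
    omega
  have h5 : 2 ^ l.pred < r := Nat.pow_pred_clog_lt_self one_lt_two hr2
  have h6 := hl₀ l (by omega)
  rw [div_lt_div_iff₀ (by positivity) (by positivity)] at h6
  have h7 : (l : ℝ) ^ 2 * (2 * (A + 1) ^ 2) < 1 * 2 ^ l := h6
  have h8 : (2 : ℝ) ^ l = 2 * 2 ^ l.pred := by
    rw [← pow_succ']; congr 1; simp only [Nat.pred_eq_sub_one]; omega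
  have h9 : (l : ℝ) ^ 2 * (A + 1) ^ 2 < 2 ^ l.pred := by linarith
  have h10 : l ^ 2 * (A + 1) ^ 2 < 2 ^ l.pred := by exact_mod_cast h9
  have h11 : (A * l + 1) ^ 2 ≤ l ^ 2 * (A + 1) ^ 2 := by
    rw [← mul_pow]
    exact Nat.pow_le_pow_left (by nlinarith) 2
  omega

lemma eulerProd_one_two_mul_le {X r : ℕ} (hr : 1 ≤ r) (hX' : X < 2 ^ (32 * (r + 1))) :
    eulerProd 1 (2 * X) ≤ 81 * 65 ^ 4 * (r : ℝ) ^ 4 := by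
  have h3 : 2 * X ≤ 2 ^ (65 * r) := by
    have h1 : 2 * X ≤ 2 * 2 ^ (32 * (r + 1)) := Nat.mul_le_mul_left 2 hX'.le
    rw [← pow_succ'] at h1
    exact h1.trans (Nat.pow_le_pow_right (by norm_num) (by omega))
  have h4 := (eulerProd_mono zero_le_one h3).trans (eulerProd_one_le (by omega))
  clear h3 hX'
  push_cast at h4
  refine h4.trans_eq ?_
  ring

/-- A majorant of the primes which is well approximated by models for the von Mangoldt function
at all scales `2 ^ j`. -/
lemma exists_majorant (A m : ℕ) (hA : 2 ≤ A) : ∃ K : ℝ, 1 ≤ K ∧ ∃ r₀ : ℕ, 1 ≤ r₀ ∧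
    ∀ r ≥ r₀, ∀ X : ℕ, 2 ^ (32 * r) ≤ X → X < 2 ^ (32 * (r + 1)) →
    ∃ (Lam : ℕ → ℝ) (κ : ℝ) (J : ℕ), (∀ n, 0 ≤ Lam n) ∧
      (∀ p, p.Prime → X ≤ p → Lam p = Real.log X) ∧
      ∑ n ∈ Ico X (2 * X), Lam n ≤ K * X ∧ 0 ≤ κ ∧ κ ≤ K ∧ 64 * r ≤ 2 ^ J ∧ J ≤ r ∧
      (∀ j < J, ∀ θ : ℝ, ‖∑ n ∈ Ico X (2 * X),
        ((sieveModel (2 ^ (j + 1)) n - sieveModel (2 ^ j) n : ℝ) : ℂ) * eC (θ * n)‖ ≤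
          K * X * (j + 1 : ℝ) ^ 24 / 2 ^ j) ∧
      (∀ θ : ℝ, ‖∑ n ∈ Ico X (2 * X), ((Lam n - κ * sieveModel (2 ^ J) n : ℝ) : ℂ) *
        eC (θ * n)‖ ≤ K * X * (r : ℝ) ^ 45 / (r : ℝ) ^ A) ∧
      ∑ n ∈ Ico X (2 * X), Lam n ^ m ≤ K * X * (r : ℝ) ^ (m + 4 * 9 ^ m) := by
  obtain ⟨r₁, hr₁⟩ := eventually_sq_mul_clog_le A
  obtain ⟨K₁, hK₁⟩ : ∃ K₁ : ℝ, K₁ = 64 ^ m * 2 * (81 * 65 ^ 4) ^ 9 ^ m := ⟨_, rfl⟩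
  have hK₁0 : 0 ≤ K₁ := by rw [hK₁]; positivity
  obtain ⟨K, hK⟩ : ∃ K : ℝ, K = 64 * 23 * 1296 ^ 11 + K₁ := ⟨_, rfl⟩
  refine ⟨K, by rw [hK]; linarith, max r₁ 64, le_max_of_le_right (by norm_num), ?_⟩
  intro r hr X hX hX'
  have hr64 : 64 ≤ r := (le_max_right _ _).trans hr
  have hr1 : 1 ≤ r := by omega
  have hrR : (1 : ℝ) ≤ r := by exact_mod_cast hr1
  obtain ⟨l, hl⟩ : ∃ l, l = Nat.clog 2 r := ⟨_, rfl⟩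
  obtain ⟨J, hJ⟩ : ∃ J, J = A * l := ⟨_, rfl⟩
  have hJr2 : (J + 1) ^ 2 ≤ r := by
    rw [hJ, hl]; exact hr₁ r ((le_max_left _ _).trans hr)
  have hJr : J ≤ r := (Nat.le_succ J).trans ((Nat.le_self_pow two_ne_zero _).trans hJr2)
  have hJ1 : 1 ≤ J := by
    rw [hJ, hl]
    exact Nat.mul_pos (by omega) (Nat.clog_pos one_lt_two (by omega))
  have hrJ : r ^ A ≤ 2 ^ J := by
    rw [hJ, hl, mul_comm, pow_mul]
    exact Nat.pow_le_pow_left (Nat.le_pow_clog one_lt_two r) A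
  have hlog := le_log_and_log_le hr1 hX hX'
  have hlog0 : 0 ≤ Real.log X := by linarith
  have hX0 : 0 < X := lt_of_lt_of_le (by positivity) hX
  have hG := selbergNorm_pos (R := 2 ^ r) Nat.one_le_two_pow
  have hmean := roughMean_nonneg_and_le (R := 2 ^ r) Nat.one_le_two_pow (2 ^ J)
  have hGle := log_div_selbergNorm_le hr1 hX hX'
  have hLle : ∀ n, Real.log X * (coprimeInd (primeProd (2 ^ J)) n * selbergSieve (2 ^ r) n) ≤
      Real.log X * selbergSieve (2 ^ r) n := fun n => by
    have := mul_le_of_le_one_left (selbergSieve_nonneg (2 ^ r) n)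
      (coprimeInd_le_one (primeProd (2 ^ J)) n)
    gcongr
  have hL0 : ∀ n, 0 ≤ Real.log X *
      (coprimeInd (primeProd (2 ^ J)) n * selbergSieve (2 ^ r) n) := fun n =>
    mul_nonneg hlog0 (mul_nonneg (coprimeInd_nonneg _ _) (selbergSieve_nonneg _ _))
  refine ⟨fun n => Real.log X * (coprimeInd (primeProd (2 ^ J)) n * selbergSieve (2 ^ r) n),
    Real.log X * roughMean (2 ^ r) (2 ^ J), J, hL0, ?_, ?_, mul_nonneg hlog0 hmean.1, ?_, ?_,
    hJr, ?_, ?_, ?_⟩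
  · intro p hp hXp
    have h1 : 2 ^ r < p := lt_of_lt_of_le
      (Nat.pow_lt_pow_right (by norm_num) (by omega : r < 32 * r)) (hX.trans hXp)
    have h2 : 2 ^ J < p := lt_of_le_of_lt (Nat.pow_le_pow_right (by norm_num) hJr) h1
    have h3 : p.Coprime (primeProd (2 ^ J)) := by
      rw [hp.coprime_iff_not_dvd]
      intro h
      have := lt_of_dvd_primeProd hp h
      omega
    simp only
    rw [selbergSieve_prime Nat.one_le_two_pow hp h1, coprimeInd, if_pos h3, mul_one, mul_one]
  · refine (sum_le_sum fun n _ => hLle n).trans ?_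
    rw [← mul_sum]
    refine (log_mul_sum_selbergSieve_le hr1 hX hX').trans ?_
    refine mul_le_mul_of_nonneg_right ?_ (Nat.cast_nonneg X)
    rw [hK]; linarith
  · calc Real.log X * roughMean (2 ^ r) (2 ^ J) ≤ Real.log X * (1 / selbergNorm (2 ^ r)) := by
          gcongr; exact hmean.2
      _ = Real.log X / selbergNorm (2 ^ r) := by ring
      _ ≤ K := hGle.trans (by rw [hK]; linarith)
  · refine le_trans ?_ hrJ
    calc 64 * r ≤ r * r := by gcongr
      _ = r ^ 2 := by ring
      _ ≤ r ^ A := Nat.pow_le_pow_right hr1 hA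
  · intro j hj θ
    refine (norm_expSum_sieveModel_sub_le hX hr1
      ((Nat.pow_le_pow_left (by omega) 2).trans hJr2) θ).trans ?_
    have h7 : 7 * 81 ^ 6 ≤ K := by rw [hK]; linarith
    clear hX hX' hrJ hJr2
    gcongr
  · intro θ
    have h1 := norm_expSum_selbergSieve_sub_le hX hJ1 hJr2 θ
    have h2 : ∑ n ∈ Ico X (2 * X), ((Real.log X * (coprimeInd (primeProd (2 ^ J)) n *
        selbergSieve (2 ^ r) n) - Real.log X * roughMean (2 ^ r) (2 ^ J) *
        sieveModel (2 ^ J) n : ℝ) : ℂ) * eC (θ * n) =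
        (Real.log X : ℝ) * ∑ n ∈ Ico X (2 * X), ((coprimeInd (primeProd (2 ^ J)) n *
        selbergSieve (2 ^ r) n - roughMean (2 ^ r) (2 ^ J) * sieveModel (2 ^ J) n : ℝ) : ℂ) *
        eC (θ * n) := by
      rw [mul_sum]
      refine sum_congr rfl fun n _ => ?_
      push_cast
      ring
    rw [h2, norm_mul, Complex.norm_real, Real.norm_of_nonneg hlog0]
    have h3 : (r : ℝ) ^ A ≤ 2 ^ J := by exact_mod_cast hrJ
    clear hX hX' hrJ hJr2
    calc _ ≤ 64 * r * (23 * 1296 ^ 11 * X * (r : ℝ) ^ 44 / 2 ^ J) := by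
          gcongr
          exact hlog.2
      _ = 64 * 23 * 1296 ^ 11 * X * (r : ℝ) ^ 45 / 2 ^ J := by ring
      _ ≤ K * X * (r : ℝ) ^ 45 / (r : ℝ) ^ A := by
          have hK' : 64 * 23 * 1296 ^ 11 ≤ K := by rw [hK]; linarith
          have hK0 : 0 ≤ K := le_trans (by positivity) hK'
          gcongr
  · have h1 := sum_selbergSieve_pow_le hX0.ne' (2 ^ r) m
    have h2 := eulerProd_one_two_mul_le hr1 hX'
    clear hX hX' hrJ hJr2
    have hE0 : 0 ≤ eulerProd 1 (2 * X) := eulerProd_nonneg zero_le_one _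
    calc _ ≤ ∑ n ∈ Ico X (2 * X), Real.log X ^ m * selbergSieve (2 ^ r) n ^ m := by
          refine sum_le_sum fun n _ => ?_
          rw [← mul_pow]
          exact pow_le_pow_left₀ (hL0 n) (hLle n) m
      _ ≤ (64 * r) ^ m * (2 * X * (81 * 65 ^ 4 * (r : ℝ) ^ 4) ^ 9 ^ m) := by
          rw [← mul_sum]
          have := hlog.2
          refine mul_le_mul (pow_le_pow_left₀ hlog0 this m) (h1.trans ?_)
            (sum_nonneg fun n _ => pow_nonneg (selbergSieve_nonneg _ _) _) (by positivity)
          gcongr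
      _ = K₁ * X * (r : ℝ) ^ (m + 4 * 9 ^ m) := by
          rw [hK₁, mul_pow, mul_pow, ← pow_mul, pow_add]
          ring
      _ ≤ K * X * (r : ℝ) ^ (m + 4 * 9 ^ m) := by
          gcongr
          rw [hK]; linarith

lemma fourierSup_nonneg (s : Finset ℕ) (f : ℕ → ℝ) : 0 ≤ fourierSup s f :=
  Real.iSup_nonneg fun _ => norm_nonneg _

lemma fourierSup_le {s : Finset ℕ} {f : ℕ → ℝ} {B : ℝ}
    (h : ∀ θ : ℝ, ‖∑ x ∈ s, (f x : ℂ) * eC (θ * x)‖ ≤ B) : fourierSup s f ≤ B :=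
  ciSup_le h

lemma supOn_nonneg (s : Finset ℕ) (f : ℕ → ℝ) : 0 ≤ supOn s f :=
  Real.iSup_nonneg fun _ => Real.iSup_nonneg fun _ => abs_nonneg _

lemma supOn_le {s : Finset ℕ} {f : ℕ → ℝ} {B : ℝ} (hB : 0 ≤ B) (h : ∀ x, |f x| ≤ B) :
    supOn s f ≤ B :=
  Real.iSup_le (fun x => Real.iSup_le (fun _ => h x) hB) hB

lemma rpow_mul_rpow_le {a b M t c : ℝ} (hc : 0 ≤ c) (hc' : c ≤ 1) (ha : 0 ≤ a) (hb : 0 ≤ b)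
    (hM : 0 < M) (ht : 0 ≤ t) (haM : a ≤ M * t) (hbM : b ≤ M) :
    a ^ c * b ^ (1 - c) ≤ M * t ^ c := by
  calc a ^ c * b ^ (1 - c) ≤ (M * t) ^ c * M ^ (1 - c) := by
        have := sub_nonneg.2 hc'
        gcongr
    _ = M ^ c * M ^ (1 - c) * t ^ c := by rw [Real.mul_rpow hM.le ht]; ring
    _ = M * t ^ c := by rw [← Real.rpow_add hM]; simp

lemma inv_primeDensity_two_pow_le {j : ℕ} (hj : 1 ≤ j) :
    (primeDensity (2 ^ j))⁻¹ ≤ 81 ^ 2 * (j : ℝ) ^ 8 := by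
  refine (inv_primeDensity_le_eulerProd _).trans ?_
  calc eulerProd 1 (2 ^ j) ^ 2 ≤ (81 * (j : ℝ) ^ 4) ^ 2 :=
        pow_le_pow_left₀ (eulerProd_nonneg zero_le_one _) (eulerProd_one_le hj) 2
    _ = _ := by ring

lemma sieveModel_two_pow_le (j n : ℕ) :
    sieveModel (2 ^ j) n ≤ 81 ^ 2 * ((j : ℝ) + 1) ^ 8 := by
  refine (sieveModel_le _ _).trans ?_
  rcases Nat.eq_zero_or_pos j with rfl | hj
  · refine (inv_primeDensity_le Nat.one_le_two_pow).trans ?_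
    norm_num
  · refine (inv_primeDensity_two_pow_le hj).trans ?_
    gcongr
    linarith

lemma primeProd_dvd_factorial {w Q : ℕ} (h : w ≤ Q) : primeProd w ∣ Q.factorial := by
  rw [primeProd]
  refine Finset.prod_primes_dvd _ (fun p hp => ?_) (fun p hp => ?_)
  · exact (Nat.prime_of_mem_primesBelow hp).prime
  · exact Nat.dvd_factorial (Nat.prime_of_mem_primesBelow hp).pos
      ((Nat.lt_of_mem_primesBelow hp).le.trans h)

lemma coprimeInd_mod {P N : ℕ} (h : P ∣ N) (n : ℕ) : coprimeInd P (n % N) = coprimeInd P n := by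
  have h1 : (n % N).Coprime P ↔ n.Coprime P := by
    rw [Nat.Coprime, Nat.Coprime, ((Nat.mod_modEq n N).of_dvd h).gcd_eq]
  simp only [coprimeInd, h1]

lemma exists_periodic_extension {w Q : ℕ} (h : w ≤ Q) : ∃ F : ℤ → ℝ,
    (∀ x : ℤ, F (x + Q.factorial) = F x) ∧ (∀ x, 0 ≤ F x) ∧
    (∀ x, F x ≤ (primeDensity w)⁻¹) ∧ ∀ n : ℕ, F n = sieveModel w n := by
  refine ⟨fun x => sieveModel w (x % (Q.factorial : ℤ)).toNat, fun x => ?_,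
    fun x => sieveModel_nonneg _ _, fun x => sieveModel_le _ _, fun n => ?_⟩
  · simp only [Int.add_emod_right]
  · dsimp only
    rw [← Int.natCast_mod, Int.toNat_natCast, sieveModel, sieveModel,
      coprimeInd_mod (primeProd_dvd_factorial h)]

lemma exists_exponents {c : ℝ} (hc : 0 < c) : ∃ m a b : ℕ, 1 ≤ m ∧ 1 ≤ a ∧ 8 ≤ b ∧
    b * (m - 1) = a + (m + 4 * 9 ^ m) ∧ (b : ℝ) + 1 ≤ (a + b) * c := by
  obtain ⟨m, hm⟩ : ∃ m : ℕ, m = ⌈1 / c⌉₊ + 2 := ⟨_, rfl⟩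
  have hmc : 1 ≤ ((m : ℝ) - 2) * c := by
    rw [← div_le_iff₀ hc, hm]
    push_cast
    linarith [Nat.le_ceil (1 / c)]
  obtain ⟨B, hB⟩ : ∃ B : ℕ, B = m + 4 * 9 ^ m := ⟨_, rfl⟩
  have hm3 : 3 ≤ m := by
    have := Nat.ceil_pos.2 (one_div_pos.2 hc)
    omega
  obtain ⟨k, rfl⟩ : ∃ k, m = k + 3 := ⟨m - 3, by omega⟩
  refine ⟨k + 3, (B + 8) * (k + 1) + 8, B + 8, by omega, by omega, by omega, ?_, ?_⟩
  · rw [← hB, Nat.add_sub_assoc (by norm_num)]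
    ring
  · push_cast at hmc ⊢
    have h1 : (B : ℝ) + 8 ≤ ((B : ℝ) + 8) * ((k + 3 - 2) * c) :=
      le_mul_of_one_le_right (by positivity) hmc
    have h2 : 1 ≤ c * (B + 8) := by
      have h3 : (k : ℝ) + 3 ≤ B := by
        have : k + 3 ≤ B := by omega
        exact_mod_cast this
      nlinarith
    linarith

lemma exists_truncation {c : ℝ} (hc : 0 < c) : ∃ (K : ℝ) (a b : ℕ), 1 ≤ K ∧ 1 ≤ a ∧
    (b : ℝ) + 1 ≤ (a + b) * c ∧ ∃ r₀ : ℕ, 1 ≤ r₀ ∧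
    ∀ r ≥ r₀, ∀ X : ℕ, 2 ^ (32 * r) ≤ X → X < 2 ^ (32 * (r + 1)) →
    ∃ (Lam g h : ℕ → ℝ) (κ : ℝ) (J : ℕ), (∀ n, 0 ≤ Lam n) ∧
      (∀ p, p.Prime → X ≤ p → Lam p = Real.log X) ∧
      ∑ n ∈ Ico X (2 * X), Lam n ≤ K * X ∧ 0 ≤ κ ∧ κ ≤ K ∧ 64 * r ≤ 2 ^ J ∧ J ≤ r ∧
      (∀ j < J, ∀ θ : ℝ, ‖∑ n ∈ Ico X (2 * X),
        ((sieveModel (2 ^ (j + 1)) n - sieveModel (2 ^ j) n : ℝ) : ℂ) * eC (θ * n)‖ ≤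
          K * X * (j + 1 : ℝ) ^ 24 / 2 ^ j) ∧
      (∀ n, Lam n - κ * sieveModel (2 ^ J) n = g n + h n) ∧
      (∀ n, |g n| ≤ K * (r : ℝ) ^ b) ∧
      (∀ θ : ℝ, ‖∑ n ∈ Ico X (2 * X), (g n : ℂ) * eC (θ * n)‖ ≤ K * X / (r : ℝ) ^ a) ∧
      ∑ n ∈ Ico X (2 * X), |h n| ≤ K * X / (r : ℝ) ^ a := by
  obtain ⟨m, a, b, hm, ha, hb, hab, habc⟩ := exists_exponents hc
  obtain ⟨K, hK, r₀, hr₀, H⟩ := exists_majorant (a + 45) m (by omega)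
  refine ⟨K * (81 ^ 2 * 256), a, b, by linarith, ha, habc, r₀, hr₀, fun r hr X hX hX' => ?_⟩
  obtain ⟨Lam, κ, J, hL0, hLp, hLs, hκ0, hκ, hrJ, hJr, hF, hf, hmom⟩ := H r hr X hX hX'
  have hr1 : 1 ≤ r := hr₀.trans hr
  clear hX hX' H hr hr₀
  have hrR : (1 : ℝ) ≤ r := by exact_mod_cast hr1
  have hKK : K ≤ K * (81 ^ 2 * 256) := by linarith
  have hJR : (J : ℝ) ≤ r := by exact_mod_cast hJr
  obtain ⟨L, hL⟩ : ∃ L : ℝ, L = K * (81 ^ 2 * 256) * (r : ℝ) ^ b := ⟨_, rfl⟩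
  have hmodel : ∀ n, κ * sieveModel (2 ^ J) n ≤ L := fun n => by
    have h1 := sieveModel_two_pow_le J n
    have h0 := sieveModel_nonneg (2 ^ J) n
    calc κ * sieveModel (2 ^ J) n ≤ K * (81 ^ 2 * ((J : ℝ) + 1) ^ 8) := by gcongr
      _ ≤ K * (81 ^ 2 * (2 * (r : ℝ)) ^ 8) := by gcongr; linarith
      _ = K * (81 ^ 2 * 256) * (r : ℝ) ^ 8 := by ring
      _ ≤ L := by rw [hL]; gcongr
  have hmodel0 : ∀ n, 0 ≤ κ * sieveModel (2 ^ J) n := fun n =>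
    mul_nonneg hκ0 (sieveModel_nonneg _ _)
  have hrL : (r : ℝ) ^ b ≤ L := by
    rw [hL]; exact le_mul_of_one_le_left (by positivity) (by linarith)
  have hL0' : 0 < L := lt_of_lt_of_le (by positivity) hrL
  obtain ⟨f, hfdef⟩ : ∃ f : ℕ → ℝ, f = fun n => Lam n - κ * sieveModel (2 ^ J) n := ⟨_, rfl⟩
  have hh : ∀ n, |if Lam n ≤ L then 0 else f n| ≤ Lam n ^ m / (r : ℝ) ^ (b * (m - 1)) := by
    intro n
    split_ifs with hn
    · rw [abs_zero]; have := hL0 n; positivity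
    · push Not at hn
      have h1 := hmodel n
      have h2 := hmodel0 n
      rw [hfdef, abs_of_nonneg (by dsimp only; linarith), le_div_iff₀ (by positivity)]
      calc (Lam n - κ * sieveModel (2 ^ J) n) * (r : ℝ) ^ (b * (m - 1))
          ≤ Lam n * Lam n ^ (m - 1) := by
            have h3 : (r : ℝ) ^ b ≤ Lam n := hrL.trans hn.le
            have h4 := hL0 n
            rw [pow_mul]
            gcongr
            linarith
        _ = Lam n ^ m := by rw [← pow_succ']; congr 1; omega
  have hhs : ∑ n ∈ Ico X (2 * X), |if Lam n ≤ L then 0 else f n| ≤ K * X / (r : ℝ) ^ a := by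
    refine (sum_le_sum fun n _ => hh n).trans ?_
    rw [← sum_div, div_le_div_iff₀ (by positivity) (by positivity)]
    calc _ ≤ K * X * (r : ℝ) ^ (m + 4 * 9 ^ m) * (r : ℝ) ^ a := by gcongr
      _ = _ := by rw [hab, pow_add]; ring
  refine ⟨Lam, fun n => if Lam n ≤ L then f n else 0, fun n => if Lam n ≤ L then 0 else f n,
    κ, J, hL0, hLp, hLs.trans (by gcongr), hκ0, hκ.trans hKK, hrJ, hJr,
    fun j hj θ => (hF j hj θ).trans (by gcongr), fun n => ?_, fun n => ?_, fun θ => ?_,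
    hhs.trans (by gcongr)⟩
  · rw [hfdef]; dsimp only; split_ifs <;> simp
  · dsimp only
    rw [← hL]
    split_ifs with hn
    · rw [hfdef, abs_le]
      have h1 := hmodel n
      have h2 := hmodel0 n
      have h3 := hL0 n
      constructor <;> dsimp only <;> linarith
    · rw [abs_zero]; exact hL0'.le
  · have h1 : ∑ n ∈ Ico X (2 * X), ((if Lam n ≤ L then f n else 0 : ℝ) : ℂ) * eC (θ * n) =
        ∑ n ∈ Ico X (2 * X), ((Lam n - κ * sieveModel (2 ^ J) n : ℝ) : ℂ) * eC (θ * n) -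
        ∑ n ∈ Ico X (2 * X), ((if Lam n ≤ L then 0 else f n : ℝ) : ℂ) * eC (θ * n) := by
      rw [← sum_sub_distrib]
      refine sum_congr rfl fun n _ => ?_
      rw [hfdef]
      split_ifs <;> simp
    rw [h1]
    refine (norm_sub_le _ _).trans ?_
    have h2 : ‖∑ n ∈ Ico X (2 * X), ((if Lam n ≤ L then 0 else f n : ℝ) : ℂ) * eC (θ * n)‖ ≤
        K * X / (r : ℝ) ^ a := by
      refine (norm_sum_le _ _).trans (le_trans (le_of_eq (sum_congr rfl fun n _ => ?_)) hhs)
      rw [norm_mul, norm_eC, mul_one, Complex.norm_real, Real.norm_eq_abs]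
    have h3 : K * X * (r : ℝ) ^ 45 / (r : ℝ) ^ (a + 45) = K * X / (r : ℝ) ^ a := by
      have : (r : ℝ) ≠ 0 := by positivity
      rw [pow_add]; field_simp
    have h4 := hf θ
    rw [h3] at h4
    calc _ ≤ K * X / (r : ℝ) ^ a + K * X / (r : ℝ) ^ a := add_le_add h4 h2
      _ = 2 * K * X / (r : ℝ) ^ a := by ring
      _ ≤ K * (81 ^ 2 * 256) * X / (r : ℝ) ^ a := by
          have h5 : 2 * K ≤ K * (81 ^ 2 * 256) := by linarith
          gcongr

lemma summable_succ_pow_mul_geometric (k : ℕ) {ρ : ℝ} (hρ0 : 0 < ρ) (hρ1 : ρ < 1) :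
    Summable fun j : ℕ => ((j : ℝ) + 1) ^ k * ρ ^ j := by
  have h1 := summable_pow_mul_geometric_of_norm_lt_one (R := ℝ) k (r := ρ)
    (by rwa [Real.norm_of_nonneg hρ0.le])
  have h2 := ((summable_nat_add_iff 1).2 h1).mul_left ρ⁻¹
  refine h2.congr fun j => ?_
  rw [pow_succ ρ]
  push_cast
  field_simp

/-- Dyadic sums of a polynomial in `j` against `2 ^ (-c * j)` decay in the starting scale. -/
lemma exists_dyadic_tail_bound {c : ℝ} (hc : 0 < c) : ∃ S : ℝ, 0 ≤ S ∧ ∀ Q j₀ N : ℕ, 0 < Q →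
    Q ≤ 2 ^ (j₀ + 1) → ∑ i ∈ range N, ((j₀ + i : ℕ) + 1 : ℝ) ^ 24 * ((2 : ℝ) ^ (j₀ + i)) ^ (-c) ≤
      S * (Q : ℝ) ^ (-(c / 4)) := by
  obtain ⟨ρ, hρ⟩ : ∃ ρ : ℝ, ρ = 2 ^ (-(3 * c / 4)) := ⟨_, rfl⟩
  have hρ0 : 0 < ρ := by rw [hρ]; positivity
  have hρ1 : ρ < 1 := by
    rw [hρ]; exact Real.rpow_lt_one_of_one_lt_of_neg one_lt_two (by linarith)
  have hsum := summable_succ_pow_mul_geometric 24 hρ0 hρ1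
  have hF0 : ∀ j : ℕ, 0 ≤ ((j : ℝ) + 1) ^ 24 * ρ ^ j := fun j => by positivity
  refine ⟨2 ^ (c / 4) * ∑' j : ℕ, ((j : ℝ) + 1) ^ 24 * ρ ^ j,
    mul_nonneg (by positivity) (tsum_nonneg hF0), fun Q j₀ N hQ hQj => ?_⟩
  have hQ0 : (0 : ℝ) < Q := by exact_mod_cast hQ
  have hterm : ∀ j : ℕ, j₀ ≤ j → ((2 : ℝ) ^ j) ^ (-c) ≤ 2 ^ (c / 4) * Q ^ (-(c / 4)) * ρ ^ j := by
    intro j hj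
    have h1 : (Q : ℝ) ≤ 2 * 2 ^ j := by
      rw [← pow_succ']
      exact_mod_cast hQj.trans (Nat.pow_le_pow_right two_pos (by omega))
    have h2 : (2 * (2 : ℝ) ^ j) ^ (-(c / 4)) ≤ (Q : ℝ) ^ (-(c / 4)) :=
      Real.rpow_le_rpow_of_nonpos hQ0 h1 (by linarith)
    have h3 : ρ ^ j = ((2 : ℝ) ^ j) ^ (-(3 * c / 4)) := by
      rw [hρ, ← Real.rpow_natCast, ← Real.rpow_mul two_pos.le, mul_comm,
        Real.rpow_mul two_pos.le, Real.rpow_natCast]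
    calc ((2 : ℝ) ^ j) ^ (-c) = ((2 : ℝ) ^ j) ^ (-(c / 4)) * ρ ^ j := by
          rw [h3, ← Real.rpow_add (by positivity)]; congr 1; ring
      _ = 2 ^ (c / 4) * (2 * (2 : ℝ) ^ j) ^ (-(c / 4)) * ρ ^ j := by
          rw [Real.mul_rpow two_pos.le (by positivity), ← mul_assoc (2 ^ (c / 4) : ℝ),
            ← Real.rpow_add two_pos, add_neg_cancel, Real.rpow_zero, one_mul]
      _ ≤ _ := by gcongr
  calc _ ≤ ∑ i ∈ range N, 2 ^ (c / 4) * (Q : ℝ) ^ (-(c / 4)) *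
        (((j₀ + i : ℕ) + 1 : ℝ) ^ 24 * ρ ^ (j₀ + i)) := by
        refine sum_le_sum fun i _ => ?_
        have h4 := mul_le_mul_of_nonneg_left (hterm (j₀ + i) (Nat.le_add_right _ _))
          (by positivity : (0 : ℝ) ≤ ((j₀ + i : ℕ) + 1 : ℝ) ^ 24)
        linarith
    _ ≤ 2 ^ (c / 4) * (Q : ℝ) ^ (-(c / 4)) * ∑' j : ℕ, ((j : ℝ) + 1) ^ 24 * ρ ^ j := by
        rw [← mul_sum]
        refine mul_le_mul_of_nonneg_left ?_ (by positivity)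
        have h5 : ∑ i ∈ range N, ((j₀ + i : ℕ) + 1 : ℝ) ^ 24 * ρ ^ (j₀ + i) =
            ∑ j ∈ Ico j₀ (j₀ + N), ((j : ℝ) + 1) ^ 24 * ρ ^ j := by
          rw [sum_Ico_eq_sum_range, Nat.add_sub_cancel_left]
        rw [h5]
        exact hsum.sum_le_tsum _ fun j _ => hF0 j
    _ = _ := by ring

lemma avgR_Ico_le {X : ℕ} (hX : 0 < X) {f : ℕ → ℝ} {B : ℝ}
    (h : ∑ n ∈ Ico X (2 * X), f n ≤ B * X) : avgR (Ico X (2 * X)) f ≤ B := by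
  have h1 : #(Ico X (2 * X)) = X := by rw [Nat.card_Ico]; omega
  have hX' : (0 : ℝ) < X := by exact_mod_cast hX
  rw [avgR, h1, div_le_iff₀ hX']
  exact h

lemma inv_pow_le_div {r Q a : ℕ} (ha : 1 ≤ a) (hr : 1 ≤ r) (hQ : 0 < Q) (hQr : (Q : ℝ) ≤ 64 * r) :
    1 / (r : ℝ) ^ a ≤ 64 / Q := by
  have hr' : (1 : ℝ) ≤ r := by exact_mod_cast hr
  have hQ0 : (0 : ℝ) < Q := by exact_mod_cast hQ
  rw [div_le_div_iff₀ (by positivity) hQ0]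
  have := le_self_pow₀ hr' (by omega : a ≠ 0)
  linarith

/-- The contribution of the truncated error term to the sum of interpolated norms. -/
lemma pow_mul_rpow_le {c : ℝ} (hc : 0 < c) (hc' : c < 1) {a b r X Q : ℕ} (hr : 1 ≤ r) (hQ : 0 < Q)
    (hQr : (Q : ℝ) ≤ 64 * r) (hab : (b : ℝ) + 1 ≤ (a + b) * c) :
    (r : ℝ) ^ b * (X / (r : ℝ) ^ (a + b)) ^ c ≤ 64 * (X : ℝ) ^ c * (Q : ℝ) ^ (-(c / 4)) := by
  have hr' : (1 : ℝ) ≤ r := by exact_mod_cast hr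
  have hQ0 : (1 : ℝ) ≤ Q := by exact_mod_cast hQ
  have h1 : ((r : ℝ) ^ (a + b)) ^ c = (r : ℝ) ^ ((a + b) * c) := by
    rw [← Real.rpow_natCast, ← Real.rpow_mul (by linarith)]; push_cast; rfl
  have h2 : (r : ℝ) ^ (b + 1) ≤ (r : ℝ) ^ ((a + b) * c) := by
    rw [← Real.rpow_natCast]
    exact Real.rpow_le_rpow_of_exponent_le hr' (by push_cast; exact hab)
  have h3 : 1 / (r : ℝ) ^ 1 ≤ 64 / Q := inv_pow_le_div le_rfl hr hQ hQr
  have h4 : 1 / (Q : ℝ) ≤ (Q : ℝ) ^ (-(c / 4)) := by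
    rw [one_div, ← Real.rpow_neg_one]
    exact Real.rpow_le_rpow_of_exponent_le hQ0 (by linarith)
  rw [Real.div_rpow (Nat.cast_nonneg _) (by positivity), h1]
  calc (r : ℝ) ^ b * ((X : ℝ) ^ c / (r : ℝ) ^ ((a + b) * c)) ≤
        (r : ℝ) ^ b * ((X : ℝ) ^ c / (r : ℝ) ^ (b + 1)) := by gcongr
    _ = (X : ℝ) ^ c * (1 / (r : ℝ) ^ 1) := by rw [pow_add]; field_simp
    _ ≤ (X : ℝ) ^ c * (64 * (Q : ℝ) ^ (-(c / 4))) := by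
        refine mul_le_mul_of_nonneg_left (h3.trans ?_) (by positivity)
        rw [div_eq_mul_one_div]
        linarith
    _ = _ := by ring

lemma one_le_log_natCast {Q : ℕ} (hQ : 3 ≤ Q) : 1 ≤ Real.log Q := by
  have h1 : (3 : ℝ) ≤ Q := by exact_mod_cast hQ
  rw [Real.le_log_iff_exp_le (by linarith)]
  linarith [Real.exp_one_lt_d9]

lemma natLog_two_le_two_mul_log {Q : ℕ} (hQ : 0 < Q) : (Nat.log 2 Q : ℝ) ≤ 2 * Real.log Q := by
  have h1 : ((2 : ℝ) ^ Nat.log 2 Q) ≤ Q := by exact_mod_cast Nat.pow_log_le_self 2 hQ.ne'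
  have h2 := Real.log_le_log (by positivity) h1
  rw [Real.log_pow] at h2
  have := Real.log_two_gt_d9
  have h3 : (0 : ℝ) ≤ Nat.log 2 Q := Nat.cast_nonneg _
  nlinarith

/-- Differences of consecutive dyadic models have small interpolated norms. -/
lemma dyadic_difference_bounds {κ K : ℝ} {X j : ℕ} (hκ0 : 0 ≤ κ) (hκ : κ ≤ K) (hK : 1 ≤ K)
    (h : ∀ θ : ℝ, ‖∑ n ∈ Ico X (2 * X),
        ((sieveModel (2 ^ (j + 1)) n - sieveModel (2 ^ j) n : ℝ) : ℂ) * eC (θ * n)‖ ≤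
          K * X * (j + 1 : ℝ) ^ 24 / 2 ^ j) :
    fourierSup (Ico X (2 * X)) (fun n => κ * (sieveModel (2 ^ (j + 1)) n - sieveModel (2 ^ j) n)) ≤
      K ^ 2 * (81 ^ 2 * 256) * (j + 1 : ℝ) ^ 24 * (X / 2 ^ j) ∧
    supOn (Ico X (2 * X)) (fun n => κ * (sieveModel (2 ^ (j + 1)) n - sieveModel (2 ^ j) n)) ≤
      K ^ 2 * (81 ^ 2 * 256) * (j + 1 : ℝ) ^ 24 := by
  constructor
  · refine fourierSup_le fun θ => ?_
    have h1 : ∑ n ∈ Ico X (2 * X), ((κ * (sieveModel (2 ^ (j + 1)) n - sieveModel (2 ^ j) n) : ℝ) :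
        ℂ) * eC (θ * n) = (κ : ℂ) * ∑ n ∈ Ico X (2 * X),
        ((sieveModel (2 ^ (j + 1)) n - sieveModel (2 ^ j) n : ℝ) : ℂ) * eC (θ * n) := by
      rw [mul_sum]
      refine sum_congr rfl fun n _ => ?_
      push_cast
      ring
    rw [h1, norm_mul, Complex.norm_real, Real.norm_of_nonneg hκ0]
    calc _ ≤ K * (K * X * (j + 1 : ℝ) ^ 24 / 2 ^ j) := by
          gcongr
          exact h θ
      _ = K ^ 2 * 1 * (j + 1 : ℝ) ^ 24 * (X / 2 ^ j) := by ring
      _ ≤ _ := by gcongr; norm_num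
  · refine supOn_le (by positivity) fun n => ?_
    have h1 := sieveModel_nonneg (2 ^ (j + 1)) n
    have h2 := sieveModel_nonneg (2 ^ j) n
    have h3 := sieveModel_two_pow_le (j + 1) n
    have h4 := sieveModel_two_pow_le j n
    have h5 : 81 ^ 2 * (((j + 1 : ℕ) : ℝ) + 1) ^ 8 ≤ 81 ^ 2 * 256 * (j + 1 : ℝ) ^ 8 := by
      calc 81 ^ 2 * (((j + 1 : ℕ) : ℝ) + 1) ^ 8 ≤ 81 ^ 2 * (2 * (j + 1 : ℝ)) ^ 8 := by
            push_cast; gcongr; linarith [Nat.cast_nonneg (α := ℝ) j]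
        _ = _ := by ring
    have h6 : 81 ^ 2 * ((j : ℝ) + 1) ^ 8 ≤ 81 ^ 2 * 256 * (j + 1 : ℝ) ^ 8 := by
      gcongr; norm_num
    have h7 : |sieveModel (2 ^ (j + 1)) n - sieveModel (2 ^ j) n| ≤
        81 ^ 2 * 256 * (j + 1 : ℝ) ^ 8 := by
      rw [abs_le]; constructor <;> linarith
    rw [abs_mul, abs_of_nonneg hκ0]
    have h8 : (j + 1 : ℝ) ^ 8 ≤ (j + 1 : ℝ) ^ 24 :=
      pow_le_pow_right₀ (by linarith [Nat.cast_nonneg (α := ℝ) j]) (by norm_num)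
    calc _ ≤ K * (81 ^ 2 * 256 * (j + 1 : ℝ) ^ 24) := by
          gcongr
          linarith
      _ = K * 1 * (81 ^ 2 * 256) * (j + 1 : ℝ) ^ 24 := by ring
      _ ≤ K * K * (81 ^ 2 * 256) * (j + 1 : ℝ) ^ 24 := by gcongr
      _ = _ := by ring

/-- Lemma 4.1 of the paper: Fourier decomposition of a majorant for
the primes. -/
theorem majorant_fourier_decomposition (c : ℝ) (hc : c ∈ Set.Ioo (0 : ℝ) 1) :
    ∃ (c₁ C Cc : ℝ) (X₀ : ℕ), 0 < c₁ ∧ 1 ≤ C ∧ 1 ≤ Cc ∧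
      ∀ X : ℕ, X₀ ≤ X →
        ∃ Lam : ℕ → ℝ,
          (∀ x ∈ Finset.Ico X (2 * X), 0 ≤ Lam x) ∧
          (∀ p ∈ Finset.Ico X (2 * X), Nat.Prime p → c₁ * Real.log X ≤ Lam p) ∧
          avgR (Finset.Ico X (2 * X)) Lam ≤ C ∧
          ∀ Q : ℕ, 0 < Q → (Q : ℝ) ≤ Real.log X →
            ∃ (Lper : ℤ → ℝ) (m : ℕ) (g : Fin m → ℕ → ℝ) (h : ℕ → ℝ),
              (∀ x : ℤ, Lper (x + (Nat.factorial Q : ℤ)) = Lper x) ∧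
              avgR (Finset.Ico X (2 * X)) (fun x => |Lper (x : ℤ)|) ≤
                C * (Real.log Q) ^ C ∧
              (∀ x : ℤ, |Lper x| ≤ C * (Q : ℝ) ^ 2) ∧
              (∀ x ∈ Finset.Ico X (2 * X),
                Lam x - Lper (x : ℤ) = (∑ i, g i x) + h x) ∧
              avgR (Finset.Ico X (2 * X)) (fun x => |h x|) ≤ C / Q ∧
              (∑ i, supOn (Finset.Ico X (2 * X)) (g i)) ≤
                Cc * (Real.log X) ^ Cc ∧
              (∑ i, (fourierSup (Finset.Ico X (2 * X)) (g i)) ^ c *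
                    (supOn (Finset.Ico X (2 * X)) (g i)) ^ (1 - c)) ≤
                Cc * (X : ℝ) ^ c * (Q : ℝ) ^ (-(c / 4)) := by
  obtain ⟨hc0, hc1⟩ := hc
  obtain ⟨K, a, b, hK, ha, hab, r₀, hr₀, H⟩ := exists_truncation hc0
  obtain ⟨S, hS0, hS⟩ := exists_dyadic_tail_bound hc0
  obtain ⟨M, hM⟩ : ∃ M : ℝ, M = K ^ 2 * (81 ^ 2 * 256) := ⟨_, rfl⟩
  have hM0 : 0 < M := by rw [hM]; positivity
  obtain ⟨C, hC⟩ : ∃ C : ℝ, C = K * (81 ^ 2 * 256) := ⟨_, rfl⟩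
  obtain ⟨Cc, hCc⟩ : ∃ Cc : ℝ, Cc = M + 64 * K + M * S + 25 + b := ⟨_, rfl⟩
  have hK0 : 0 < K := by linarith
  have hC0 : 0 ≤ C := by rw [hC]; positivity
  have hMS : 0 ≤ M * S := mul_nonneg hM0.le hS0
  have hb0 : (0 : ℝ) ≤ b := Nat.cast_nonneg b
  refine ⟨1, C, Cc, 2 ^ (32 * r₀), one_pos, by rw [hC]; linarith, by rw [hCc]; linarith,
    fun X hX₀ => ?_⟩
  have hX0 : 0 < X := lt_of_lt_of_le (by positivity) hX₀
  have hr : r₀ ≤ Nat.log 2 X / 32 := by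
    rw [Nat.le_div_iff_mul_le (by norm_num), mul_comm]
    exact Nat.le_log_of_pow_le one_lt_two hX₀
  generalize hrdef : Nat.log 2 X / 32 = r at hr
  have hX : 2 ^ (32 * r) ≤ X :=
    (Nat.pow_le_pow_right two_pos (by omega)).trans (Nat.pow_log_le_self 2 hX0.ne')
  have hX' : X < 2 ^ (32 * (r + 1)) :=
    (Nat.lt_pow_succ_log_self one_lt_two X).trans_le (Nat.pow_le_pow_right two_pos (by omega))
  obtain ⟨Lam, g, h, κ, J, hL0, hLp, hLs, hκ0, hκ, hrJ, hJr, hF, hf, hg, hgF, hh⟩ := H r hr X hX hX'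
  have hr1 : 1 ≤ r := hr₀.trans hr
  have hlog := le_log_and_log_le hr1 hX hX'
  clear hX hX' hX₀ H
  have hrR : (1 : ℝ) ≤ r := by exact_mod_cast hr1
  refine ⟨Lam, fun x _ => hL0 x, fun p hp hpp => ?_, avgR_Ico_le hX0 (hLs.trans ?_),
    fun Q hQ hQX => ?_⟩
  · rw [one_mul, hLp p hpp (mem_Ico.1 hp).1]
  · have : K ≤ C := by rw [hC]; linarith
    gcongr
  have hQr := hQX.trans hlog.2
  have hQ1 : (1 : ℝ) ≤ Q := by exact_mod_cast hQ
  have hlog1 : 1 ≤ Real.log X := hrR.trans hlog.1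
  rcases Nat.lt_or_ge Q 3 with hQ3 | hQ3
  · have hQ2 : (Q : ℝ) ≤ 2 := by exact_mod_cast (by omega : Q ≤ 2)
    have hCc0 : 0 ≤ Cc := by rw [hCc]; positivity
    refine ⟨0, 0, 0, Lam, fun x => rfl, ?_, fun x => ?_, fun x _ => by simp,
      avgR_Ico_le hX0 ?_, ?_, ?_⟩
    · simp only [avgR, Pi.zero_apply, abs_zero, sum_const_zero, zero_div]
      exact mul_nonneg hC0 (Real.rpow_nonneg (Real.log_nonneg hQ1) _)
    · simp only [Pi.zero_apply, abs_zero]; positivity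
    · simp only [abs_of_nonneg (hL0 _)]
      refine hLs.trans ?_
      have : K ≤ C / Q := by
        rw [le_div_iff₀ (by linarith), hC]
        nlinarith
      gcongr
    · rw [Fin.sum_univ_zero]; positivity
    · rw [Fin.sum_univ_zero]; positivity
  obtain ⟨j₀, hj₀⟩ : ∃ j₀, j₀ = Nat.log 2 Q := ⟨_, rfl⟩
  have hjQ : 2 ^ j₀ ≤ Q := by rw [hj₀]; exact Nat.pow_log_le_self 2 hQ.ne'
  have hjQ' : Q ≤ 2 ^ (j₀ + 1) := by rw [hj₀]; exact (Nat.lt_pow_succ_log_self one_lt_two Q).le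
  have hjlog : (j₀ : ℝ) ≤ 2 * Real.log Q := by rw [hj₀]; exact natLog_two_le_two_mul_log hQ
  have hlogQ := one_le_log_natCast hQ3
  have hj1 : 1 ≤ j₀ := by rw [hj₀]; exact Nat.log_pos one_lt_two (by omega)
  have hjJ : j₀ ≤ J := by
    have h1 : Q ≤ 64 * r := by exact_mod_cast hQr
    exact (Nat.pow_le_pow_iff_right one_lt_two).1 (hjQ.trans (h1.trans hrJ))
  obtain ⟨F, hFper, hF0, hFle, hFeq⟩ := exists_periodic_extension hjQ
  have hFabs : ∀ x, |κ * F x| = κ * F x := fun x => abs_of_nonneg (mul_nonneg hκ0 (hF0 x))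
  obtain ⟨G, hG⟩ : ∃ G : ℕ → ℕ → ℝ, G = fun j n =>
    κ * (sieveModel (2 ^ (j + 1)) n - sieveModel (2 ^ j) n) := ⟨_, rfl⟩
  have hGF : ∀ j < J, fourierSup (Ico X (2 * X)) (G j) ≤ M * (j + 1 : ℝ) ^ 24 * (X / 2 ^ j) ∧
      supOn (Ico X (2 * X)) (G j) ≤ M * (j + 1 : ℝ) ^ 24 := fun j hj => by
    rw [hG, hM]
    exact dyadic_difference_bounds hκ0 hκ hK (hF j hj)
  have hgsup : supOn (Ico X (2 * X)) g ≤ K * (r : ℝ) ^ b := supOn_le (by positivity) hg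
  refine ⟨fun x => κ * F x, J - j₀ + 1, Fin.cons g fun i : Fin (J - j₀) => G (j₀ + i), h,
    fun x => by simp only [hFper], avgR_Ico_le hX0 ?_, fun x => ?_, fun x _ => ?_,
    avgR_Ico_le hX0 (hh.trans ?_), ?_, ?_⟩
  · simp only [hFabs]
    have h1 : ∀ n ∈ Ico X (2 * X), κ * F n ≤ C * Real.log Q ^ C := fun n _ => by
      have h2 := (hFle n).trans (inv_primeDensity_two_pow_le hj1)
      calc κ * F n ≤ K * (81 ^ 2 * (j₀ : ℝ) ^ 8) := by
            have := hF0 n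
            gcongr
        _ ≤ K * (81 ^ 2 * (2 * Real.log Q) ^ 8) := by gcongr
        _ = C * Real.log Q ^ (8 : ℝ) := by rw [hC]; norm_cast; ring
        _ ≤ C * Real.log Q ^ C := by
            refine mul_le_mul_of_nonneg_left ?_ hC0
            exact Real.rpow_le_rpow_of_exponent_le hlogQ (by rw [hC]; linarith)
    refine (sum_le_sum h1).trans_eq ?_
    rw [sum_const, nsmul_eq_mul, Nat.card_Ico, mul_comm]
    congr 2
    omega
  · rw [hFabs]
    have h1 := (hFle x).trans (inv_primeDensity_le Nat.one_le_two_pow)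
    have h2 : ((2 ^ j₀ : ℕ) : ℝ) ≤ Q := by exact_mod_cast hjQ
    have h3 := hF0 x
    calc κ * F x ≤ C * Q := by
          have : κ ≤ C := hκ.trans (by rw [hC]; linarith)
          have := h1.trans h2
          gcongr
      _ ≤ C * (Q : ℝ) ^ 2 := by
          gcongr
          exact le_self_pow₀ hQ1 two_ne_zero
  · simp only [Fin.sum_univ_succ, Fin.cons_zero, Fin.cons_succ]
    rw [Fin.sum_univ_eq_sum_range (fun i => G (j₀ + i) x) (J - j₀), hG]
    dsimp only
    have h1 := sum_range_sub (fun i => sieveModel (2 ^ (j₀ + i)) x) (J - j₀)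
    simp only [← add_assoc, Nat.add_sub_cancel' hjJ, add_zero] at h1
    rw [← mul_sum, h1, hFeq]
    linarith [hf x]
  · have h1 := inv_pow_le_div ha hr1 hQ hQr
    calc K * X / (r : ℝ) ^ a = K * X * (1 / (r : ℝ) ^ a) := by ring
      _ ≤ K * X * (64 / Q) := by gcongr
      _ = K * 64 / Q * X := by ring
      _ ≤ C / Q * X := by
          have : K * 64 ≤ C := by rw [hC]; linarith
          gcongr
  · simp only [Fin.sum_univ_succ, Fin.cons_zero, Fin.cons_succ]
    rw [Fin.sum_univ_eq_sum_range (fun i => supOn (Ico X (2 * X)) (G (j₀ + i))) (J - j₀)]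
    have h1 : ∑ i ∈ range (J - j₀), supOn (Ico X (2 * X)) (G (j₀ + i)) ≤
        r * (M * (r : ℝ) ^ 24) := by
      have h2 : ∀ i ∈ range (J - j₀), supOn (Ico X (2 * X)) (G (j₀ + i)) ≤ M * (r : ℝ) ^ 24 := by
        intro i hi
        have hi' := mem_range.1 hi
        refine (hGF (j₀ + i) (by omega)).2.trans ?_
        have h3 : ((j₀ + i : ℕ) + 1 : ℝ) ≤ r := by
          exact_mod_cast (by omega : j₀ + i + 1 ≤ r)
        gcongr
      refine (sum_le_sum h2).trans ?_
      rw [sum_const, nsmul_eq_mul, card_range]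
      have : ((J - j₀ : ℕ) : ℝ) ≤ r := by exact_mod_cast (by omega : J - j₀ ≤ r)
      gcongr
    have h4 : (r : ℝ) ^ b ≤ (r : ℝ) ^ (25 + b) := pow_le_pow_right₀ hrR (by omega)
    have h5 : (r : ℝ) ^ 25 ≤ (r : ℝ) ^ (25 + b) := pow_le_pow_right₀ hrR (by omega)
    calc _ ≤ K * (r : ℝ) ^ b + r * (M * (r : ℝ) ^ 24) := add_le_add hgsup h1
      _ = K * (r : ℝ) ^ b + M * (r : ℝ) ^ 25 := by ring
      _ ≤ K * (r : ℝ) ^ (25 + b) + M * (r : ℝ) ^ (25 + b) := by gcongr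
      _ = (K + M) * (r : ℝ) ^ ((25 + b : ℕ) : ℝ) := by rw [Real.rpow_natCast]; ring
      _ ≤ Cc * Real.log X ^ ((25 + b : ℕ) : ℝ) := by
          have h6 : K + M ≤ Cc := by rw [hCc]; linarith
          have h7 := hlog.1
          have h8 : 0 ≤ Cc := by rw [hCc]; positivity
          gcongr
      _ ≤ Cc * Real.log X ^ Cc := by
          have h8 : 0 ≤ Cc := by rw [hCc]; positivity
          refine mul_le_mul_of_nonneg_left ?_ h8
          refine Real.rpow_le_rpow_of_exponent_le hlog1 ?_
          rw [hCc]; push_cast; linarith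
  · simp only [Fin.sum_univ_succ, Fin.cons_zero, Fin.cons_succ]
    rw [Fin.sum_univ_eq_sum_range (fun i => fourierSup (Ico X (2 * X)) (G (j₀ + i)) ^ c *
      supOn (Ico X (2 * X)) (G (j₀ + i)) ^ (1 - c)) (J - j₀)]
    have h1 : fourierSup (Ico X (2 * X)) g ^ c * supOn (Ico X (2 * X)) g ^ (1 - c) ≤
        64 * K * ((X : ℝ) ^ c * (Q : ℝ) ^ (-(c / 4))) := by
      refine (rpow_mul_rpow_le (M := K * (r : ℝ) ^ b) (t := X / (r : ℝ) ^ (a + b)) hc0.le hc1.le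
        (fourierSup_nonneg _ _) (supOn_nonneg _ _) (by positivity) (by positivity)
        (fourierSup_le fun θ => (hgF θ).trans_eq ?_) hgsup).trans ?_
      · rw [pow_add]; field_simp
      · have h2 := mul_le_mul_of_nonneg_left (pow_mul_rpow_le hc0 hc1 (X := X) hr1 hQ hQr hab)
          hK0.le
        linarith
    have h3 : ∑ i ∈ range (J - j₀), fourierSup (Ico X (2 * X)) (G (j₀ + i)) ^ c *
        supOn (Ico X (2 * X)) (G (j₀ + i)) ^ (1 - c) ≤
        M * S * ((X : ℝ) ^ c * (Q : ℝ) ^ (-(c / 4))) := by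
      have h4 : ∀ i ∈ range (J - j₀), fourierSup (Ico X (2 * X)) (G (j₀ + i)) ^ c *
          supOn (Ico X (2 * X)) (G (j₀ + i)) ^ (1 - c) ≤ M * (X : ℝ) ^ c *
          (((j₀ + i : ℕ) + 1 : ℝ) ^ 24 * ((2 : ℝ) ^ (j₀ + i)) ^ (-c)) := by
        intro i hi
        have hi' := mem_range.1 hi
        have h5 := hGF (j₀ + i) (by omega)
        refine (rpow_mul_rpow_le hc0.le hc1.le (fourierSup_nonneg _ _) (supOn_nonneg _ _)
          (by positivity) (by positivity) h5.1 h5.2).trans_eq ?_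
        rw [Real.div_rpow (Nat.cast_nonneg _) (by positivity), Real.rpow_neg (by positivity)]
        ring
      refine (sum_le_sum h4).trans ?_
      rw [← mul_sum]
      have h6 := mul_le_mul_of_nonneg_left (hS Q j₀ (J - j₀) hQ hjQ')
        (by positivity : 0 ≤ M * (X : ℝ) ^ c)
      linarith
    calc _ ≤ _ := add_le_add h1 h3
      _ = (64 * K + M * S) * ((X : ℝ) ^ c * (Q : ℝ) ^ (-(c / 4))) := by ring
      _ ≤ Cc * ((X : ℝ) ^ c * (Q : ℝ) ^ (-(c / 4))) := by
          have h6 : 64 * K + M * S ≤ Cc := by rw [hCc]; linarith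
          gcongr
      _ = _ := by ring
end
end

section
/- There is an absolute constant δ₀ > 0 such that the following holds. Let δ ∈ (0, δ₀], let k ∈ ℕ, and let I₁,…,I_k be disjoint intervals of integers, each with min I_ℓ ≥ 3, satisfying log log(max I_ℓ) − log log(min I_ℓ) ≥ k·δ^{−4.1} for every ℓ ∈ [k]. Let 𝒫' := {p₁⋯p_k : p_ℓ a prime in I_ℓ for each ℓ ∈ [k]}. Then γ(𝒫') ≤ δ^{4.05}, where γ(𝒩) := 𝔼^log_{n,n'∈𝒩} gcd(n,n') − 1. -/
noncomputable section

open Finset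
open scoped Classical

/-- Logarithmic average of a real-valued function over a finite set of naturals. -/
def logAvgR (s : Finset ℕ) (f : ℕ → ℝ) : ℝ :=
  (∑ n ∈ s, f n / (n : ℝ)) / (∑ n ∈ s, (1 : ℝ) / (n : ℝ))

/-- `γ(𝒩) := 𝔼^log_{n, n' ∈ 𝒩} gcd(n, n') − 1`. -/
def gam (s : Finset ℕ) : ℝ :=
  logAvgR s (fun n => logAvgR s (fun n' => (Nat.gcd n n' : ℝ))) - 1

/-- The set of products `p₁ ⋯ p_k` with `p_ℓ` prime in the interval `[a ℓ, b ℓ]`. -/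
def almostPrimes {k : ℕ} (a b : Fin k → ℕ) : Finset ℕ :=
  (Fintype.piFinset (fun ℓ => (Finset.Icc (a ℓ) (b ℓ)).filter Nat.Prime)).image
    (fun g => ∏ ℓ, g ℓ)

/-- Chebyshev's bounds for `θ` yield a proportion of primes in every interval `(n, M * n]`. -/
theorem exists_le_theta_mul_sub_theta :
    ∃ M : ℕ, 2 ≤ M ∧ ∀ n : ℕ, 1 ≤ n →
      (n : ℝ) ≤ Chebyshev.theta ((M * n : ℕ) : ℝ) - Chebyshev.theta (n : ℝ) := by
  have hlog : (fun x : ℝ => Real.log (x + 1)) =o[Filter.atTop] (fun x : ℝ => x) := by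
    have h1 : (fun x : ℝ => Real.log (x + 1)) =o[Filter.atTop] (fun x : ℝ => x + 1) :=
      Real.isLittleO_log_id_atTop.comp_tendsto
        (Filter.tendsto_atTop_add_const_right _ 1 Filter.tendsto_id)
    refine h1.trans_isBigO ?_
    refine Asymptotics.IsBigO.of_bound 2 ?_
    filter_upwards [Filter.eventually_ge_atTop (1 : ℝ)] with x hx
    rw [Real.norm_of_nonneg (by linarith), Real.norm_of_nonneg (by linarith)]
    linarith
  have hsqrt : (fun x : ℝ => Real.sqrt x * Real.log x) =o[Filter.atTop] (fun x : ℝ => x) := by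
    have h1 : (fun x : ℝ => Real.log x) =o[Filter.atTop] (fun x : ℝ => Real.sqrt x) := by
      simpa only [Real.sqrt_eq_rpow] using
        isLittleO_log_rpow_atTop (show (0 : ℝ) < 1 / 2 by norm_num)
    refine ((Asymptotics.isBigO_refl (fun x : ℝ => Real.sqrt x) Filter.atTop).mul_isLittleO
      h1).congr' Filter.EventuallyEq.rfl ?_
    filter_upwards [Filter.eventually_ge_atTop (0 : ℝ)] with x hx
    exact Real.mul_self_sqrt hx
  obtain ⟨X, hX⟩ := Filter.eventually_atTop.1
    ((hlog.bound (show (0 : ℝ) < 1 / 16 by norm_num)).and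
      (hsqrt.bound (show (0 : ℝ) < 1 / 16 by norm_num)))
  refine ⟨max 16 ⌈X⌉₊, by simp, fun n hn => ?_⟩
  set M := max 16 ⌈X⌉₊
  have hn' : (1 : ℝ) ≤ n := by exact_mod_cast hn
  have hM : (16 : ℝ) ≤ M := by exact_mod_cast le_max_left 16 ⌈X⌉₊
  have hMX : X ≤ M := (Nat.le_ceil X).trans (by exact_mod_cast le_max_right 16 ⌈X⌉₊)
  have hMn : (M : ℝ) ≤ ((M * n : ℕ) : ℝ) := by
    push_cast
    nlinarith
  have hMn16 : 16 * (n : ℝ) ≤ ((M * n : ℕ) : ℝ) := by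
    push_cast
    nlinarith
  obtain ⟨h1, h2⟩ := hX _ (hMX.trans hMn)
  have hlower := Chebyshev.theta_ge (M * n)
  have hupper := Chebyshev.theta_le_log4_mul_x (x := (n : ℝ)) (by linarith)
  have h4 : Real.log 4 = 2 * Real.log 2 := by
    rw [show (4 : ℝ) = 2 ^ 2 by norm_num, Real.log_pow]
    norm_num
  rw [h4] at hupper
  have hl2 := Real.log_two_gt_d9
  have hl2' := Real.log_two_lt_d9
  generalize ((M * n : ℕ) : ℝ) = y at *
  rw [Real.norm_of_nonneg (show 0 ≤ y by linarith)] at h1 h2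
  have h1' := (le_abs_self _).trans h1
  have h2' := (le_abs_self _).trans h2
  nlinarith

/-- A weak form of Mertens' second theorem. -/
theorem exists_mul_loglog_sub_le_sum_Ioc_primes_inv :
    ∃ c : ℝ, 0 < c ∧ ∃ C : ℝ, ∀ a b : ℕ, 3 ≤ a → a ≤ b →
      c * (Real.log (Real.log b) - Real.log (Real.log a) - C) ≤
        ∑ p ∈ (Finset.Ioc a b).filter Nat.Prime, (1 : ℝ) / p := by
  obtain ⟨M, hM, hθ⟩ := exists_le_theta_mul_sub_theta
  have hM' : (2 : ℝ) ≤ M := by exact_mod_cast hM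
  set m := Real.log M with hm
  have hm0 : 0 < m := Real.log_pos (by linarith)
  have hlog_ge : ∀ a : ℕ, 3 ≤ a → 1 ≤ Real.log a := by
    intro a ha
    have ha' : (3 : ℝ) ≤ a := by exact_mod_cast ha
    rw [Real.le_log_iff_exp_le (by linarith)]
    linarith [Real.exp_one_lt_d9]
  have hlog_mul : ∀ a : ℕ, 3 ≤ a → Real.log ((M * a : ℕ) : ℝ) = m + Real.log a := by
    intro a ha
    push_cast
    rw [Real.log_mul (by positivity) (by positivity)]
  have hloglog : ∀ a : ℕ, 3 ≤ a →
      Real.log (Real.log ((M * a : ℕ) : ℝ)) - Real.log (Real.log a) ≤ m / Real.log a := by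
    intro a ha
    have h1 := hlog_ge a ha
    rw [hlog_mul a ha, ← Real.log_div (by positivity) (by positivity)]
    refine (Real.log_le_sub_one_of_pos (by positivity)).trans (le_of_eq ?_)
    field_simp
    ring
  refine ⟨1 / (M * m * (1 + m)), by positivity, m, fun a b ha hab => ?_⟩
  induction hd : b - a using Nat.strong_induction_on generalizing a with
  | _ d ih =>
  have h1 := hlog_ge a ha
  rcases lt_or_ge b (M * a) with hb | hb
  · have hb3 := hlog_ge b (ha.trans hab)
    have hlog_b : Real.log b ≤ Real.log ((M * a : ℕ) : ℝ) :=
      Real.log_le_log (by exact_mod_cast (by lia : 0 < b)) (by exact_mod_cast hb.le)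
    have h2 := Real.log_le_log (by linarith) hlog_b
    have h3 := hloglog a ha
    have h4 : m / Real.log a ≤ m := div_le_self hm0.le h1
    refine le_trans ?_ (Finset.sum_nonneg fun p _ => by positivity)
    exact mul_nonpos_of_nonneg_of_nonpos (by positivity) (by linarith)
  · have haM : a < M * a := by nlinarith
    have key := ih (b - M * a) (by lia) (M * a) (by lia) hb rfl
    have hsplit : ∑ p ∈ (Finset.Ioc a b).filter Nat.Prime, (1 : ℝ) / p =
        ∑ p ∈ (Finset.Ioc a (M * a)).filter Nat.Prime, (1 : ℝ) / p +
        ∑ p ∈ (Finset.Ioc (M * a) b).filter Nat.Prime, (1 : ℝ) / p := by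
      simp only [Finset.sum_filter]
      exact (Finset.sum_Ioc_consecutive _ haM.le hb).symm
    have hlogMa := hlog_mul a ha
    have ha0 : (0 : ℝ) < a := by exact_mod_cast (by lia : 0 < a)
    have hblock : 1 / (M * (m + Real.log a)) ≤
        ∑ p ∈ (Finset.Ioc a (M * a)).filter Nat.Prime, (1 : ℝ) / p := by
      have hdiff : Chebyshev.theta ((M * a : ℕ) : ℝ) - Chebyshev.theta (a : ℝ) =
          ∑ p ∈ (Finset.Ioc a (M * a)).filter Nat.Prime, Real.log p := by
        simp only [Chebyshev.theta, Nat.floor_natCast, Finset.sum_filter]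
        rw [← Finset.sum_Ioc_consecutive _ (Nat.zero_le a) haM.le]
        ring
      have h5 : ∑ p ∈ (Finset.Ioc a (M * a)).filter Nat.Prime, Real.log p ≤
          ∑ p ∈ (Finset.Ioc a (M * a)).filter Nat.Prime,
            (M * a * (m + Real.log a)) * ((1 : ℝ) / p) := by
        refine Finset.sum_le_sum fun p hp => ?_
        rw [Finset.mem_filter, Finset.mem_Ioc] at hp
        have hp0 : (0 : ℝ) < p := by exact_mod_cast hp.2.pos
        have hpM : (p : ℝ) ≤ ((M * a : ℕ) : ℝ) := by exact_mod_cast hp.1.2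
        have hl := Real.log_le_log hp0 hpM
        rw [hlogMa] at hl
        push_cast at hpM
        rw [mul_one_div, le_div_iff₀ hp0, mul_comm]
        exact mul_le_mul hpM hl (Real.log_natCast_nonneg p) (by positivity)
      rw [← Finset.mul_sum, ← hdiff] at h5
      have h6 := (hθ a (by lia)).trans h5
      rw [div_le_iff₀ (by positivity)]
      refine le_of_mul_le_mul_left ?_ ha0
      linarith
    have hstep : 1 / (M * m * (1 + m)) *
        (Real.log (Real.log ((M * a : ℕ) : ℝ)) - Real.log (Real.log a)) ≤
          1 / (M * (m + Real.log a)) := by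
      refine (mul_le_mul_of_nonneg_left (hloglog a ha) (by positivity)).trans ?_
      rw [div_mul_div_comm, div_le_div_iff₀ (by positivity) (by positivity)]
      have h7 : m + Real.log a ≤ (1 + m) * Real.log a := by nlinarith
      have h8 := mul_le_mul_of_nonneg_left h7 (show 0 ≤ M * m by positivity)
      linarith
    rw [hsplit]
    calc _ = 1 / (M * m * (1 + m)) *
          (Real.log (Real.log ((M * a : ℕ) : ℝ)) - Real.log (Real.log a)) +
          1 / (M * m * (1 + m)) *
          (Real.log (Real.log b) - Real.log (Real.log ((M * a : ℕ) : ℝ)) - m) := by ring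
      _ ≤ _ := by linarith

/-- The greatest common divisor is multiplicative over families that are coprime off the
diagonal. -/
theorem gcd_prod_prod_eq_prod_gcd {ι : Type*} (s : Finset ι) (g h : ι → ℕ)
    (hgh : ∀ i ∈ s, ∀ j ∈ s, i ≠ j → (g i).Coprime (h j))
    (hh : ∀ i ∈ s, ∀ j ∈ s, i ≠ j → (h i).Coprime (h j)) :
    (∏ i ∈ s, g i).gcd (∏ i ∈ s, h i) = ∏ i ∈ s, (g i).gcd (h i) := by
  induction s using Finset.induction_on with
  | empty => simp
  | insert x s hx ih =>
    have hne : ∀ i ∈ s, x ≠ i := fun i hi hxi => hx (hxi ▸ hi)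
    rw [Finset.prod_insert hx, Finset.prod_insert hx, Finset.prod_insert hx,
      ← ih (fun i hi j hj => hgh i (Finset.mem_insert_of_mem hi) j (Finset.mem_insert_of_mem hj))
        (fun i hi j hj => hh i (Finset.mem_insert_of_mem hi) j (Finset.mem_insert_of_mem hj))]
    have h1 : (h x).Coprime (∏ i ∈ s, h i) := Nat.Coprime.prod_right fun i hi =>
      hh x (Finset.mem_insert_self _ _) i (Finset.mem_insert_of_mem hi) (hne i hi)
    have h2 : (g x).Coprime (∏ i ∈ s, h i) := Nat.Coprime.prod_right fun i hi =>
      hgh x (Finset.mem_insert_self _ _) i (Finset.mem_insert_of_mem hi) (hne i hi)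
    have h3 : (∏ i ∈ s, g i).Coprime (h x) := Nat.Coprime.prod_left fun i hi =>
      hgh i (Finset.mem_insert_of_mem hi) x (Finset.mem_insert_self _ _) (hne i hi).symm
    rw [h1.gcd_mul, h3.gcd_mul_right_cancel, h2.gcd_mul_left_cancel]

/-- The sum of `gcd(p, q) / (p q)` over a finite set of primes. -/
theorem sum_gcd_div_div_le {P : Finset ℕ} (hP : ∀ p ∈ P, p.Prime) :
    ∑ p ∈ P, ∑ q ∈ P, (p.gcd q : ℝ) / ((p : ℝ) * q) ≤
      (∑ p ∈ P, (1 : ℝ) / p) ^ 2 + ∑ p ∈ P, (1 : ℝ) / p := by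
  have hterm : ∀ p ∈ P, ∀ q ∈ P, (p.gcd q : ℝ) / ((p : ℝ) * q) ≤
      (1 : ℝ) / p * (1 / q) + if p = q then (1 : ℝ) / p else 0 := by
    intro p hp q hq
    have hp0 : (0 : ℝ) < p := by exact_mod_cast (hP p hp).pos
    have hq0 : (0 : ℝ) < q := by exact_mod_cast (hP q hq).pos
    split_ifs with hpq
    · subst hpq
      rw [Nat.gcd_self, div_mul_cancel_left₀ hp0.ne', inv_eq_one_div]
      linarith [show 0 ≤ (1 : ℝ) / p * (1 / p) by positivity]
    · rw [((Nat.coprime_primes (hP p hp) (hP q hq)).2 hpq).gcd_eq_one, div_mul_div_comm]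
      simp
  calc _ ≤ ∑ p ∈ P, ∑ q ∈ P, ((1 : ℝ) / p * (1 / q) + if p = q then (1 : ℝ) / p else 0) :=
        Finset.sum_le_sum fun p hp => Finset.sum_le_sum fun q hq => hterm p hp q hq
    _ = _ := by
      simp only [Finset.sum_add_distrib]
      congr 1
      · rw [sq, Finset.sum_mul_sum]
      · exact Finset.sum_congr rfl fun p hp => by rw [Finset.sum_ite_eq, if_pos hp]

/-- `γ(𝒩)` as a quotient of a double sum by the square of the logarithmic mass. -/
theorem gam_eq (s : Finset ℕ) :
    gam s = (∑ n ∈ s, ∑ n' ∈ s, (n.gcd n' : ℝ) / ((n : ℝ) * n')) /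
      (∑ n ∈ s, (1 : ℝ) / n) ^ 2 - 1 := by
  unfold gam logAvgR
  rw [sq, ← div_div]
  congr 2
  rw [Finset.sum_div]
  refine Finset.sum_congr rfl fun n _ => ?_
  rw [div_right_comm, Finset.sum_div]
  congr 1
  refine Finset.sum_congr rfl fun n' _ => ?_
  rw [div_div, mul_comm]

section AlmostPrimes

variable {k : ℕ} {a b : Fin k → ℕ}

/-- The primes in the interval `[a ℓ, b ℓ]`. -/
def blockPrimes (a b : Fin k → ℕ) (ℓ : Fin k) : Finset ℕ :=
  (Finset.Icc (a ℓ) (b ℓ)).filter Nat.Prime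

theorem prime_of_mem_blockPrimes {ℓ : Fin k} {p : ℕ} (hp : p ∈ blockPrimes a b ℓ) : p.Prime :=
  (Finset.mem_filter.1 hp).2

theorem ne_of_mem_blockPrimes
    (hdisj : ∀ ℓ ℓ', ℓ ≠ ℓ' → Disjoint (Finset.Icc (a ℓ) (b ℓ)) (Finset.Icc (a ℓ') (b ℓ')))
    {i j : Fin k} (hij : i ≠ j) {p q : ℕ} (hp : p ∈ blockPrimes a b i)
    (hq : q ∈ blockPrimes a b j) : p ≠ q := by
  rintro rfl
  exact Finset.disjoint_left.1 (hdisj i j hij) (Finset.mem_filter.1 hp).1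
    (Finset.mem_filter.1 hq).1

theorem coprime_of_mem_blockPrimes
    (hdisj : ∀ ℓ ℓ', ℓ ≠ ℓ' → Disjoint (Finset.Icc (a ℓ) (b ℓ)) (Finset.Icc (a ℓ') (b ℓ')))
    {i j : Fin k} (hij : i ≠ j) {p q : ℕ} (hp : p ∈ blockPrimes a b i)
    (hq : q ∈ blockPrimes a b j) : p.Coprime q :=
  (Nat.coprime_primes (prime_of_mem_blockPrimes hp) (prime_of_mem_blockPrimes hq)).2
    (ne_of_mem_blockPrimes hdisj hij hp hq)

theorem injOn_prod_blockPrimes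
    (hdisj : ∀ ℓ ℓ', ℓ ≠ ℓ' → Disjoint (Finset.Icc (a ℓ) (b ℓ)) (Finset.Icc (a ℓ') (b ℓ'))) :
    Set.InjOn (fun g : Fin k → ℕ => ∏ ℓ, g ℓ) (Fintype.piFinset (blockPrimes a b)) := by
  intro g hg h hh hgh
  rw [Finset.mem_coe, Fintype.mem_piFinset] at hg hh
  funext i
  have hdvd : g i ∣ ∏ ℓ, h ℓ :=
    (Finset.dvd_prod_of_mem g (Finset.mem_univ i)).trans hgh.dvd
  obtain ⟨j, -, hj⟩ :=
    ((prime_of_mem_blockPrimes (hg i)).prime.dvd_finsetProd_iff _).1 hdvd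
  have heq : g i = h j := (Nat.prime_dvd_prime_iff_eq (prime_of_mem_blockPrimes (hg i))
    (prime_of_mem_blockPrimes (hh j))).1 hj
  obtain rfl : i = j := by
    by_contra hij
    exact ne_of_mem_blockPrimes hdisj hij (hg i) (hh j) heq
  exact heq

theorem sum_almostPrimes
    (hdisj : ∀ ℓ ℓ', ℓ ≠ ℓ' → Disjoint (Finset.Icc (a ℓ) (b ℓ)) (Finset.Icc (a ℓ') (b ℓ')))
    (F : ℕ → ℝ) :
    ∑ n ∈ almostPrimes a b, F n =
      ∑ g ∈ Fintype.piFinset (blockPrimes a b), F (∏ ℓ, g ℓ) :=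
  Finset.sum_image (injOn_prod_blockPrimes hdisj)

theorem sum_one_div_almostPrimes
    (hdisj : ∀ ℓ ℓ', ℓ ≠ ℓ' → Disjoint (Finset.Icc (a ℓ) (b ℓ)) (Finset.Icc (a ℓ') (b ℓ'))) :
    ∑ n ∈ almostPrimes a b, (1 : ℝ) / n = ∏ ℓ, ∑ p ∈ blockPrimes a b ℓ, (1 : ℝ) / p := by
  rw [sum_almostPrimes hdisj, Finset.prod_univ_sum]
  refine Finset.sum_congr rfl fun g _ => ?_
  rw [Nat.cast_prod, Finset.prod_div_distrib, Finset.prod_const_one]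

theorem sum_gcd_almostPrimes
    (hdisj : ∀ ℓ ℓ', ℓ ≠ ℓ' → Disjoint (Finset.Icc (a ℓ) (b ℓ)) (Finset.Icc (a ℓ') (b ℓ'))) :
    ∑ n ∈ almostPrimes a b, ∑ n' ∈ almostPrimes a b, (n.gcd n' : ℝ) / ((n : ℝ) * n') =
      ∏ ℓ, ∑ p ∈ blockPrimes a b ℓ, ∑ q ∈ blockPrimes a b ℓ,
        (p.gcd q : ℝ) / ((p : ℝ) * q) := by
  rw [sum_almostPrimes hdisj, Finset.prod_univ_sum]
  refine Finset.sum_congr rfl fun g hg => ?_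
  rw [sum_almostPrimes hdisj, Finset.prod_univ_sum]
  refine Finset.sum_congr rfl fun h hh => ?_
  rw [Fintype.mem_piFinset] at hg hh
  rw [gcd_prod_prod_eq_prod_gcd Finset.univ g h
    (fun i _ j _ hij => coprime_of_mem_blockPrimes hdisj hij (hg i) (hh j))
    (fun i _ j _ hij => coprime_of_mem_blockPrimes hdisj hij (hh i) (hh j))]
  push_cast
  rw [Finset.prod_div_distrib, Finset.prod_mul_distrib]

/-- A lower bound for the logarithmic mass of every block bounds `γ` of the almost primes. -/
theorem gam_almostPrimes_le
    (hdisj : ∀ ℓ ℓ', ℓ ≠ ℓ' → Disjoint (Finset.Icc (a ℓ) (b ℓ)) (Finset.Icc (a ℓ') (b ℓ')))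
    {H : ℝ} (hH : 0 < H) (hmass : ∀ ℓ, H ≤ ∑ p ∈ blockPrimes a b ℓ, (1 : ℝ) / p) :
    gam (almostPrimes a b) ≤ Real.exp (k / H) - 1 := by
  rw [gam_eq, sum_one_div_almostPrimes hdisj, sum_gcd_almostPrimes hdisj,
    ← Finset.prod_pow, ← Finset.prod_div_distrib]
  gcongr
  calc _ ≤ ∏ _ℓ : Fin k, Real.exp (1 / H) := by
        refine Finset.prod_le_prod (fun ℓ _ => by positivity) fun ℓ _ => ?_
        have hS : 0 < ∑ p ∈ blockPrimes a b ℓ, (1 : ℝ) / p := hH.trans_le (hmass ℓ)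
        rw [div_le_iff₀ (by positivity)]
        refine (sum_gcd_div_div_le fun p hp => prime_of_mem_blockPrimes hp).trans ?_
        have h1 := mul_le_mul_of_nonneg_right (Real.add_one_le_exp (1 / H))
          (sq_nonneg (∑ p ∈ blockPrimes a b ℓ, (1 : ℝ) / p))
        refine le_trans ?_ h1
        have h2 : 1 ≤ 1 / H * ∑ p ∈ blockPrimes a b ℓ, (1 : ℝ) / p := by
          rw [one_div_mul_eq_div, one_le_div hH]
          exact hmass ℓ
        nlinarith
    _ = Real.exp (k / H) := by
        rw [Finset.prod_const, Finset.card_univ, Fintype.card_fin, ← Real.exp_nat_mul,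
          mul_one_div]

end AlmostPrimes

/-- Lemma 5.2 of the paper: almost pairwise coprimality of the
almost primes. -/
theorem almost_primes_coprimality :
    ∃ δ₀ : ℝ, 0 < δ₀ ∧
      ∀ (δ : ℝ) (k : ℕ) (a b : Fin k → ℕ),
        0 < δ → δ ≤ δ₀ → 1 ≤ k →
        (∀ ℓ, 3 ≤ a ℓ) → (∀ ℓ, a ℓ ≤ b ℓ) →
        (∀ ℓ ℓ', ℓ ≠ ℓ' →
          Disjoint (Finset.Icc (a ℓ) (b ℓ)) (Finset.Icc (a ℓ') (b ℓ'))) →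
        (∀ ℓ, (k : ℝ) * δ ^ (-(4.1 : ℝ)) ≤
          Real.log (Real.log (b ℓ)) - Real.log (Real.log (a ℓ))) →
        gam (almostPrimes a b) ≤ δ ^ ((4.05 : ℝ)) := by
  obtain ⟨c, hc, C, hmertens⟩ := exists_mul_loglog_sub_le_sum_Ioc_primes_inv
  have hpow : ∀ (r : ℝ), 0 < r → ∀ ε > 0, ∀ᶠ x : ℝ in nhdsWithin 0 (Set.Ioi 0), x ^ r ≤ ε := by
    intro r hr ε hε
    have h := (Real.continuousAt_rpow_const 0 r (Or.inr hr.le)).tendsto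
    rw [Real.zero_rpow hr.ne'] at h
    exact (h.mono_left nhdsWithin_le_nhds).eventually_le_const hε
  obtain ⟨δ₀, hδ₀, hsmall⟩ := (nhdsGT_basis_Ioc (0 : ℝ)).eventually_iff.1
    (((hpow 4.1 (by norm_num) (1 / (2 * (|C| + 1))) (by positivity)).and
      (hpow 4.1 (by norm_num) (c / 2) (by positivity))).and
      (hpow 0.05 (by norm_num) (c / 4) (by positivity)))
  refine ⟨δ₀, hδ₀, fun δ k a b hδ hδle hk ha hab hdisj hlen => ?_⟩
  obtain ⟨⟨h1, h2⟩, h3⟩ := hsmall ⟨hδ, hδle⟩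
  have hk' : (1 : ℝ) ≤ k := by exact_mod_cast hk
  have hδpow : 0 < δ ^ (4.1 : ℝ) := Real.rpow_pos_of_pos hδ _
  rw [Real.rpow_neg hδ.le] at hlen
  have hsplit : δ ^ (4.1 : ℝ) = δ ^ (4.05 : ℝ) * δ ^ (0.05 : ℝ) := by
    rw [← Real.rpow_add hδ]
    norm_num
  have h405 : 0 < δ ^ (4.05 : ℝ) := Real.rpow_pos_of_pos hδ _
  generalize δ ^ (4.1 : ℝ) = t at *
  have hCt : 2 * (|C| + 1) ≤ t⁻¹ := by
    rw [← one_div, le_div_comm₀ (by positivity) hδpow]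
    exact h1
  have hmass : ∀ ℓ, c / 2 * (k * t⁻¹) ≤ ∑ p ∈ blockPrimes a b ℓ, (1 : ℝ) / p := by
    intro ℓ
    refine le_trans ?_ ((hmertens (a ℓ) (b ℓ) (ha ℓ) (hab ℓ)).trans
      (Finset.sum_le_sum_of_subset_of_nonneg
        (Finset.filter_subset_filter _ Finset.Ioc_subset_Icc_self)
        fun p _ _ => by positivity))
    have h4 := hlen ℓ
    have h5 : t⁻¹ ≤ k * t⁻¹ := le_mul_of_one_le_left (by positivity) hk'
    have h6 := le_abs_self C
    rw [div_mul_eq_mul_div, mul_div_assoc]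
    exact mul_le_mul_of_nonneg_left (by linarith) hc.le
  refine (gam_almostPrimes_le hdisj (by positivity) hmass).trans ?_
  have hq : (k : ℝ) / (c / 2 * (k * t⁻¹)) = 2 / c * t := by
    field_simp
  rw [hq]
  have hle : 2 / c * t ≤ 1 := by
    rw [div_mul_eq_mul_div, div_le_one hc]
    linarith
  have hnonneg : 0 ≤ 2 / c * t := by positivity
  have hexp := Real.abs_exp_sub_one_le (x := 2 / c * t) (by rwa [abs_of_nonneg hnonneg])
  rw [abs_of_nonneg hnonneg] at hexp
  refine (le_abs_self _).trans (hexp.trans ?_)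
  calc 2 * (2 / c * t) = δ ^ (4.05 : ℝ) * (4 / c * δ ^ (0.05 : ℝ)) := by rw [hsplit]; ring
    _ ≤ δ ^ (4.05 : ℝ) * 1 := by
        refine mul_le_mul_of_nonneg_left ?_ h405.le
        rw [div_mul_eq_mul_div, div_le_one hc]
        linarith
    _ = _ := mul_one _
end
end
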